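/- arXiv:2103.14014 — 2 statements merged into one kernel-verified Lean document; each statement's English description precedes it below -/
import Mathlib

section
/- Fix a constant p > 1 − 1/e² with p < 1, and let u = 2/log b, so u < 1. Then for every ε > 0, P(|χ(G_{n,p}) − n/(α(n)−1)| ≤ ε·n/log² n) → 1 as n → ∞ through the set of integers n satisfying α₀(n) − α(n) ≥ u. In other words, for all n with α₀(n) − α(n) ≥ u, whp χ(G_{n,p}) = n/(α(n)−1) + o(n/log² n). -/
open Filter Real

/-- Number of edges of a graph on `Fin n`. -/
noncomputable def edgeCount {n : ℕ} (G : SimpleGraph (Fin n)) : ℕ := G.edgeSet.ncard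

/-- The probability that the binomial random graph `G_{n,p}` equals `G`. -/
noncomputable def gnpWeight (n : ℕ) (p : ℝ) (G : SimpleGraph (Fin n)) : ℝ :=
  p ^ edgeCount G * (1 - p) ^ (n.choose 2 - edgeCount G)

open scoped Classical in
/-- The probability that `G_{n,p}` lies in the set `A` of graphs. -/
noncomputable def gnpProb (n : ℕ) (p : ℝ) (A : Set (SimpleGraph (Fin n))) : ℝ :=
  ∑ G : SimpleGraph (Fin n), if G ∈ A then gnpWeight n p G else 0

/-- The chromatic number, as a natural number. -/
noncomputable def chrom {n : ℕ} (G : SimpleGraph (Fin n)) : ℕ := G.chromaticNumber.toNat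

/-- `α₀(n) = 2 log_b n − 2 log_b log_b n + 2 log_b (e/2) + 1`. -/
noncomputable def alpha0 (b : ℝ) (x : ℝ) : ℝ :=
  2 * Real.logb b x - 2 * Real.logb b (Real.logb b x) + 2 * Real.logb b (Real.exp 1 / 2) + 1

section SubsetAverage

variable {ε : Type*}

/-- The expectation of `f` at a random subset of `E` that contains each element independently with
probability `p`. -/
noncomputable def subsetAvg (p : ℝ) (E : Finset ε) (f : Finset ε → ℝ) : ℝ :=
  ∑ S ∈ E.powerset, p ^ S.card * (1 - p) ^ (E.card - S.card) * f S

variable {p : ℝ}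

lemma subsetAvg_empty (f : Finset ε → ℝ) : subsetAvg p ∅ f = f ∅ := by
  simp [subsetAvg]

lemma subsetAvg_congr {E : Finset ε} {f g : Finset ε → ℝ} (h : ∀ S ⊆ E, f S = g S) :
    subsetAvg p E f = subsetAvg p E g :=
  Finset.sum_congr rfl fun S hS => by rw [h S (Finset.mem_powerset.1 hS)]

lemma subsetAvg_mono (hp0 : 0 ≤ p) (hp1 : p ≤ 1) {E : Finset ε} {f g : Finset ε → ℝ}
    (h : ∀ S ⊆ E, f S ≤ g S) : subsetAvg p E f ≤ subsetAvg p E g :=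
  Finset.sum_le_sum fun S hS => mul_le_mul_of_nonneg_left (h S (Finset.mem_powerset.1 hS))
    (mul_nonneg (pow_nonneg hp0 _) (pow_nonneg (sub_nonneg.2 hp1) _))

lemma subsetAvg_const (E : Finset ε) (c : ℝ) : subsetAvg p E (fun _ => c) = c := by
  unfold subsetAvg
  rw [← Finset.sum_mul, Finset.sum_pow_mul_eq_add_pow]
  simp

lemma subsetAvg_sub (E : Finset ε) (f g : Finset ε → ℝ) :
    subsetAvg p E (fun S => f S - g S) = subsetAvg p E f - subsetAvg p E g := by
  simp [subsetAvg, mul_sub]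

lemma subsetAvg_add (E : Finset ε) (f g : Finset ε → ℝ) :
    subsetAvg p E (fun S => f S + g S) = subsetAvg p E f + subsetAvg p E g := by
  simp [subsetAvg, mul_add, Finset.sum_add_distrib]

lemma subsetAvg_mul_left (E : Finset ε) (c : ℝ) (f : Finset ε → ℝ) :
    subsetAvg p E (fun S => c * f S) = c * subsetAvg p E f := by
  simp only [subsetAvg, Finset.mul_sum]
  exact Finset.sum_congr rfl fun _ _ => by ring

lemma subsetAvg_sum {ι : Type*} (s : Finset ι) (E : Finset ε) (f : ι → Finset ε → ℝ) :
    subsetAvg p E (fun S => ∑ i ∈ s, f i S) = ∑ i ∈ s, subsetAvg p E (f i) := by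
  simp only [subsetAvg, Finset.mul_sum]
  exact Finset.sum_comm

lemma subsetAvg_markov (hp0 : 0 ≤ p) (hp1 : p ≤ 1) {E : Finset ε} {f : Finset ε → ℝ} {c : ℝ}
    (hc : 0 < c) (P : Finset ε → Prop) [DecidablePred P] (h0 : ∀ S, 0 ≤ f S)
    (h : ∀ S, P S → c ≤ f S) :
    subsetAvg p E (fun S => if P S then 1 else 0) ≤ subsetAvg p E f / c := by
  rw [le_div_iff₀ hc, mul_comm, ← subsetAvg_mul_left]
  refine subsetAvg_mono hp0 hp1 fun S _ => ?_
  split_ifs with hS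
  · simpa using h S hS
  · simpa using h0 S

lemma subsetAvg_second_moment (hp0 : 0 ≤ p) (hp1 : p ≤ 1) (E : Finset ε) (f : Finset ε → ℝ)
    (P : Finset ε → Prop) [DecidablePred P] (h : ∀ S, ¬ P S → f S = 0) :
    (subsetAvg p E f) ^ 2 ≤
      subsetAvg p E (fun S => f S ^ 2) * subsetAvg p E (fun S => if P S then 1 else 0) := by
  have hw : ∀ S : Finset ε, 0 ≤ p ^ S.card * (1 - p) ^ (E.card - S.card) := fun S =>
    mul_nonneg (pow_nonneg hp0 _) (pow_nonneg (sub_nonneg.2 hp1) _)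
  have key := Finset.sum_mul_sq_le_sq_mul_sq E.powerset
    (fun S => √(p ^ S.card * (1 - p) ^ (E.card - S.card)) * f S)
    (fun S => √(p ^ S.card * (1 - p) ^ (E.card - S.card)) * (if P S then 1 else 0))
  have e1 : ∀ S : Finset ε, √(p ^ S.card * (1 - p) ^ (E.card - S.card)) * f S *
      (√(p ^ S.card * (1 - p) ^ (E.card - S.card)) * (if P S then 1 else 0)) =
      p ^ S.card * (1 - p) ^ (E.card - S.card) * f S := by
    intro S
    rw [mul_mul_mul_comm, Real.mul_self_sqrt (hw S)]
    split_ifs with hS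
    · simp
    · simp [h S hS]
  have e2 : ∀ S : Finset ε, (√(p ^ S.card * (1 - p) ^ (E.card - S.card)) * f S) ^ 2 =
      p ^ S.card * (1 - p) ^ (E.card - S.card) * f S ^ 2 := fun S => by
    rw [mul_pow, Real.sq_sqrt (hw S)]
  have e3 : ∀ S : Finset ε, (√(p ^ S.card * (1 - p) ^ (E.card - S.card)) *
      (if P S then 1 else 0)) ^ 2 =
      p ^ S.card * (1 - p) ^ (E.card - S.card) * (if P S then 1 else 0) := fun S => by
    rw [mul_pow, Real.sq_sqrt (hw S)]
    split_ifs <;> simp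
  simp_rw [e1, e2, e3] at key
  exact key

lemma abs_subsetAvg_sub_le (hp0 : 0 ≤ p) (hp1 : p ≤ 1) {E : Finset ε} {f g : Finset ε → ℝ} {c : ℝ}
    (h : ∀ S ⊆ E, |f S - g S| ≤ c) : |subsetAvg p E f - subsetAvg p E g| ≤ c := by
  rw [← subsetAvg_sub, abs_le]
  constructor
  · rw [← subsetAvg_const (p := p) E (-c)]
    exact subsetAvg_mono hp0 hp1 fun S hS => (abs_le.1 (h S hS)).1
  · conv_rhs => rw [← subsetAvg_const (p := p) E c]
    exact subsetAvg_mono hp0 hp1 fun S hS => (abs_le.1 (h S hS)).2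

lemma subsetAvg_exp_le_of_abs_le_one (hp0 : 0 ≤ p) (hp1 : p ≤ 1) {E : Finset ε}
    {f : Finset ε → ℝ} (h : ∀ S ⊆ E, |f S| ≤ 1) (h0 : subsetAvg p E f = 0) (θ : ℝ) :
    subsetAvg p E (fun S => exp (θ * f S)) ≤ exp (θ ^ 2 / 2) := by
  calc subsetAvg p E (fun S => exp (θ * f S))
      ≤ subsetAvg p E (fun S => cosh θ + sinh θ * f S) := by
        refine subsetAvg_mono hp0 hp1 fun S hS => ?_
        have := Real.exp_mul_le_cosh_add_mul_sinh (h S hS) θ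
        rw [mul_comm θ, mul_comm (sinh θ)]
        exact this
    _ = cosh θ := by rw [subsetAvg_add, subsetAvg_const, subsetAvg_mul_left, h0]; ring
    _ ≤ _ := Real.cosh_le_exp_half_sq θ

variable [DecidableEq ε]

lemma subsetAvg_insert {e : ε} {E : Finset ε} (he : e ∉ E) (f : Finset ε → ℝ) :
    subsetAvg p (insert e E) f =
      (1 - p) * subsetAvg p E f + p * subsetAvg p E (fun S => f (insert e S)) := by
  unfold subsetAvg
  rw [Finset.sum_powerset_insert he, Finset.mul_sum, Finset.mul_sum]
  congr 1
  · refine Finset.sum_congr rfl fun S hS => ?_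
    have hc := Finset.card_le_card (Finset.mem_powerset.1 hS)
    rw [Finset.card_insert_of_notMem he, Nat.succ_sub hc, pow_succ]
    ring
  · refine Finset.sum_congr rfl fun S hS => ?_
    have hn : e ∉ S := fun h => he (Finset.mem_powerset.1 hS h)
    rw [Finset.card_insert_of_notMem he, Finset.card_insert_of_notMem hn, Nat.succ_sub_succ,
      pow_succ]
    ring

lemma subsetAvg_union {A B : Finset ε} (h : Disjoint A B) (f : Finset ε → ℝ) :
    subsetAvg p (A ∪ B) f = subsetAvg p A (fun S => subsetAvg p B (fun T => f (S ∪ T))) := by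
  induction B using Finset.induction_on generalizing f with
  | empty => simp [subsetAvg_empty]
  | insert e B he ih =>
    rw [Finset.disjoint_insert_right] at h
    have hn : e ∉ A ∪ B := by simp [h.1, he]
    rw [Finset.union_insert, subsetAvg_insert hn, ih h.2, ih h.2, ← subsetAvg_mul_left,
      ← subsetAvg_mul_left, ← subsetAvg_add]
    refine subsetAvg_congr fun S _ => ?_
    rw [subsetAvg_insert he]
    simp [Finset.union_insert]

lemma subsetAvg_disjoint {E F : Finset ε} (h : F ⊆ E) :
    subsetAvg p E (fun S => if Disjoint S F then 1 else 0) = (1 - p) ^ F.card := by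
  have hE : E = (E \ F) ∪ F := (Finset.sdiff_union_of_subset h).symm
  rw [hE, subsetAvg_union Finset.sdiff_disjoint]
  have key : ∀ S ⊆ E \ F, subsetAvg p F (fun T => if Disjoint (S ∪ T) F then (1 : ℝ) else 0)
      = (1 - p) ^ F.card := by
    intro S hS
    unfold subsetAvg
    rw [Finset.sum_eq_single ∅]
    · have : Disjoint S F := Finset.disjoint_of_subset_left hS Finset.sdiff_disjoint
      simp [this]
    · intro T hT hne
      refine mul_eq_zero_of_right _ (if_neg ?_)
      intro hd
      have := (Finset.disjoint_union_left.1 hd).2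
      exact hne (Finset.disjoint_self_iff_empty _ |>.1
        (Finset.disjoint_of_subset_right (Finset.mem_powerset.1 hT) this))
    · simp
  rw [subsetAvg_congr key, subsetAvg_const]

/-- The bounded differences inequality, in moment generating function form. -/
lemma subsetAvg_exp_le_of_bounded_differences (hp0 : 0 ≤ p) (hp1 : p ≤ 1) {ι : Type*}
    [DecidableEq ι] (s : Finset ι) (B : ι → Finset ε) (hB : (s : Set ι).PairwiseDisjoint B)
    (f : Finset ε → ℝ)
    (hf : ∀ i ∈ s, ∀ S T T', T ⊆ B i → T' ⊆ B i → |f (S ∪ T) - f (S ∪ T')| ≤ 1) (θ : ℝ) :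
    subsetAvg p (s.biUnion B) (fun S => exp (θ * (f S - subsetAvg p (s.biUnion B) f))) ≤
      exp (s.card * (θ ^ 2 / 2)) := by
  induction s using Finset.induction_on generalizing f with
  | empty => simp [subsetAvg_empty]
  | insert i s hi ih =>
    have hd : Disjoint (s.biUnion B) (B i) := by
      rw [Finset.disjoint_biUnion_left]
      intro j hj
      exact hB (by simp [hj]) (by simp) (by rintro rfl; exact hi hj)
    rw [Finset.biUnion_insert, Finset.union_comm, subsetAvg_union hd, subsetAvg_union hd f]
    set g : Finset ε → ℝ := fun S => subsetAvg p (B i) (fun T => f (S ∪ T)) with hg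
    have hgf : ∀ S, subsetAvg p (B i) (fun T => exp (θ * (f (S ∪ T) - g S))) ≤
        exp (θ ^ 2 / 2) := by
      intro S
      refine subsetAvg_exp_le_of_abs_le_one hp0 hp1 (f := fun T => f (S ∪ T) - g S) ?_ ?_ θ
      · intro T hT
        have := abs_subsetAvg_sub_le hp0 hp1 (E := B i) (f := fun _ => f (S ∪ T))
          (g := fun T' => f (S ∪ T')) (c := 1)
          (fun T' hT' => hf i (by simp) S T T' hT hT')
        rwa [subsetAvg_const] at this
      · rw [subsetAvg_sub, subsetAvg_const, hg, sub_self]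
    have hih := ih (hB.subset (by simp)) g (by
      intro j hj S T T' hT hT'
      refine abs_subsetAvg_sub_le hp0 hp1 fun U _ => ?_
      rw [Finset.union_right_comm S T U, Finset.union_right_comm S T' U]
      exact hf j (by simp [hj]) _ _ _ hT hT')
    set m := subsetAvg p (s.biUnion B) g
    calc _ ≤ subsetAvg p (s.biUnion B) (fun S => exp (θ ^ 2 / 2) * exp (θ * (g S - m))) := by
          refine subsetAvg_mono hp0 hp1 fun S _ => ?_
          have : ∀ T, exp (θ * (f (S ∪ T) - m)) =
              exp (θ * (g S - m)) * exp (θ * (f (S ∪ T) - g S)) := by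
            intro T; rw [← Real.exp_add]; congr 1; ring
          simp_rw [this]
          rw [subsetAvg_mul_left, mul_comm]
          exact mul_le_mul_of_nonneg_right (hgf S) (Real.exp_pos _).le
      _ ≤ exp (θ ^ 2 / 2) * exp (s.card * (θ ^ 2 / 2)) := by
          rw [subsetAvg_mul_left]
          exact mul_le_mul_of_nonneg_left hih (Real.exp_pos _).le
      _ = _ := by
          rw [← Real.exp_add, Finset.card_insert_of_notMem hi]
          congr 1
          push_cast
          ring

/-- A function with bounded differences which is at most `k` with probability more than
`exp (-t² / 2N)` exceeds `k + 2t` with probability at most `exp (-t² / 2N)`. -/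
lemma subsetAvg_concentration (hp0 : 0 ≤ p) (hp1 : p ≤ 1) {ι : Type*}
    [DecidableEq ι] (s : Finset ι) (hs : s.Nonempty) (B : ι → Finset ε)
    (hB : (s : Set ι).PairwiseDisjoint B) (f : Finset ε → ℝ)
    (hf : ∀ i ∈ s, ∀ S T T', T ⊆ B i → T' ⊆ B i → |f (S ∪ T) - f (S ∪ T')| ≤ 1) {k t : ℝ}
    (ht : 0 < t)
    (hk : exp (-(t ^ 2 / (2 * s.card))) <
      subsetAvg p (s.biUnion B) (fun S => if f S ≤ k then 1 else 0)) :
    subsetAvg p (s.biUnion B) (fun S => if k + 2 * t ≤ f S then 1 else 0) ≤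
      exp (-(t ^ 2 / (2 * s.card))) := by
  have hN : (0 : ℝ) < s.card := by exact_mod_cast hs.card_pos
  set m := subsetAvg p (s.biUnion B) f with hm
  have tail : ∀ θ : ℝ, θ = t / s.card ∨ θ = -(t / s.card) → ∀ P : Finset ε → Prop,
      (∀ S, P S → t ^ 2 / s.card ≤ θ * (f S - m)) → [DecidablePred P] →
      subsetAvg p (s.biUnion B) (fun S => if P S then 1 else 0) ≤
        exp (-(t ^ 2 / (2 * s.card))) := by
    intro θ hθ P hP _
    have h1 := subsetAvg_markov hp0 hp1 (E := s.biUnion B) (Real.exp_pos (t ^ 2 / s.card)) P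
      (f := fun S => exp (θ * (f S - m))) (fun S => (Real.exp_pos _).le)
      (fun S hS => Real.exp_le_exp.2 (hP S hS))
    refine h1.trans ?_
    rw [div_le_iff₀ (Real.exp_pos _), ← Real.exp_add]
    refine (subsetAvg_exp_le_of_bounded_differences hp0 hp1 s B hB f hf θ).trans ?_
    apply Real.exp_le_exp.2
    have : θ ^ 2 = (t / s.card) ^ 2 := by rcases hθ with rfl | rfl <;> ring
    rw [this]
    apply le_of_eq
    field_simp
    ring
  have hmk : m ≤ k + t := by
    by_contra! hlt
    refine hk.not_ge ?_
    refine tail _ (Or.inr rfl) (fun S => f S ≤ k) fun S hS => ?_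
    rw [neg_mul, ← mul_neg, div_mul_eq_mul_div, sq]
    gcongr
    linarith
  refine tail _ (Or.inl rfl) (fun S => k + 2 * t ≤ f S) fun S hS => ?_
  rw [div_mul_eq_mul_div, sq]
  gcongr
  linarith

end SubsetAverage

section Pairs

variable {V : Type*} [DecidableEq V]

/-- The unordered pairs of distinct elements of `W`. -/
def pairs (W : Finset V) : Finset (Sym2 V) := W.offDiag.image (Function.uncurry Sym2.mk)

lemma mk_mem_pairs {W : Finset V} {x y : V} : s(x, y) ∈ pairs W ↔ x ∈ W ∧ y ∈ W ∧ x ≠ y := by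
  simp only [pairs, Finset.mem_image, Finset.mem_offDiag, Prod.exists, Function.uncurry]
  constructor
  · rintro ⟨a, c, ⟨ha, hc, hne⟩, h⟩
    rcases Sym2.eq_iff.1 h with ⟨rfl, rfl⟩ | ⟨rfl, rfl⟩
    · exact ⟨ha, hc, hne⟩
    · exact ⟨hc, ha, hne.symm⟩
  · rintro ⟨hx, hy, hne⟩
    exact ⟨x, y, ⟨hx, hy, hne⟩, rfl⟩

lemma card_pairs (W : Finset V) : (pairs W).card = W.card.choose 2 := Sym2.card_image_offDiag W

lemma pairs_mono {W W' : Finset V} (h : W ⊆ W') : pairs W ⊆ pairs W' := by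
  intro e
  induction e using Sym2.inductionOn with
  | _ x y =>
    rw [mk_mem_pairs, mk_mem_pairs]
    exact fun ⟨hx, hy, hne⟩ => ⟨h hx, h hy, hne⟩

lemma disjoint_pairs {W W' : Finset V} (h : Disjoint W W') : Disjoint (pairs W) (pairs W') := by
  rw [Finset.disjoint_left]
  intro e
  induction e using Sym2.inductionOn with
  | _ x y =>
    rw [mk_mem_pairs, mk_mem_pairs]
    exact fun ⟨hx, _, _⟩ ⟨hx', _, _⟩ => Finset.disjoint_left.1 h hx hx'

end Pairs

section RandomGraph

variable {n : ℕ} {p : ℝ}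

open scoped Classical in
lemma gnpProb_eq_subsetAvg (A : Set (SimpleGraph (Fin n))) :
    gnpProb n p A = subsetAvg p (pairs (Finset.univ : Finset (Fin n)))
      (fun S : Finset (Sym2 (Fin n)) =>
        if SimpleGraph.fromEdgeSet (S : Set (Sym2 (Fin n))) ∈ A then 1 else 0) := by
  have hdiag : ∀ S ⊆ pairs (Finset.univ : Finset (Fin n)),
      (SimpleGraph.fromEdgeSet (S : Set (Sym2 (Fin n)))).edgeSet = S := by
    intro S hS
    rw [SimpleGraph.edgeSet_fromEdgeSet]
    ext e
    induction e using Sym2.inductionOn with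
    | _ x y =>
      simp only [Set.mem_sdiff, Finset.mem_coe]
      refine ⟨fun h => h.1, fun h => ⟨h, ?_⟩⟩
      have := (mk_mem_pairs.1 (hS h)).2.2
      simpa using this
  have hec : ∀ S ⊆ pairs (Finset.univ : Finset (Fin n)),
      edgeCount (SimpleGraph.fromEdgeSet (S : Set (Sym2 (Fin n)))) = S.card := by
    intro S hS
    rw [edgeCount, hdiag S hS, Set.ncard_coe_finset]
  unfold gnpProb subsetAvg
  symm
  refine Finset.sum_bij' (fun S _ => SimpleGraph.fromEdgeSet (S : Set (Sym2 (Fin n))))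
    (fun G _ => G.edgeFinset) (fun _ _ => Finset.mem_univ _) ?_ ?_ ?_ ?_
  · intro G _
    rw [Finset.mem_powerset]
    intro e
    induction e using Sym2.inductionOn with
    | _ x y =>
      rw [SimpleGraph.mem_edgeFinset, SimpleGraph.mem_edgeSet, mk_mem_pairs]
      exact fun h => ⟨Finset.mem_univ _, Finset.mem_univ _, h.ne⟩
  · intro S hS
    rw [← Finset.coe_inj, SimpleGraph.coe_edgeFinset]
    exact hdiag S (Finset.mem_powerset.1 hS)
  · intro G _
    rw [SimpleGraph.coe_edgeFinset, SimpleGraph.fromEdgeSet_edgeSet]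
  · intro S hS
    have hS := Finset.mem_powerset.1 hS
    simp only [gnpWeight]
    rw [hec S hS, card_pairs, Finset.card_univ, Fintype.card_fin]
    split_ifs <;> simp

lemma gnpProb_mono (hp0 : 0 ≤ p) (hp1 : p ≤ 1) {A B : Set (SimpleGraph (Fin n))} (h : A ⊆ B) :
    gnpProb n p A ≤ gnpProb n p B := by
  classical
  rw [gnpProb_eq_subsetAvg, gnpProb_eq_subsetAvg]
  refine subsetAvg_mono hp0 hp1 fun S _ => ?_
  split_ifs with h1 h2 h2
  · rfl
  · exact absurd (h h1) h2
  · exact zero_le_one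
  · rfl

lemma gnpProb_le_one (hp0 : 0 ≤ p) (hp1 : p ≤ 1) (A : Set (SimpleGraph (Fin n))) :
    gnpProb n p A ≤ 1 := by
  classical
  rw [gnpProb_eq_subsetAvg]
  refine le_of_le_of_eq ?_ (subsetAvg_const (p := p) (pairs (Finset.univ : Finset (Fin n))) (1 : ℝ))
  refine subsetAvg_mono hp0 hp1 fun S _ => ?_
  split_ifs <;> norm_num

lemma one_sub_le_gnpProb (hp0 : 0 ≤ p) (hp1 : p ≤ 1) {A B C D : Set (SimpleGraph (Fin n))}
    (h : ∀ G, G ∉ B → G ∉ C → G ∉ D → G ∈ A) :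
    1 - gnpProb n p B - gnpProb n p C - gnpProb n p D ≤ gnpProb n p A := by
  classical
  suffices h1 : 1 ≤ gnpProb n p A + gnpProb n p B + gnpProb n p C + gnpProb n p D by linarith
  rw [gnpProb_eq_subsetAvg, gnpProb_eq_subsetAvg, gnpProb_eq_subsetAvg, gnpProb_eq_subsetAvg,
    ← subsetAvg_add, ← subsetAvg_add, ← subsetAvg_add]
  refine (subsetAvg_const (p := p) (pairs (Finset.univ : Finset (Fin n))) (1 : ℝ)).ge.trans ?_
  refine subsetAvg_mono hp0 hp1 fun S _ => ?_
  by_cases hA : SimpleGraph.fromEdgeSet (S : Set (Sym2 (Fin n))) ∈ A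
  · rw [if_pos hA]
    split_ifs <;> norm_num
  · rw [if_neg hA]
    by_cases hB : SimpleGraph.fromEdgeSet (S : Set (Sym2 (Fin n))) ∈ B
    · rw [if_pos hB]
      split_ifs <;> norm_num
    · by_cases hC : SimpleGraph.fromEdgeSet (S : Set (Sym2 (Fin n))) ∈ C
      · rw [if_pos hC]
        split_ifs <;> norm_num
      · rw [if_pos (by_contra fun hD => hA (h _ hB hC hD))]
        split_ifs <;> norm_num

lemma chrom_le_iff {G : SimpleGraph (Fin n)} {k : ℕ} : chrom G ≤ k ↔ G.Colorable k := by
  have hfin : G.chromaticNumber ≠ ⊤ :=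
    SimpleGraph.chromaticNumber_ne_top_iff_exists.2 ⟨_, G.colorable_of_fintype⟩
  rw [← SimpleGraph.chromaticNumber_le_iff_colorable, chrom, ← ENat.natCast_toNat hfin, Nat.cast_le,
    ENat.toNat_natCast]

lemma chrom_le_succ {G G' : SimpleGraph (Fin n)} {v : Fin n}
    (h : ∀ x y, x ≠ v → y ≠ v → G.Adj x y → G'.Adj x y) : chrom G ≤ chrom G' + 1 := by
  rw [chrom_le_iff]
  obtain ⟨C⟩ := chrom_le_iff.1 (le_refl (chrom G'))
  let D : G.Coloring (Option (Fin (chrom G'))) := SimpleGraph.Coloring.mk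
    (fun x => if x = v then none else some (C x)) (by
      intro x y hxy
      by_cases hx : x = v
      · have hy : y ≠ v := fun hy => hxy.ne (hx.trans hy.symm)
        simp [hx, hy]
      · by_cases hy : y = v
        · simp [hx, hy]
        · simpa [hx, hy] using C.valid (h x y hx hy hxy))
  simpa using D.colorable

open scoped Classical in
lemma gnpProb_chrom_concentration (hp0 : 0 ≤ p) (hp1 : p ≤ 1) (hn : 0 < n) {k t : ℝ} (ht : 0 < t)
    (hk : exp (-(t ^ 2 / (2 * n))) < gnpProb n p {G | (chrom G : ℝ) ≤ k}) :
    gnpProb n p {G | k + 2 * t ≤ (chrom G : ℝ)} ≤ exp (-(t ^ 2 / (2 * n))) := by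
  let B : Fin n → Finset (Sym2 (Fin n)) := fun v => (Finset.Iio v).image (fun u => s(u, v))
  have hBmem : ∀ v x y, s(x, y) ∈ B v ↔ (x < v ∧ y = v) ∨ (y < v ∧ x = v) := by
    intro v x y
    simp only [B, Finset.mem_image, Finset.mem_Iio]
    constructor
    · rintro ⟨u, hu, h⟩
      rcases Sym2.eq_iff.1 h with ⟨rfl, rfl⟩ | ⟨rfl, rfl⟩
      · exact Or.inl ⟨hu, rfl⟩
      · exact Or.inr ⟨hu, rfl⟩
    · rintro (⟨h, rfl⟩ | ⟨h, rfl⟩)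
      · exact ⟨x, h, rfl⟩
      · exact ⟨y, h, Sym2.eq_swap⟩
  have hE : pairs (Finset.univ : Finset (Fin n)) = Finset.univ.biUnion B := by
    ext e
    induction e using Sym2.inductionOn with
    | _ x y =>
      simp only [mk_mem_pairs, Finset.mem_univ, true_and, Finset.mem_biUnion, hBmem]
      constructor
      · intro h
        rcases lt_or_gt_of_ne h with h | h
        · exact ⟨y, Or.inl ⟨h, rfl⟩⟩
        · exact ⟨x, Or.inr ⟨h, rfl⟩⟩
      · rintro ⟨v, ⟨h, rfl⟩ | ⟨h, rfl⟩⟩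
        · exact h.ne
        · exact h.ne'
  have hdisj : ((Finset.univ : Finset (Fin n)) : Set (Fin n)).PairwiseDisjoint B := by
    intro v _ w _ hvw
    rw [Function.onFun, Finset.disjoint_left]
    intro e
    induction e using Sym2.inductionOn with
    | _ x y =>
      rw [hBmem, hBmem]
      rintro (⟨h, rfl⟩ | ⟨h, rfl⟩) (⟨h', h''⟩ | ⟨h', h''⟩)
      · exact hvw h''
      · subst h''
        exact absurd (h.trans h') (lt_irrefl _)
      · subst h''
        exact absurd (h.trans h') (lt_irrefl _)
      · exact hvw h''
  have hlip : ∀ v ∈ (Finset.univ : Finset (Fin n)), ∀ S T T' : Finset (Sym2 (Fin n)),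
      T ⊆ B v → T' ⊆ B v →
      |(chrom (SimpleGraph.fromEdgeSet ((S ∪ T : Finset _) : Set (Sym2 (Fin n)))) : ℝ) -
        chrom (SimpleGraph.fromEdgeSet ((S ∪ T' : Finset _) : Set (Sym2 (Fin n))))| ≤ 1 := by
    intro v _
    have key : ∀ S T T' : Finset (Sym2 (Fin n)), T ⊆ B v →
      (chrom (SimpleGraph.fromEdgeSet ((S ∪ T : Finset _) : Set (Sym2 (Fin n)))) : ℝ) ≤
        chrom (SimpleGraph.fromEdgeSet ((S ∪ T' : Finset _) : Set (Sym2 (Fin n)))) + 1 := by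
      intro S T T' hT
      have := chrom_le_succ (n := n)
        (G := SimpleGraph.fromEdgeSet ((S ∪ T : Finset _) : Set (Sym2 (Fin n))))
        (G' := SimpleGraph.fromEdgeSet ((S ∪ T' : Finset _) : Set (Sym2 (Fin n)))) (v := v) (by
          intro x y hx hy hxy
          rw [SimpleGraph.fromEdgeSet_adj, Finset.mem_coe, Finset.mem_union] at hxy ⊢
          refine ⟨Or.inl (hxy.1.resolve_right fun h => ?_), hxy.2⟩
          rcases (hBmem v x y).1 (hT h) with h | h
          · exact hy h.2
          · exact hx h.2)
      exact_mod_cast this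
    intro S T T' hT hT'
    rw [abs_le]
    constructor <;> linarith [key S T T' hT, key S T' T hT']
  rw [gnpProb_eq_subsetAvg] at hk ⊢
  have hcard : ((Finset.univ : Finset (Fin n)).card : ℝ) = n := by simp
  have := subsetAvg_concentration hp0 hp1 (Finset.univ : Finset (Fin n))
    (Finset.card_pos.1 (by simpa using hn)) B hdisj
    (fun S => (chrom (SimpleGraph.fromEdgeSet (S : Set (Sym2 (Fin n)))) : ℝ)) hlip ht (k := k)
  rw [hcard, ← hE] at this
  simp only [Set.mem_ofPred_eq] at hk ⊢
  convert this (by convert hk)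

end RandomGraph

section Tuples

variable {V : Type*} [DecidableEq V]

/-- The sum of `φ` over all sequences of pairwise disjoint subsets of `R` with prescribed sizes. -/
noncomputable def tupleSum : List ℕ → Finset V → (List (Finset V) → ℝ) → ℝ
  | [], _, φ => φ []
  | a :: as, R, φ => ∑ W ∈ R.powersetCard a, tupleSum as (R \ W) (fun l => φ (W :: l))

/-- `l` is a sequence of pairwise disjoint subsets of `R` with sizes `as`. -/
def IsTuple : List ℕ → Finset V → List (Finset V) → Prop
  | [], _, l => l = []
  | a :: as, R, l => ∃ W l', l = W :: l' ∧ W ∈ R.powersetCard a ∧ IsTuple as (R \ W) l'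

/-- The weighted number of sequences of pairwise disjoint subsets of `R` with prescribed sizes, the
weight of a sequence being the product of the weights of its terms. -/
noncomputable def prodSum : List (ℕ × (Finset V → ℝ)) → Finset V → ℝ
  | [], _ => 1
  | (a, ψ) :: l, R => ∑ W ∈ R.powersetCard a, ψ W * prodSum l (R \ W)

/-- All pairs inside the members of a list of sets. -/
def tupleEdges : List (Finset V) → Finset (Sym2 V)
  | [] => ∅
  | W :: l => pairs W ∪ tupleEdges l

lemma tupleSum_mono {as : List ℕ} {R : Finset V} {φ φ' : List (Finset V) → ℝ}
    (h : ∀ l, IsTuple as R l → φ l ≤ φ' l) : tupleSum as R φ ≤ tupleSum as R φ' := by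
  induction as generalizing R φ φ' with
  | nil => exact h [] rfl
  | cons a as ih =>
    exact Finset.sum_le_sum fun W hW => ih fun l hl => h _ ⟨W, l, rfl, hW, hl⟩

lemma tupleSum_congr {as : List ℕ} {R : Finset V} {φ φ' : List (Finset V) → ℝ}
    (h : ∀ l, IsTuple as R l → φ l = φ' l) : tupleSum as R φ = tupleSum as R φ' :=
  le_antisymm (tupleSum_mono fun l hl => (h l hl).le) (tupleSum_mono fun l hl => (h l hl).ge)

lemma tupleSum_mul_left (as : List ℕ) (R : Finset V) (c : ℝ) (φ : List (Finset V) → ℝ) :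
    tupleSum as R (fun l => c * φ l) = c * tupleSum as R φ := by
  induction as generalizing R φ with
  | nil => rfl
  | cons a as ih =>
    simp only [tupleSum, Finset.mul_sum]
    exact Finset.sum_congr rfl fun W _ => ih _ _

lemma subsetAvg_tupleSum {ε : Type*} (p : ℝ) (E : Finset ε) (as : List ℕ) (R : Finset V)
    (φ : Finset ε → List (Finset V) → ℝ) :
    subsetAvg p E (fun S => tupleSum as R (φ S)) =
      tupleSum as R (fun l => subsetAvg p E (fun S => φ S l)) := by
  induction as generalizing R φ with
  | nil => rfl
  | cons a as ih =>
    simp only [tupleSum]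
    rw [subsetAvg_sum]
    exact Finset.sum_congr rfl fun W _ => ih _ _

lemma tupleSum_prod (as : List ℕ) (R : Finset V) (ω : Finset V → ℝ) :
    tupleSum as R (fun l => (l.map ω).prod) = prodSum (as.map (·, ω)) R := by
  induction as generalizing R with
  | nil => simp [tupleSum, prodSum]
  | cons a as ih =>
    simp only [tupleSum, prodSum, List.map_cons, List.prod_cons]
    refine Finset.sum_congr rfl fun W _ => ?_
    rw [tupleSum_mul_left, ih]

lemma tupleSum_one (as : List ℕ) (R : Finset V) :
    tupleSum as R (fun _ => 1) * (as.map fun a => (a.factorial : ℝ)).prod =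
      R.card.descFactorial as.sum := by
  induction as generalizing R with
  | nil => simp [tupleSum]
  | cons a as ih =>
    simp only [tupleSum, List.map_cons, List.prod_cons, List.sum_cons]
    have key : ∀ W ∈ R.powersetCard a, tupleSum as (R \ W) (fun _ => 1) *
        (as.map fun a => (a.factorial : ℝ)).prod = ((R.card - a).descFactorial as.sum : ℝ) := by
      intro W hW
      rw [Finset.mem_powersetCard] at hW
      rw [ih, Finset.card_sdiff_of_subset hW.1, hW.2]
    have h2 : R.card.descFactorial (a + as.sum) =
        (R.card - a).descFactorial as.sum * R.card.descFactorial a := by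
      rw [← Nat.descFactorial_mul_descFactorial (Nat.le_add_right a as.sum), Nat.add_sub_cancel_left]
    rw [mul_left_comm, Finset.sum_mul, Finset.sum_congr rfl key, Finset.sum_const,
      Finset.card_powersetCard, h2, Nat.descFactorial_eq_factorial_mul_choose R.card a]
    push_cast
    rw [nsmul_eq_mul]
    ring

lemma IsTuple.subset {as : List ℕ} {R : Finset V} {l : List (Finset V)} (h : IsTuple as R l) :
    ∀ W ∈ l, W ⊆ R := by
  induction as generalizing R l with
  | nil =>
    obtain rfl : l = [] := h
    simp
  | cons a as ih =>
    obtain ⟨W, l', rfl, hW, hl⟩ := h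
    intro W' hW'
    rcases List.mem_cons.1 hW' with rfl | hW'
    · exact (Finset.mem_powersetCard.1 hW).1
    · exact (ih hl W' hW').trans Finset.sdiff_subset

lemma mem_tupleEdges {l : List (Finset V)} {e : Sym2 V} :
    e ∈ tupleEdges l ↔ ∃ W ∈ l, e ∈ pairs W := by
  induction l with
  | nil => simp [tupleEdges]
  | cons W l ih => simp [tupleEdges, ih]

lemma IsTuple.disjoint_tupleEdges {as : List ℕ} {R W : Finset V} {l : List (Finset V)}
    (h : IsTuple as (R \ W) l) : Disjoint (pairs W) (tupleEdges l) := by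
  rw [Finset.disjoint_left]
  intro e he hel
  obtain ⟨W', hW', he'⟩ := mem_tupleEdges.1 hel
  exact Finset.disjoint_left.1 (disjoint_pairs (Finset.disjoint_of_subset_right (h.subset W' hW')
    Finset.disjoint_sdiff)) he he'

lemma IsTuple.card_tupleEdges {as : List ℕ} {R : Finset V} {l : List (Finset V)}
    (h : IsTuple as R l) : (tupleEdges l).card = (as.map fun a => a.choose 2).sum := by
  induction as generalizing R l with
  | nil =>
    obtain rfl : l = [] := h
    rfl
  | cons a as ih =>
    obtain ⟨W, l', rfl, hW, hl⟩ := h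
    rw [tupleEdges, Finset.card_union_of_disjoint hl.disjoint_tupleEdges, ih hl, card_pairs,
      (Finset.mem_powersetCard.1 hW).2]
    simp

lemma IsTuple.card_inter_tupleEdges {as : List ℕ} {R : Finset V} {l : List (Finset V)}
    (h : IsTuple as R l) (F : Finset (Sym2 V)) :
    (tupleEdges l ∩ F).card = (l.map fun W => (pairs W ∩ F).card).sum := by
  induction as generalizing R l with
  | nil =>
    obtain rfl : l = [] := h
    simp [tupleEdges]
  | cons a as ih =>
    obtain ⟨W, l', rfl, hW, hl⟩ := h
    rw [tupleEdges, Finset.union_inter_distrib_right, Finset.card_union_of_disjoint, ih hl]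
    · simp
    · exact Finset.disjoint_of_subset_left Finset.inter_subset_left
        (Finset.disjoint_of_subset_right Finset.inter_subset_left hl.disjoint_tupleEdges)

lemma IsTuple.tupleEdges_subset {as : List ℕ} {R : Finset V} {l : List (Finset V)}
    (h : IsTuple as R l) : tupleEdges l ⊆ pairs R := by
  intro e he
  obtain ⟨W, hW, he⟩ := mem_tupleEdges.1 he
  exact pairs_mono (h.subset W hW) he

lemma exists_isTuple_of_tupleSum_ne_zero {as : List ℕ} {R : Finset V} {φ : List (Finset V) → ℝ}
    (h : tupleSum as R φ ≠ 0) : ∃ l, IsTuple as R l ∧ φ l ≠ 0 := by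
  by_contra! hc
  apply h
  rw [tupleSum_congr hc]
  have := tupleSum_mul_left as R 0 (fun _ => 0)
  simpa using this

open scoped Classical in
/-- The first moment of the number of sequences all of whose members are independent. -/
lemma subsetAvg_tupleSum_disjoint (p : ℝ) (as : List ℕ) (R : Finset V) :
    subsetAvg p (pairs R) (fun S => tupleSum as R
      (fun l => if Disjoint S (tupleEdges l) then 1 else 0)) =
      (1 - p) ^ (as.map fun a => a.choose 2).sum * tupleSum as R (fun _ => 1) := by
  rw [subsetAvg_tupleSum, ← tupleSum_mul_left]
  refine tupleSum_congr fun l hl => ?_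
  have := subsetAvg_disjoint (p := p) hl.tupleEdges_subset
  rw [hl.card_tupleEdges] at this
  rw [mul_one, ← this]

open scoped Classical in
/-- The second moment bound for the existence of a sequence of independent sets. -/
lemma one_le_mul_subsetAvg_exists_isTuple {p : ℝ} (hp0 : 0 ≤ p) (hp1 : p < 1) (as : List ℕ)
    (R : Finset V) (hR : as.sum ≤ R.card) {K : ℝ}
    (hK : ∀ l, IsTuple as R l → prodSum (as.map
      (·, fun W => (1 / (1 - p)) ^ (pairs W ∩ tupleEdges l).card)) R ≤
        tupleSum as R (fun _ => 1) * K) :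
    1 ≤ K * subsetAvg p (pairs R)
      (fun S => if ∃ l, IsTuple as R l ∧ Disjoint S (tupleEdges l) then 1 else 0) := by
  set N := tupleSum as R (fun _ => 1) with hN
  set Q := (as.map fun a => a.choose 2).sum with hQ
  have hq : 0 < 1 - p := by linarith
  have hNpos : 0 < N := by
    have h1 := tupleSum_one as R
    have h2 : (0 : ℝ) < R.card.descFactorial as.sum := by
      exact_mod_cast Nat.pos_of_ne_zero fun h => (Nat.descFactorial_eq_zero_iff_lt.1 h).not_ge hR
    have h3 : 0 < (as.map fun a => (a.factorial : ℝ)).prod := by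
      refine List.prod_pos fun x hx => ?_
      obtain ⟨a, _, rfl⟩ := List.mem_map.1 hx
      exact_mod_cast a.factorial_pos
    rw [← h1] at h2
    exact pos_of_mul_pos_left h2 h3.le
  set X : Finset (Sym2 V) → ℝ := fun S => tupleSum as R
      (fun l => if Disjoint S (tupleEdges l) then 1 else 0) with hX
  have hEX : subsetAvg p (pairs R) X = (1 - p) ^ Q * N := subsetAvg_tupleSum_disjoint p as R
  have hEX2 : subsetAvg p (pairs R) (fun S => X S ^ 2) ≤ ((1 - p) ^ Q) ^ 2 * N ^ 2 * K := by
    have h1 : ∀ S, X S ^ 2 = tupleSum as R (fun l => tupleSum as R (fun l' =>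
        if Disjoint S (tupleEdges l ∪ tupleEdges l') then 1 else 0)) := by
      intro S
      rw [sq]
      conv_lhs => rw [hX]
      simp only
      rw [← tupleSum_mul_left]
      refine tupleSum_congr fun l _ => ?_
      rw [mul_comm, ← tupleSum_mul_left]
      refine tupleSum_congr fun l' _ => ?_
      have hd := Finset.disjoint_union_right (s := S) (t := tupleEdges l) (u := tupleEdges l')
      by_cases h1 : Disjoint S (tupleEdges l) <;> by_cases h2 : Disjoint S (tupleEdges l') <;>
        simp [h1, h2, hd]
    simp only [h1]
    rw [subsetAvg_tupleSum]
    have h2 : ∀ l, IsTuple as R l → subsetAvg p (pairs R) (fun S => tupleSum as R (fun l' =>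
        if Disjoint S (tupleEdges l ∪ tupleEdges l') then 1 else 0)) ≤
          ((1 - p) ^ Q) ^ 2 * (N * K) * 1 := by
      intro l hl
      rw [mul_one]
      refine le_trans (le_of_eq ?_) (mul_le_mul_of_nonneg_left (hK l hl) (by positivity))
      rw [subsetAvg_tupleSum, ← tupleSum_prod, ← tupleSum_mul_left]
      refine tupleSum_congr fun l' hl' => ?_
      have h3 := subsetAvg_disjoint (p := p)
        (Finset.union_subset hl.tupleEdges_subset hl'.tupleEdges_subset)
      have h4 := Finset.card_union_add_card_inter (tupleEdges l) (tupleEdges l')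
      rw [hl.card_tupleEdges, hl'.card_tupleEdges, ← hQ] at h4
      have h5 : (l'.map fun W => (1 / (1 - p)) ^ (pairs W ∩ tupleEdges l).card).prod =
          (1 / (1 - p)) ^ (tupleEdges l ∩ tupleEdges l').card := by
        rw [Finset.inter_comm, hl'.card_inter_tupleEdges]
        clear h4 hl' h3
        induction l' with
        | nil => simp
        | cons W l' ih =>
          rw [List.map_cons, List.prod_cons, List.map_cons, List.sum_cons, pow_add, ih]
      rw [h5, ← pow_mul, mul_two, ← h4, pow_add, mul_assoc, ← mul_pow, mul_one_div_cancel hq.ne',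
        one_pow, mul_one, ← h3]
    refine (tupleSum_mono h2).trans (le_of_eq ?_)
    rw [tupleSum_mul_left, ← hN]
    ring
  have h := subsetAvg_second_moment hp0 hp1.le (pairs R) X
    (fun S => ∃ l, IsTuple as R l ∧ Disjoint S (tupleEdges l)) (by
      intro S hS
      by_contra hne
      obtain ⟨l, hl, h⟩ := exists_isTuple_of_tupleSum_ne_zero hne
      exact hS ⟨l, hl, by_contra fun hd => h (if_neg hd)⟩)
  rw [hEX] at h
  set P := subsetAvg p (pairs R)
      (fun S => if ∃ l, IsTuple as R l ∧ Disjoint S (tupleEdges l) then (1 : ℝ) else 0) with hP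
  have hP0 : 0 ≤ P := by
    refine le_of_eq_of_le (subsetAvg_const (p := p) (pairs R) (0 : ℝ)).symm ?_
    refine subsetAvg_mono hp0 hp1.le fun S _ => ?_
    split_ifs <;> norm_num
  have h3 := h.trans (mul_le_mul_of_nonneg_right hEX2 hP0)
  have hpos : 0 < ((1 - p) ^ Q * N) ^ 2 := by positivity
  refine le_of_mul_le_mul_left ?_ hpos
  rw [mul_one]
  calc _ ≤ _ := h3
    _ = _ := by ring

end Tuples

section Factorials

lemma succ_pow_le_exp_one_mul_pow (k : ℕ) : ((k : ℝ) + 1) ^ k ≤ exp 1 * (k : ℝ) ^ k := by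
  rcases Nat.eq_zero_or_pos k with rfl | hk
  · simp
  have hk' : (0 : ℝ) < k := by exact_mod_cast hk
  have h1 : (k : ℝ) + 1 ≤ k * exp (1 / k) := by
    have := Real.add_one_le_exp (1 / (k : ℝ))
    calc (k : ℝ) + 1 = k * (1 / k + 1) := by field_simp; ring
      _ ≤ _ := by gcongr
  calc ((k : ℝ) + 1) ^ k ≤ (k * exp (1 / k)) ^ k := by gcongr
    _ = exp 1 * (k : ℝ) ^ k := by
      rw [mul_pow, ← Real.exp_nat_mul, mul_one_div_cancel hk'.ne', mul_comm]

lemma pow_self_le_descFactorial (n T : ℕ) (hT : T ≤ n) :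
    (n : ℝ) ^ n ≤ n.descFactorial T * exp T * ((n - T : ℕ) : ℝ) ^ (n - T) := by
  induction T with
  | zero => simp
  | succ T ih =>
    refine (ih (by omega)).trans ?_
    obtain ⟨k, hk⟩ : ∃ k, n - T = k + 1 := ⟨n - T - 1, by omega⟩
    have hk' : n - (T + 1) = k := by omega
    rw [Nat.descFactorial_succ, hk, hk']
    push_cast
    rw [Real.exp_add]
    have := succ_pow_le_exp_one_mul_pow k
    calc (n.descFactorial T : ℝ) * exp T * ((k : ℝ) + 1) ^ (k + 1)
        = n.descFactorial T * exp T * ((k : ℝ) + 1) * ((k : ℝ) + 1) ^ k := by ring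
      _ ≤ n.descFactorial T * exp T * ((k : ℝ) + 1) * (exp 1 * (k : ℝ) ^ k) := by gcongr
      _ = _ := by ring

lemma pow_le_descFactorial_mul_exp (n T : ℕ) (hT : T ≤ n) :
    (n : ℝ) ^ T ≤ n.descFactorial T * exp (T ^ 2 / n) := by
  rcases Nat.eq_zero_or_pos n with rfl | hn
  · obtain rfl : T = 0 := by omega
    simp
  have hn' : (0 : ℝ) < n := by exact_mod_cast hn
  have h1 := pow_self_le_descFactorial n T hT
  have h2 : ((n - T : ℕ) : ℝ) ≤ n * exp (-(T / n)) := by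
    have := Real.add_one_le_exp (-((T : ℝ) / n))
    rw [Nat.cast_sub hT]
    calc (n : ℝ) - T = n * (-(T / n) + 1) := by field_simp; ring
      _ ≤ _ := by gcongr
  have h3 : ((n - T : ℕ) : ℝ) ^ (n - T) ≤ (n : ℝ) ^ (n - T) * exp (-(T / n) * (n - T)) := by
    calc ((n - T : ℕ) : ℝ) ^ (n - T) ≤ (n * exp (-(T / n))) ^ (n - T) := by gcongr
      _ = _ := by
        rw [mul_pow, ← Real.exp_nat_mul, Nat.cast_sub hT]
        ring_nf
  have h4 : (0 : ℝ) < (n : ℝ) ^ (n - T) := by positivity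
  refine le_of_mul_le_mul_right ?_ h4
  rw [← pow_add, Nat.add_sub_cancel' hT]
  refine h1.trans ((mul_le_mul_of_nonneg_left h3 (by positivity)).trans (le_of_eq ?_))
  have h5 : exp ((T : ℝ) ^ 2 / n) = exp T * exp (-(T / n) * (n - T)) := by
    rw [← Real.exp_add]
    congr 1
    field_simp
    ring
  rw [h5]
  ring

lemma descFactorial_le_pow_mul_exp (n T : ℕ) :
    (n.descFactorial T : ℝ) ≤ (n : ℝ) ^ T * exp (-(T * (T - 1) / (2 * n))) := by
  rcases Nat.eq_zero_or_pos n with rfl | hn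
  · have := Nat.descFactorial_le_pow 0 T
    simpa using (by exact_mod_cast this : ((Nat.descFactorial 0 T : ℕ) : ℝ) ≤ (0 : ℝ) ^ T)
  have hn' : (0 : ℝ) < n := by exact_mod_cast hn
  induction T with
  | zero => simp
  | succ T ih =>
    rw [Nat.descFactorial_succ]
    push_cast
    have h2 : ((n - T : ℕ) : ℝ) ≤ n * exp (-(T / n)) := by
      rcases le_or_gt T n with hT | hT
      · have := Real.add_one_le_exp (-((T : ℝ) / n))
        rw [Nat.cast_sub hT]
        calc (n : ℝ) - T = n * (-(T / n) + 1) := by field_simp; ring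
          _ ≤ _ := by gcongr
      · rw [Nat.sub_eq_zero_of_le hT.le]
        simp only [Nat.cast_zero]
        positivity
    calc ((n - T : ℕ) : ℝ) * n.descFactorial T
        ≤ (n * exp (-(T / n))) * ((n : ℝ) ^ T * exp (-(T * (T - 1) / (2 * n)))) := by gcongr
      _ = (n : ℝ) ^ (T + 1) * (exp (-(T / n)) * exp (-(T * (T - 1) / (2 * n)))) := by ring
      _ = _ := by
        rw [← Real.exp_add]
        congr 2
        field_simp
        ring

lemma factorial_le_mul_exp {a : ℕ} (ha : 0 < a) :
    (a.factorial : ℝ) ≤ a * exp 1 * ((a : ℝ) / exp 1) ^ a := by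
  induction a, ha using Nat.le_induction with
  | base => simp [Real.exp_ne_zero]
  | succ a ha ih =>
    rw [Nat.factorial_succ]
    have ha' : (0 : ℝ) < a := by exact_mod_cast ha
    push_cast
    have h1 : (a : ℝ) ^ (a + 1) * exp 1 ≤ ((a : ℝ) + 1) ^ (a + 1) := by
      have h2 : (a : ℝ) * exp (1 / (a + 1)) ≤ a + 1 := by
        have h3 := Real.add_one_le_exp (-(1 / ((a : ℝ) + 1)))
        have h4 : (a : ℝ) ≤ (a + 1) * exp (-(1 / ((a : ℝ) + 1))) := by
          calc (a : ℝ) = (a + 1) * (-(1 / ((a : ℝ) + 1)) + 1) := by field_simp; ring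
            _ ≤ _ := by gcongr
        calc (a : ℝ) * exp (1 / (a + 1))
            ≤ (a + 1) * exp (-(1 / ((a : ℝ) + 1))) * exp (1 / (a + 1)) := by gcongr
          _ = a + 1 := by rw [mul_assoc, ← Real.exp_add]; simp
      calc (a : ℝ) ^ (a + 1) * exp 1 = ((a : ℝ) * exp (1 / (a + 1))) ^ (a + 1) := by
            rw [mul_pow, ← Real.exp_nat_mul]
            congr 2
            push_cast
            field_simp
        _ ≤ _ := by gcongr
    calc ((a : ℝ) + 1) * a.factorial ≤ (a + 1) * (a * exp 1 * ((a : ℝ) / exp 1) ^ a) := by gcongr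
      _ = (a + 1) * ((a : ℝ) ^ (a + 1) * exp 1) / exp 1 ^ a := by
        rw [div_pow]
        ring
      _ ≤ (a + 1) * ((a : ℝ) + 1) ^ (a + 1) / exp 1 ^ a := by gcongr
      _ = _ := by
        rw [div_pow, pow_succ (exp 1)]
        field_simp

lemma pow_div_exp_le_factorial (a : ℕ) : ((a : ℝ) / exp 1) ^ a ≤ a.factorial := by
  have := pow_self_le_descFactorial a a le_rfl
  rw [Nat.descFactorial_self, Nat.sub_self, pow_zero, mul_one] at this
  rw [div_pow, div_le_iff₀ (by positivity), ← Real.exp_nat_mul, mul_one]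
  exact this

end Factorials

section ProdSum

variable {V : Type*} [DecidableEq V]

lemma prodSum_perm {l l' : List (ℕ × (Finset V → ℝ))} (h : l.Perm l') (R : Finset V) :
    prodSum l R = prodSum l' R := by
  induction h generalizing R with
  | nil => rfl
  | cons x _ ih =>
    obtain ⟨a, ψ⟩ := x
    simp only [prodSum, ih]
  | swap x y l =>
    obtain ⟨a, ψ⟩ := x
    obtain ⟨c, ψ'⟩ := y
    simp only [prodSum, Finset.mul_sum]
    rw [Finset.sum_comm' (t' := R.powersetCard a) (s' := fun W => (R \ W).powersetCard c)]
    · refine Finset.sum_congr rfl fun W _ => Finset.sum_congr rfl fun W' _ => ?_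
      rw [sdiff_right_comm]
      ring
    · intro W W'
      simp only [Finset.mem_powersetCard, Finset.subset_sdiff]
      have := disjoint_comm (a := W) (b := W')
      tauto
  | trans _ _ ih1 ih2 => rw [ih1, ih2]

lemma prodSum_add (a : ℕ) (ψ ψ' : Finset V → ℝ) (l : List (ℕ × (Finset V → ℝ))) (R : Finset V) :
    prodSum ((a, fun W => ψ W + ψ' W) :: l) R = prodSum ((a, ψ) :: l) R + prodSum ((a, ψ') :: l) R := by
  simp only [prodSum, add_mul, Finset.sum_add_distrib]

lemma prodSum_le_of_forall_sum_le {ω : Finset V → ℝ} (h0 : ∀ W, 0 ≤ ω W) {m : ℕ} {z : ℝ}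
    (hz : 0 ≤ z) (as : List ℕ)
    (h : ∀ a ∈ as, ∀ R : Finset V, a + m ≤ R.card →
      ∑ W ∈ R.powersetCard a, ω W ≤ R.card.choose a * z)
    (R : Finset V) (hR : as.sum + m ≤ R.card) :
    prodSum (as.map (·, ω)) R * (as.map fun a => (a.factorial : ℝ)).prod ≤
      R.card.descFactorial as.sum * (as.map fun _ => z).prod := by
  induction as generalizing R with
  | nil => simp [prodSum]
  | cons a as ih =>
    simp only [prodSum, List.map_cons, List.prod_cons, List.sum_cons] at hR ⊢
    have h1 := h a (by simp) R (by omega)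
    have h2 : R.card.descFactorial (a + as.sum) =
        (R.card - a).descFactorial as.sum * R.card.descFactorial a := by
      rw [← Nat.descFactorial_mul_descFactorial (Nat.le_add_right a as.sum), Nat.add_sub_cancel_left]
    have hz' : 0 ≤ (as.map fun _ => z).prod := List.prod_nonneg fun x hx => by
      obtain ⟨_, _, rfl⟩ := List.mem_map.1 hx
      exact hz
    calc (∑ W ∈ R.powersetCard a, ω W * prodSum (as.map (·, ω)) (R \ W)) *
          (a.factorial * (as.map fun a => (a.factorial : ℝ)).prod)
        = a.factorial * ∑ W ∈ R.powersetCard a, ω W * (prodSum (as.map (·, ω)) (R \ W) *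
            (as.map fun a => (a.factorial : ℝ)).prod) := by
          rw [mul_left_comm, Finset.sum_mul]
          simp only [mul_assoc]
      _ ≤ a.factorial * ∑ W ∈ R.powersetCard a, ω W *
            ((R.card - a).descFactorial as.sum * (as.map fun _ => z).prod) := by
          refine mul_le_mul_of_nonneg_left (Finset.sum_le_sum fun W hW =>
            mul_le_mul_of_nonneg_left ?_ (h0 W)) (by positivity)
          rw [Finset.mem_powersetCard] at hW
          have h3 : (R \ W).card = R.card - a := by rw [Finset.card_sdiff_of_subset hW.1, hW.2]
          rw [← h3]
          exact ih (fun a ha => h a (by simp [ha])) (R \ W) (by omega)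
      _ = a.factorial * (∑ W ∈ R.powersetCard a, ω W) *
            ((R.card - a).descFactorial as.sum * (as.map fun _ => z).prod) := by
          rw [← Finset.sum_mul]
          ring
      _ ≤ a.factorial * (R.card.choose a * z) *
            ((R.card - a).descFactorial as.sum * (as.map fun _ => z).prod) := by gcongr
      _ = _ := by
        rw [h2, Nat.descFactorial_eq_factorial_mul_choose R.card a]
        push_cast
        ring

lemma prodSum_append_le {ωb : Finset V → ℝ} (h0 : ∀ W, 0 ≤ ωb W) {β : ℕ → ℝ}
    (bs : List ℕ) (l : List (ℕ × (Finset V → ℝ))) (hβ : ∀ a ∈ bs, ∀ R : Finset V,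
      ∑ W ∈ R.powersetCard a, ωb W ≤ β a) {B : ℝ} (hB : 0 ≤ B) (R : Finset V)
    (hl : ∀ R', R' ⊆ R → R'.card = R.card - bs.sum → prodSum l R' ≤ B) :
    prodSum (bs.map (·, ωb) ++ l) R ≤ (bs.map β).prod * B := by
  have hβ0 : ∀ a ∈ bs, 0 ≤ β a := fun a ha =>
    (Finset.sum_nonneg fun W _ => h0 W).trans (hβ a ha ∅)
  induction bs generalizing R with
  | nil => simpa using hl R le_rfl (by simp)
  | cons a bs ih =>
    simp only [prodSum, List.map_cons, List.prod_cons, List.sum_cons, List.cons_append] at hl ⊢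
    have hp : 0 ≤ (bs.map β).prod := List.prod_nonneg fun x hx => by
      obtain ⟨c, hc, rfl⟩ := List.mem_map.1 hx
      exact hβ0 c (by simp [hc])
    calc ∑ W ∈ R.powersetCard a, ωb W * prodSum (bs.map (·, ωb) ++ l) (R \ W)
        ≤ ∑ W ∈ R.powersetCard a, ωb W * ((bs.map β).prod * B) := by
          refine Finset.sum_le_sum fun W hW => mul_le_mul_of_nonneg_left ?_ (h0 W)
          rw [Finset.mem_powersetCard] at hW
          have h3 : (R \ W).card = R.card - a := by rw [Finset.card_sdiff_of_subset hW.1, hW.2]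
          refine ih (fun c hc => hβ c (by simp [hc])) _ (fun R' hR' hc => hl R'
              (hR'.trans Finset.sdiff_subset) ?_) (fun c hc => hβ0 c (by simp [hc]))
          rw [hc, h3, Nat.sub_sub]
      _ ≤ _ := by
        rw [← Finset.sum_mul, mul_assoc]
        exact mul_le_mul_of_nonneg_right (hβ a (by simp) R) (mul_nonneg hp hB)

/-- If all terms can be split into two parts and there is a product bound for every pattern of
parts, then the bounds add up. -/
lemma prodSum_le_of_split {ωb ωs : Finset V → ℝ} {N : ℝ} {y z : ℕ → ℝ} {as : List ℕ}
    {R : Finset V}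
    (h : ∀ bs ss : List ℕ, (bs ++ ss).Perm as →
      prodSum (bs.map (·, ωb) ++ ss.map (·, ωs)) R ≤ N * (bs.map y).prod * (ss.map z).prod) :
    prodSum (as.map (·, fun W => ωb W + ωs W)) R ≤ N * (as.map fun a => y a + z a).prod := by
  have key : ∀ rest bs ss : List ℕ, (bs ++ (ss ++ rest)).Perm as →
      prodSum (rest.map (·, fun W => ωb W + ωs W) ++ (bs.map (·, ωb) ++ ss.map (·, ωs))) R ≤
        N * (bs.map y).prod * (ss.map z).prod * (rest.map fun a => y a + z a).prod := by
    intro rest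
    induction rest with
    | nil =>
      intro bs ss hp
      simpa using h bs ss (by simpa using hp)
    | cons a rest ih =>
      intro bs ss hp
      have h1 := ih (a :: bs) ss (List.Perm.trans (by
        rw [List.cons_append, ← List.append_assoc, ← List.append_assoc]
        exact List.perm_middle.symm) hp)
      have h2 := ih bs (a :: ss) (List.Perm.trans (by
        rw [List.cons_append]
        exact List.perm_middle.symm.append_left bs) hp)
      rw [List.map_cons, List.cons_append, prodSum_add]
      have e1 := prodSum_perm (List.perm_middle (l₁ := rest.map (·, fun W => ωb W + ωs W))
          (l₂ := bs.map (·, ωb) ++ ss.map (·, ωs)) (a := (a, ωb))) R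
      have e2 := prodSum_perm (((List.perm_middle (l₁ := bs.map (·, ωb))
          (l₂ := ss.map (·, ωs)) (a := (a, ωs))).append_left
          (rest.map (·, fun W => ωb W + ωs W))).trans List.perm_middle) R
      rw [← e1, ← e2]
      rw [List.map_cons, List.map_cons, List.prod_cons, List.cons_append] at h1
      rw [List.map_cons, List.map_cons, List.prod_cons] at h2
      rw [List.map_cons, List.prod_cons]
      refine (add_le_add h1 h2).trans (le_of_eq ?_)
      ring
  simpa using key as [] [] (by simp)

end ProdSum

section ProdSumBound

variable {V : Type*} [DecidableEq V]

lemma prodSum_le_tupleSum_mul {ωb ωs : Finset V → ℝ} (hb0 : ∀ W, 0 ≤ ωb W) (hs0 : ∀ W, 0 ≤ ωs W)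
    {R : Finset V} (hRpos : 0 < R.card) {as : List ℕ} {m : ℕ} {z : ℝ} (hz : 0 ≤ z) {β c : ℕ → ℝ}
    (hs : ∀ a ∈ as, ∀ R' : Finset V, a + m ≤ R'.card →
      ∑ W ∈ R'.powersetCard a, ωs W ≤ R'.card.choose a * z)
    (hb : ∀ a ∈ as, ∀ R' : Finset V, ∑ W ∈ R'.powersetCard a, ωb W ≤ β a)
    (hsum : as.sum + m ≤ R.card)
    (hc : ∀ bs ss : List ℕ, (bs ++ ss).Perm as →
      (bs.sum : ℝ) ^ 2 / R.card ≤ (bs.map c).sum) :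
    prodSum (as.map (·, fun W => ωb W + ωs W)) R ≤ tupleSum as R (fun _ => 1) *
      (as.map fun a => β a * a.factorial / (R.card : ℝ) ^ a * exp (c a) + z).prod := by
  set n := R.card with hn
  have hfac : ∀ l : List ℕ, 0 < (l.map fun a => (a.factorial : ℝ)).prod := fun l => by
    refine List.prod_pos fun x hx => ?_
    obtain ⟨a, _, rfl⟩ := List.mem_map.1 hx
    exact_mod_cast a.factorial_pos
  refine prodSum_le_of_split (y := fun a => β a * a.factorial / (n : ℝ) ^ a * exp (c a))
    (z := fun _ => z) fun bs ss hp => ?_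
  have hmem : ∀ a ∈ bs ++ ss, a ∈ as := fun a ha => hp.mem_iff.1 ha
  have hsum' : bs.sum + ss.sum = as.sum := by rw [← hp.sum_eq, List.sum_append]
  have hN : tupleSum as R (fun _ => 1) * ((bs.map fun a => (a.factorial : ℝ)).prod *
      (ss.map fun a => (a.factorial : ℝ)).prod) =
      (n - bs.sum).descFactorial ss.sum * n.descFactorial bs.sum := by
    have h1 := tupleSum_one as R
    rw [← (hp.map fun a => (a.factorial : ℝ)).prod_eq, List.map_append, List.prod_append,
      ← hsum', ← Nat.descFactorial_mul_descFactorial (Nat.le_add_right bs.sum ss.sum),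
      Nat.add_sub_cancel_left] at h1
    rw [h1]
    push_cast
    rfl
  set N := tupleSum as R (fun _ => 1)
  have hz' : ∀ l : List ℕ, 0 ≤ (l.map fun _ => z).prod := fun l => List.prod_nonneg fun x hx => by
    obtain ⟨_, _, rfl⟩ := List.mem_map.1 hx
    exact hz
  have hβ : ∀ a ∈ as, 0 ≤ β a := fun a ha =>
    (Finset.sum_nonneg fun W _ => hb0 W).trans (hb a ha ∅)
  have hβ' : 0 ≤ (bs.map β).prod := List.prod_nonneg fun x hx => by
    obtain ⟨a, ha, rfl⟩ := List.mem_map.1 hx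
    exact hβ a (hmem a (by simp [ha]))
  refine (prodSum_append_le hb0 bs _ (fun a ha => hb a (hmem a (by simp [ha])))
    (B := (n - bs.sum).descFactorial ss.sum * (ss.map fun _ => z).prod /
      (ss.map fun a => (a.factorial : ℝ)).prod) (div_nonneg (mul_nonneg (by positivity) (hz' ss))
      (hfac ss).le) R ?_).trans ?_
  · intro R' _ hR'
    rw [← hn] at hR'
    rw [le_div_iff₀ (hfac ss), ← hR']
    exact prodSum_le_of_forall_sum_le hs0 hz ss (fun a ha => hs a (hmem a (by simp [ha]))) R'
      (by omega)
  · have hy : (bs.map fun a => β a * a.factorial / (n : ℝ) ^ a * exp (c a)).prod * (n : ℝ) ^ bs.sum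
        = (bs.map β).prod * (bs.map fun a => (a.factorial : ℝ)).prod * exp (bs.map c).sum := by
      clear hN hβ' hsum' hp hmem
      induction bs with
      | nil => simp
      | cons a bs ih =>
        simp only [List.map_cons, List.prod_cons, List.sum_cons, pow_add, Real.exp_add]
        have hna : (n : ℝ) ^ a ≠ 0 := by positivity
        calc _ = β a * a.factorial * exp (c a) * ((n : ℝ) ^ a / (n : ℝ) ^ a) *
              ((bs.map fun a => β a * a.factorial / (n : ℝ) ^ a * exp (c a)).prod *
                (n : ℝ) ^ bs.sum) := by ring
          _ = _ := by
            rw [ih, div_self hna]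
            ring
    have h2 : (n : ℝ) ^ bs.sum ≤ n.descFactorial bs.sum * exp (bs.map c).sum := by
      refine (pow_le_descFactorial_mul_exp n bs.sum (by omega)).trans ?_
      gcongr
      exact hc bs ss hp
    have h3 : 0 < (n : ℝ) ^ bs.sum * ((bs.map fun a => (a.factorial : ℝ)).prod *
        (ss.map fun a => (a.factorial : ℝ)).prod) :=
      mul_pos (by positivity) (mul_pos (hfac bs) (hfac ss))
    refine le_of_mul_le_mul_right ?_ h3
    have hfb := hfac bs
    have hfs := hfac ss
    have hzs := hz' ss
    set Fb := (bs.map fun a => (a.factorial : ℝ)).prod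
    set Fs := (ss.map fun a => (a.factorial : ℝ)).prod
    set D : ℝ := ((n - bs.sum).descFactorial ss.sum : ℝ)
    have hD : 0 ≤ D := by positivity
    calc _ = (bs.map β).prod * D * (ss.map fun _ => z).prod * Fb * (n : ℝ) ^ bs.sum := by
          field_simp
      _ ≤ (bs.map β).prod * D * (ss.map fun _ => z).prod * Fb *
            (n.descFactorial bs.sum * exp (bs.map c).sum) := by gcongr
      _ = (D * n.descFactorial bs.sum) * ((bs.map β).prod * Fb * exp (bs.map c).sum) *
            (ss.map fun _ => z).prod := by ring
      _ = _ := by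
        rw [← hN, ← hy]
        ring

end ProdSumBound

section BoundedDegree

variable {V : Type*} [DecidableEq V]

/-- The neighbours of `v` in `T` with respect to the set `F` of pairs. -/
def nbrs (F : Finset (Sym2 V)) (T : Finset V) (v : V) : Finset V :=
  T.filter fun w => s(v, w) ∈ F

/-- All degrees inside `T` are at most `h`. -/
def DegLE (F : Finset (Sym2 V)) (h : ℕ) (T : Finset V) : Prop := ∀ v ∈ T, (nbrs F T v).card ≤ h

lemma pairs_insert_inter {F : Finset (Sym2 V)} {T : Finset V} {v : V} (hv : v ∉ T) :
    (pairs (insert v T) ∩ F).card = (pairs T ∩ F).card + (nbrs F T v).card := by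
  have h1 : pairs (insert v T) ∩ F = (pairs T ∩ F) ∪ (nbrs F T v).image (fun w => s(v, w)) := by
    ext e
    induction e using Sym2.inductionOn with
    | _ x y =>
      simp only [Finset.mem_inter, mk_mem_pairs, Finset.mem_insert, Finset.mem_union,
        Finset.mem_image, nbrs, Finset.mem_filter]
      constructor
      · rintro ⟨⟨rfl | hx, rfl | hy, hne⟩, hF⟩
        · exact absurd rfl hne
        · exact Or.inr ⟨y, ⟨hy, hF⟩, rfl⟩
        · exact Or.inr ⟨x, ⟨hx, by rwa [Sym2.eq_swap]⟩, Sym2.eq_swap⟩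
        · exact Or.inl ⟨⟨hx, hy, hne⟩, hF⟩
      · rintro (⟨⟨hx, hy, hne⟩, hF⟩ | ⟨w, ⟨hw, hF⟩, he⟩)
        · exact ⟨⟨Or.inr hx, Or.inr hy, hne⟩, hF⟩
        · rw [he] at hF
          rcases Sym2.eq_iff.1 he with ⟨rfl, rfl⟩ | ⟨rfl, rfl⟩
          · exact ⟨⟨Or.inl rfl, Or.inr hw, fun h => hv (h ▸ hw)⟩, hF⟩
          · exact ⟨⟨Or.inr hw, Or.inl rfl, fun h => hv (h ▸ hw)⟩, hF⟩
  rw [h1, Finset.card_union_of_disjoint, Finset.card_image_of_injective]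
  · intro a c hac
    rcases Sym2.eq_iff.1 hac with ⟨_, h⟩ | ⟨h, h'⟩
    · exact h
    · exact h'.trans h
  · rw [Finset.disjoint_left]
    intro e he he'
    obtain ⟨w, _, rfl⟩ := Finset.mem_image.1 he'
    exact hv (mk_mem_pairs.1 (Finset.mem_inter.1 he).1).1

lemma DegLE.mono {F : Finset (Sym2 V)} {h : ℕ} {T T' : Finset V} (hT : DegLE F h T')
    (hs : T ⊆ T') : DegLE F h T := fun v hv =>
  (Finset.card_le_card (Finset.filter_subset_filter _ hs)).trans (hT v (hs hv))

open scoped Classical in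
/-- The weighted number of `c`-subsets of `R` with all degrees at most `h`. -/
noncomputable def degSum (b : ℝ) (F : Finset (Sym2 V)) (h : ℕ) (R : Finset V) (c : ℕ) : ℝ :=
  ∑ T ∈ R.powersetCard c, if DegLE F h T then b ^ (pairs T ∩ F).card else 0

lemma succ_mul_degSum_succ_le {b : ℝ} (hb : 1 ≤ b) {F : Finset (Sym2 V)} {h r : ℕ} {R : Finset V}
    (hr : ∀ v, (nbrs F R v).card ≤ r) (c : ℕ) :
    (c + 1) * degSum b F h R (c + 1) ≤ degSum b F h R c * ((R.card - c) + c * r * b ^ h) := by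
  classical
  have hb0 : 0 ≤ b := zero_le_one.trans hb
  have h1 : (c + 1) * degSum b F h R (c + 1) = ∑ T ∈ R.powersetCard c, ∑ v ∈ R \ T,
      if DegLE F h (insert v T) then b ^ (pairs (insert v T) ∩ F).card else 0 := by
    rw [degSum, Finset.mul_sum]
    have h2 : ∀ W ∈ R.powersetCard (c + 1),
        (c + 1 : ℝ) * (if DegLE F h W then b ^ (pairs W ∩ F).card else 0) =
          ∑ v ∈ W, if DegLE F h W then b ^ (pairs W ∩ F).card else 0 := by
      intro W hW
      rw [Finset.sum_const, (Finset.mem_powersetCard.1 hW).2, nsmul_eq_mul]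
      push_cast
      rfl
    rw [Finset.sum_congr rfl h2, Finset.sum_sigma', Finset.sum_sigma']
    refine Finset.sum_bij' (fun x _ => ⟨x.1.erase x.2, x.2⟩) (fun x _ => ⟨insert x.2 x.1, x.2⟩)
      ?_ ?_ ?_ ?_ ?_
    · rintro ⟨W, v⟩ hx
      simp only [Finset.mem_sigma, Finset.mem_powersetCard, Finset.mem_sdiff] at hx ⊢
      refine ⟨⟨(Finset.erase_subset _ _).trans hx.1.1, ?_⟩, hx.1.1 hx.2, Finset.notMem_erase _ _⟩
      rw [Finset.card_erase_of_mem hx.2, hx.1.2, Nat.add_sub_cancel]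
    · rintro ⟨T, v⟩ hx
      simp only [Finset.mem_sigma, Finset.mem_powersetCard, Finset.mem_sdiff] at hx ⊢
      refine ⟨⟨Finset.insert_subset hx.2.1 hx.1.1, ?_⟩, Finset.mem_insert_self _ _⟩
      rw [Finset.card_insert_of_notMem hx.2.2, hx.1.2]
    · rintro ⟨W, v⟩ hx
      simp only [Finset.mem_sigma] at hx
      simp [Finset.insert_erase hx.2]
    · rintro ⟨T, v⟩ hx
      simp only [Finset.mem_sigma, Finset.mem_sdiff] at hx
      simp [Finset.erase_insert hx.2.2]
    · rintro ⟨W, v⟩ hx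
      simp only [Finset.mem_sigma] at hx
      simp [Finset.insert_erase hx.2]
  rw [h1, degSum, Finset.sum_mul]
  refine Finset.sum_le_sum fun T hT => ?_
  rw [Finset.mem_powersetCard] at hT
  by_cases hd : DegLE F h T
  · rw [if_pos hd]
    have h3 : ∀ v ∈ R \ T, (if DegLE F h (insert v T) then b ^ (pairs (insert v T) ∩ F).card else 0)
        ≤ b ^ (pairs T ∩ F).card * (1 + if (nbrs F T v).Nonempty then b ^ h else 0) := by
      intro v hv
      rw [Finset.mem_sdiff] at hv
      split_ifs with h4 h5 h5
      · rw [pairs_insert_inter hv.2, pow_add]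
        gcongr
        refine (pow_le_pow_right₀ hb ?_).trans (le_add_of_nonneg_left zero_le_one)
        refine (Finset.card_le_card ?_).trans (h4 v (Finset.mem_insert_self _ _))
        exact Finset.filter_subset_filter _ (Finset.subset_insert _ _)
      · rw [pairs_insert_inter hv.2, pow_add, Finset.not_nonempty_iff_eq_empty.1 h5]
        simp
      · positivity
      · positivity
    refine (Finset.sum_le_sum h3).trans ?_
    rw [← Finset.mul_sum]
    refine mul_le_mul_of_nonneg_left ?_ (by positivity)
    rw [Finset.sum_add_distrib, Finset.sum_const, Finset.card_sdiff_of_subset hT.1, hT.2,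
      ← Finset.sum_filter, Finset.sum_const, nsmul_eq_mul, nsmul_eq_mul, mul_one]
    have h6 : c ≤ R.card := hT.2 ▸ Finset.card_le_card hT.1
    rw [Nat.cast_sub h6]
    gcongr
    have h7 : (R \ T).filter (fun v => (nbrs F T v).Nonempty) ⊆ T.biUnion (fun w => nbrs F R w) := by
      intro v hv
      simp only [Finset.mem_filter, Finset.mem_sdiff] at hv
      obtain ⟨w, hw⟩ := hv.2
      rw [nbrs, Finset.mem_filter] at hw
      rw [Finset.mem_biUnion]
      refine ⟨w, hw.1, ?_⟩
      rw [nbrs, Finset.mem_filter, Sym2.eq_swap]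
      exact ⟨hv.1.1, hw.2⟩
    have h8 := (Finset.card_le_card h7).trans (Finset.card_biUnion_le_card_mul _ _ r fun w _ => hr w)
    rw [hT.2] at h8
    exact_mod_cast h8
  · rw [if_neg hd, zero_mul]
    refine le_of_eq (Finset.sum_eq_zero fun v hv => if_neg fun h4 => hd ?_)
    exact h4.mono (Finset.subset_insert _ _)

lemma degSum_le {b : ℝ} (hb : 1 ≤ b) {F : Finset (Sym2 V)} {h r a : ℕ} {R : Finset V}
    (hr : ∀ v, (nbrs F R v).card ≤ r) (ha : a ≤ R.card) {κ : ℝ} (hκ : 0 ≤ κ)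
    (hκa : a * r * b ^ h ≤ κ * (R.card - a)) {c : ℕ} (hc : c ≤ a) :
    degSum b F h R c ≤ R.card.choose c * (1 + κ) ^ c := by
  have hb0 : 0 ≤ b := zero_le_one.trans hb
  induction c with
  | zero =>
    simp only [degSum, Finset.powersetCard_zero, Finset.sum_singleton]
    split_ifs <;> simp [pairs]
  | succ c ih =>
    have h1 := succ_mul_degSum_succ_le (h := h) hb hr c
    have hca : (c : ℝ) + 1 ≤ a := by exact_mod_cast hc
    have haR : (a : ℝ) ≤ R.card := by exact_mod_cast ha
    have h2 : (R.card - c : ℝ) + c * r * b ^ h ≤ (R.card - c) * (1 + κ) := by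
      have : (c : ℝ) * r * b ^ h ≤ a * r * b ^ h := by
        gcongr
        linarith
      nlinarith
    have h3 : (R.card.choose (c + 1) : ℝ) * (c + 1) = R.card.choose c * (R.card - c) := by
      have := Nat.choose_succ_right_eq R.card c
      have h4 : ((R.card - c : ℕ) : ℝ) = R.card - c := Nat.cast_sub (by omega)
      rw [← h4]
      exact_mod_cast this
    have hpos : (0 : ℝ) < c + 1 := by positivity
    refine le_of_mul_le_mul_left ?_ hpos
    refine h1.trans ?_
    have h5 : (0 : ℝ) ≤ R.card - c := by linarith
    calc degSum b F h R c * ((R.card - c) + c * r * b ^ h)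
        ≤ (R.card.choose c * (1 + κ) ^ c) * ((R.card - c) * (1 + κ)) := by
          gcongr
          exact ih (by omega)
      _ = (R.card.choose c * (R.card - c)) * (1 + κ) ^ (c + 1) := by ring
      _ = _ := by
        rw [← h3]
        ring

end BoundedDegree

section BigOverlap

variable {V : Type*} [DecidableEq V]

lemma IsTuple.eq_of_mem {as : List ℕ} {R : Finset V} {l : List (Finset V)} (h : IsTuple as R l)
    {U U' : Finset V} (hU : U ∈ l) (hU' : U' ∈ l) {x : V} (hx : x ∈ U) (hx' : x ∈ U') : U = U' := by
  induction as generalizing R l with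
  | nil =>
    obtain rfl : l = [] := h
    simp at hU
  | cons a as ih =>
    obtain ⟨W, l', rfl, hW, hl⟩ := h
    rcases List.mem_cons.1 hU with h1 | h1 <;> rcases List.mem_cons.1 hU' with h2 | h2
    · rw [h1, h2]
    · exact absurd (h1 ▸ hx) (Finset.mem_sdiff.1 (hl.subset _ h2 hx')).2
    · exact absurd (h2 ▸ hx') (Finset.mem_sdiff.1 (hl.subset _ h1 hx)).2
    · exact ih hl h1 h2

lemma IsTuple.length_eq {as : List ℕ} {R : Finset V} {l : List (Finset V)} (h : IsTuple as R l) :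
    l.length = as.length := by
  induction as generalizing R l with
  | nil =>
    obtain rfl : l = [] := h
    rfl
  | cons a as ih =>
    obtain ⟨W, l', rfl, hW, hl⟩ := h
    simp [ih hl]

lemma IsTuple.card_mem {as : List ℕ} {R : Finset V} {l : List (Finset V)} (h : IsTuple as R l)
    {U : Finset V} (hU : U ∈ l) : U.card ∈ as := by
  induction as generalizing R l with
  | nil =>
    obtain rfl : l = [] := h
    simp at hU
  | cons a as ih =>
    obtain ⟨W, l', rfl, hW, hl⟩ := h
    rcases List.mem_cons.1 hU with rfl | hU
    · simp [(Finset.mem_powersetCard.1 hW).2]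
    · exact List.mem_cons_of_mem _ (ih hl hU)

lemma mk_mem_tupleEdges {l : List (Finset V)} {v w : V} :
    s(v, w) ∈ tupleEdges l ↔ ∃ U ∈ l, v ∈ U ∧ w ∈ U ∧ v ≠ w := by
  simp only [mem_tupleEdges, mk_mem_pairs]

lemma IsTuple.nbrs_subset {as : List ℕ} {R : Finset V} {l : List (Finset V)} (h : IsTuple as R l)
    {U : Finset V} (hU : U ∈ l) {v : V} (hv : v ∈ U) (T : Finset V) :
    nbrs (tupleEdges l) T v ⊆ T ∩ U := by
  intro w hw
  rw [nbrs, Finset.mem_filter, mk_mem_tupleEdges] at hw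
  obtain ⟨hwT, U', hU', hvU', hwU', _⟩ := hw
  rw [h.eq_of_mem hU hU' hv hvU']
  exact Finset.mem_inter.2 ⟨hwT, hwU'⟩

lemma exists_mem_of_nbrs_nonempty {l : List (Finset V)} {v : V} {T : Finset V}
    (h : (nbrs (tupleEdges l) T v).Nonempty) : ∃ U ∈ l, v ∈ U := by
  obtain ⟨w, hw⟩ := h
  rw [nbrs, Finset.mem_filter, mk_mem_tupleEdges] at hw
  obtain ⟨_, U, hU, hv, _⟩ := hw
  exact ⟨U, hU, hv⟩

lemma IsTuple.card_nbrs_le {as : List ℕ} {R : Finset V} {l : List (Finset V)} (h : IsTuple as R l)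
    {r : ℕ} (hr : ∀ a ∈ as, a ≤ r) (T : Finset V) (v : V) :
    (nbrs (tupleEdges l) T v).card ≤ r := by
  rcases (nbrs (tupleEdges l) T v).eq_empty_or_nonempty with h0 | h0
  · simp [h0]
  · obtain ⟨U, hU, hv⟩ := exists_mem_of_nbrs_nonempty h0
    exact ((Finset.card_le_card (h.nbrs_subset hU hv T)).trans
      (Finset.card_le_card Finset.inter_subset_right)).trans (hr _ (h.card_mem hU))

lemma IsTuple.card_pairs_inter_le {as : List ℕ} {R : Finset V} {l : List (Finset V)}
    (h : IsTuple as R l) {U : Finset V} (hU : U ∈ l) (W : Finset V) :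
    (pairs W ∩ tupleEdges l).card ≤
      (W ∩ U).card.choose 2 + (pairs (W \ U) ∩ tupleEdges l).card := by
  rw [← card_pairs]
  refine (Finset.card_le_card ?_).trans (Finset.card_union_le _ _)
  intro e
  induction e using Sym2.inductionOn with
  | _ x y =>
    simp only [Finset.mem_inter, Finset.mem_union, mk_mem_pairs, mk_mem_tupleEdges,
      Finset.mem_sdiff]
    rintro ⟨⟨hx, hy, hne⟩, U', hU', hxU', hyU', _⟩
    by_cases hxU : x ∈ U
    · obtain rfl := h.eq_of_mem hU hU' hxU hxU'
      exact Or.inl ⟨⟨hx, hxU⟩, ⟨hy, hyU'⟩, hne⟩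
    · have hyU : y ∉ U := fun hyU => hxU (h.eq_of_mem hU hU' hyU hyU' ▸ hxU')
      exact Or.inr ⟨⟨⟨hx, hxU⟩, ⟨hy, hyU⟩, hne⟩, U', hU', hxU', hyU', hne⟩

lemma IsTuple.exists_anchor {as : List ℕ} {R : Finset V} {l : List (Finset V)}
    (hl : IsTuple as R l) {W : Finset V} {h : ℕ} (hW : ¬ DegLE (tupleEdges l) h W) :
    ∃ U ∈ l, h ≤ (W ∩ U).card ∧ DegLE (tupleEdges l) (W.card / 2) (W \ U) := by
  obtain ⟨v, hvW, hv⟩ : ∃ v ∈ W, h < (nbrs (tupleEdges l) W v).card := by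
    by_contra! hc
    exact hW hc
  obtain ⟨U₀, hU₀, hvU₀⟩ := exists_mem_of_nbrs_nonempty (Finset.card_pos.1 (Nat.zero_lt_of_lt hv))
  have h1 := Finset.card_le_card (hl.nbrs_subset hU₀ hvU₀ W)
  obtain ⟨U, hU, hmax⟩ := l.toFinset.exists_max_image (fun U => (W ∩ U).card)
    ⟨U₀, List.mem_toFinset.2 hU₀⟩
  have hU' := List.mem_toFinset.1 hU
  refine ⟨U, hU', (hv.le.trans h1).trans (hmax U₀ (List.mem_toFinset.2 hU₀)), fun x hx => ?_⟩
  rcases (nbrs (tupleEdges l) (W \ U) x).eq_empty_or_nonempty with h0 | h0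
  · simp [h0]
  · obtain ⟨U', hU'l, hxU'⟩ := exists_mem_of_nbrs_nonempty h0
    have h2 := Finset.card_le_card (hl.nbrs_subset hU'l hxU' (W \ U))
    have h3 : ((W \ U) ∩ U').card ≤ (W ∩ U).card :=
      (Finset.card_le_card (Finset.inter_subset_inter_right Finset.sdiff_subset)).trans
        (hmax U' (List.mem_toFinset.2 hU'l))
    have h4 : ((W \ U) ∩ U').card ≤ (W \ U).card := Finset.card_le_card Finset.inter_subset_left
    have h5 := Finset.card_sdiff_add_card_inter W U
    omega

open scoped Classical in
lemma IsTuple.sum_not_degLE_le {b : ℝ} (hb : 1 ≤ b) {as : List ℕ} {R₀ : Finset V}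
    {l : List (Finset V)} (hl : IsTuple as R₀ l) {h a : ℕ} (R : Finset V) :
    ∑ W ∈ R.powersetCard a,
      (if DegLE (tupleEdges l) h W then 0 else b ^ (pairs W ∩ tupleEdges l).card) ≤
    ∑ U ∈ l.toFinset, ∑ i ∈ Finset.range (a + 1 - h),
      (U.card.choose (a - i) : ℝ) * b ^ (a - i).choose 2 *
        degSum b (tupleEdges l) (a / 2) R i := by
  have hb0 : 0 ≤ b := zero_le_one.trans hb
  set F := tupleEdges l with hF
  let g : (Σ _ : ℕ, Finset V × Finset V) → ℝ := fun x =>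
    b ^ (a - x.1).choose 2 * (if DegLE F (a / 2) x.2.2 then b ^ (pairs x.2.2 ∩ F).card else 0)
  have hg : ∀ x, 0 ≤ g x := fun x => by
    simp only [g]
    split_ifs <;> positivity
  let f : Finset V → Finset V → (Σ _ : ℕ, Finset V × Finset V) := fun U W =>
    ⟨a - (W ∩ U).card, (W ∩ U, W \ U)⟩
  have h1 : ∀ W ∈ R.powersetCard a, (if DegLE F h W then 0 else b ^ (pairs W ∩ F).card) ≤
      ∑ U ∈ l.toFinset, if h ≤ (W ∩ U).card then g (f U W) else 0 := by
    intro W hW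
    have hWa := (Finset.mem_powersetCard.1 hW).2
    have hnn : ∀ U ∈ l.toFinset, 0 ≤ if h ≤ (W ∩ U).card then g (f U W) else 0 := fun U _ => by
      split_ifs
      exacts [hg _, le_rfl]
    split_ifs with hd
    · exact Finset.sum_nonneg hnn
    · obtain ⟨U, hU, hhU, hdU⟩ := hl.exists_anchor hd
      refine le_trans ?_ (Finset.single_le_sum hnn (List.mem_toFinset.2 hU))
      rw [if_pos hhU]
      have h2 : (W ∩ U).card ≤ a := hWa ▸ Finset.card_le_card Finset.inter_subset_left
      rw [hWa] at hdU
      simp only [g, f]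
      rw [if_pos hdU, Nat.sub_sub_self h2, ← pow_add]
      exact pow_le_pow_right₀ hb (hl.card_pairs_inter_le hU W)
  refine (Finset.sum_le_sum h1).trans ?_
  rw [Finset.sum_comm]
  refine Finset.sum_le_sum fun U _ => ?_
  rw [← Finset.sum_filter]
  have hinj : Set.InjOn (f U) ((R.powersetCard a).filter fun W => h ≤ (W ∩ U).card) := by
    intro W _ W' _ hWW'
    simp only [f, Sigma.mk.injEq, heq_eq_eq, Prod.mk.injEq] at hWW'
    rw [← Finset.sdiff_union_inter W U, ← Finset.sdiff_union_inter W' U, hWW'.2.1, hWW'.2.2]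
  rw [← Finset.sum_image (f := g) hinj]
  have hsub : ((R.powersetCard a).filter fun W => h ≤ (W ∩ U).card).image (f U) ⊆
      (Finset.range (a + 1 - h)).sigma
        (fun i => U.powersetCard (a - i) ×ˢ R.powersetCard i) := by
    intro x hx
    obtain ⟨W, hW, rfl⟩ := Finset.mem_image.1 hx
    simp only [Finset.mem_filter, Finset.mem_powersetCard] at hW
    have h2 : (W ∩ U).card ≤ a := hW.1.2 ▸ Finset.card_le_card Finset.inter_subset_left
    have h3 := Finset.card_sdiff_add_card_inter W U
    simp only [f, Finset.mem_sigma, Finset.mem_range, Finset.mem_product, Finset.mem_powersetCard]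
    refine ⟨by omega, ⟨Finset.inter_subset_right, by omega⟩,
      Finset.sdiff_subset.trans hW.1.1, by omega⟩
  refine (Finset.sum_le_sum_of_subset_of_nonneg hsub fun x _ _ => hg x).trans (le_of_eq ?_)
  rw [Finset.sum_sigma]
  refine Finset.sum_congr rfl fun i _ => ?_
  rw [Finset.sum_product]
  simp only [g]
  rw [Finset.sum_const, Finset.card_powersetCard, ← Finset.mul_sum, nsmul_eq_mul, degSum, mul_assoc]

lemma sum_big_le {b : ℝ} (hb : 1 ≤ b) {n r a h : ℕ} (har : a ≤ r) (hr : 0 < r) (hh : 0 < h) {κ : ℝ}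
    (hκ : 0 ≤ κ) (hbig : (2 * (r * n * (1 + κ))) ^ 2 ≤ b ^ (a + h - 1)) :
    ∑ i ∈ Finset.range (a + 1 - h), (r.choose (a - i) : ℝ) * b ^ (a - i).choose 2 *
      (n.choose i * (1 + κ) ^ i) ≤ 2 * r ^ (r - a) * b ^ a.choose 2 := by
  have hb0 : 0 < b := zero_lt_one.trans_le hb
  set X : ℝ := r * n * (1 + κ) with hX
  have hX0 : 0 ≤ X := by positivity
  have h1 : ∀ i ∈ Finset.range (a + 1 - h), (r.choose (a - i) : ℝ) * b ^ (a - i).choose 2 *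
      (n.choose i * (1 + κ) ^ i) ≤ r ^ (r - a) * b ^ a.choose 2 * (1 / 2) ^ i := by
    intro i hi
    rw [Finset.mem_range] at hi
    have hia : i ≤ a := by omega
    have h2 : (r.choose (a - i) : ℝ) ≤ r ^ (r - a) * r ^ i := by
      rw [← pow_add, ← Nat.choose_symm (by omega : a - i ≤ r)]
      have : r - (a - i) = r - a + i := by omega
      rw [this]
      exact_mod_cast Nat.choose_le_pow r _
    have h3 : (n.choose i : ℝ) ≤ n ^ i := by exact_mod_cast Nat.choose_le_pow n i
    have h4 : (2 * X) ^ i * b ^ (a - i).choose 2 ≤ b ^ a.choose 2 := by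
      refine abs_le_of_sq_le_sq' ?_ (by positivity) |>.2
      rw [mul_pow, ← pow_mul, mul_comm i 2, pow_mul]
      have h5 : ((2 * X) ^ 2) ^ i ≤ (b ^ (a + (a - i) - 1)) ^ i := by
        gcongr
        refine hbig.trans (pow_le_pow_right₀ hb (by omega))
      refine (mul_le_mul_of_nonneg_right h5 (by positivity)).trans (le_of_eq ?_)
      rw [← pow_mul, ← pow_mul, ← pow_mul, ← pow_add]
      congr 1
      have e1 : ∀ k : ℕ, k.choose 2 * 2 = k * (k - 1) := fun k => by
        rw [Nat.choose_two_right]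
        exact Nat.div_mul_cancel (Nat.even_mul_pred_self k).two_dvd
      rw [e1, e1]
      obtain ⟨j, rfl⟩ : ∃ j, a = i + j := ⟨a - i, by omega⟩
      rw [Nat.add_sub_cancel_left]
      obtain ⟨k, rfl⟩ : ∃ k, j = k + 1 := ⟨j - 1, by omega⟩
      have e2 : i + (k + 1) + (k + 1) - 1 = i + 2 * k + 1 := by omega
      have e3 : i + (k + 1) - 1 = i + k := by omega
      rw [e2, e3, Nat.add_sub_cancel]
      ring
    calc (r.choose (a - i) : ℝ) * b ^ (a - i).choose 2 * (n.choose i * (1 + κ) ^ i)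
        ≤ r ^ (r - a) * r ^ i * b ^ (a - i).choose 2 * (n ^ i * (1 + κ) ^ i) := by gcongr
      _ = r ^ (r - a) * ((2 * X) ^ i * b ^ (a - i).choose 2) * (1 / 2) ^ i := by
        rw [hX, mul_pow, mul_pow, mul_pow, one_div, inv_pow]
        field_simp
      _ ≤ _ := by
        exact mul_le_mul_of_nonneg_right (mul_le_mul_of_nonneg_left h4 (by positivity))
          (by positivity)
  refine (Finset.sum_le_sum h1).trans ?_
  rw [← Finset.mul_sum]
  have h6 : ∑ i ∈ Finset.range (a + 1 - h), ((1 : ℝ) / 2) ^ i ≤ 2 := by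
    exact (summable_geometric_two.sum_le_tsum _ fun i _ => by positivity).trans_eq tsum_geometric_two
  calc _ ≤ (r : ℝ) ^ (r - a) * b ^ a.choose 2 * 2 := by gcongr
    _ = _ := by ring

end BigOverlap

section TupleVariance

variable {V : Type*} [DecidableEq V] [Fintype V]

lemma IsTuple.prodSum_le {b : ℝ} (hb : 1 ≤ b) {as : List ℕ} {R : Finset V}
    {l : List (Finset V)} (hl : IsTuple as R l) {n r m h : ℕ} (hn : Fintype.card V = n) (hn0 : 0 < n)
    (hlen : as.length ≤ n) (hr : ∀ a ∈ as, a ≤ r) (hr0 : 0 < r) (hh : 0 < h) {κ κ' : ℝ}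
    (hκ : 0 ≤ κ) (hκ' : 0 ≤ κ') (hκs : r * r * b ^ h ≤ κ * m)
    (hκb : ∀ a ∈ as, a ≤ n ∧ a * r * b ^ (a / 2) ≤ κ' * (n - a))
    (hbig : ∀ a ∈ as, (2 * (r * n * (1 + κ'))) ^ 2 ≤ b ^ (a + h - 1))
    (hsum : as.sum + m ≤ n) {c : ℕ → ℝ} (hc : ∀ bs ss : List ℕ, (bs ++ ss).Perm as →
      (bs.sum : ℝ) ^ 2 / n ≤ (bs.map c).sum) :
    prodSum (as.map (·, fun W => b ^ (pairs W ∩ tupleEdges l).card)) Finset.univ ≤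
      tupleSum as (Finset.univ : Finset V) (fun _ => 1) *
        (as.map fun a => n * (2 * r ^ (r - a) * b ^ a.choose 2) * a.factorial / (n : ℝ) ^ a *
          exp (c a) + (1 + κ) ^ r).prod := by
  classical
  have hb0 : 0 ≤ b := zero_le_one.trans hb
  have hun : (Finset.univ : Finset V).card = n := by rw [Finset.card_univ, hn]
  let F := tupleEdges l
  let ωb : Finset V → ℝ := fun W => if DegLE F h W then 0 else b ^ (pairs W ∩ F).card
  let ωs : Finset V → ℝ := fun W => if DegLE F h W then b ^ (pairs W ∩ F).card else 0
  have hω : (fun W => b ^ (pairs W ∩ tupleEdges l).card) = fun W => ωb W + ωs W := by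
    funext W
    simp only [ωb, ωs]
    split_ifs <;> simp [F]
  have hb' : ∀ W, 0 ≤ ωb W := fun W => by
    simp only [ωb]
    split_ifs <;> positivity
  have hs' : ∀ W, 0 ≤ ωs W := fun W => by
    simp only [ωs]
    split_ifs <;> positivity
  rw [hω]
  have key := prodSum_le_tupleSum_mul (R := Finset.univ) hb' hs' (by rw [hun]; exact hn0) (as := as)
    (m := m) (z := (1 + κ) ^ r) (by positivity)
    (β := fun a => n * (2 * r ^ (r - a) * b ^ a.choose 2)) (c := c) ?_ ?_ (by rw [hun]; exact hsum)
    (by rw [hun]; exact hc)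
  · rw [hun] at key
    exact key
  · intro a ha R' hR'
    have h1 := degSum_le hb (F := F) (h := h) (R := R') (r := r) (a := a) (κ := κ) (c := a)
      (fun v => hl.card_nbrs_le hr R' v) (by omega) hκ ?_ le_rfl
    · refine h1.trans (mul_le_mul_of_nonneg_left ?_ (by positivity))
      exact pow_le_pow_right₀ (by linarith) (hr a ha)
    · have h2 : (m : ℝ) ≤ R'.card - a := by
        rw [le_sub_iff_add_le]
        exact_mod_cast (by omega : m + a ≤ R'.card)
      have h3 : (a : ℝ) ≤ r := by exact_mod_cast hr a ha
      calc (a : ℝ) * r * b ^ h ≤ r * r * b ^ h := by gcongr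
        _ ≤ κ * m := hκs
        _ ≤ _ := by gcongr
  · intro a ha R'
    have h0 : ∑ W ∈ R'.powersetCard a, ωb W ≤ ∑ W ∈ (Finset.univ : Finset V).powersetCard a, ωb W :=
      Finset.sum_le_sum_of_subset_of_nonneg (Finset.powersetCard_mono (Finset.subset_univ _))
        fun W _ _ => hb' W
    refine h0.trans ((hl.sum_not_degLE_le hb Finset.univ).trans ?_)
    have h1 : ∀ U ∈ l.toFinset, (∑ i ∈ Finset.range (a + 1 - h),
        (U.card.choose (a - i) : ℝ) * b ^ (a - i).choose 2 * degSum b F (a / 2) Finset.univ i) ≤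
        2 * r ^ (r - a) * b ^ a.choose 2 := by
      intro U hU
      refine le_trans (Finset.sum_le_sum fun i hi => ?_)
        (sum_big_le hb (hr a ha) hr0 hh hκ' (hbig a ha))
      rw [Finset.mem_range] at hi
      have h2 : U.card ≤ r := hr _ (hl.card_mem (List.mem_toFinset.1 hU))
      have h3 : (U.card.choose (a - i) : ℝ) ≤ r.choose (a - i) := by
        exact_mod_cast Nat.choose_le_choose _ h2
      have h4 := degSum_le hb (F := F) (h := a / 2) (R := Finset.univ) (r := r) (a := a) (κ := κ')
        (c := i) (fun v => hl.card_nbrs_le hr _ v) (by rw [hun]; exact (hκb a ha).1) hκ'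
        (by rw [hun]; exact (hκb a ha).2) (by omega)
      rw [hun] at h4
      refine mul_le_mul (mul_le_mul_of_nonneg_right h3 (by positivity)) h4 ?_ (by positivity)
      rw [degSum]
      refine Finset.sum_nonneg fun W _ => ?_
      split_ifs <;> positivity
    refine (Finset.sum_le_sum h1).trans ?_
    rw [Finset.sum_const, nsmul_eq_mul]
    refine mul_le_mul_of_nonneg_right ?_ (by positivity)
    exact_mod_cast (List.toFinset_card_le l).trans (hl.length_eq.trans_le hlen)

end TupleVariance

section TwoSizes

lemma sum_map_eq_count {r s : ℕ} (hrs : r ≠ s) {l : List ℕ} (hl : ∀ a ∈ l, a = r ∨ a = s)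
    (f : ℕ → ℝ) : (l.map f).sum = l.count r * f r + l.count s * f s := by
  induction l with
  | nil => simp
  | cons a l ih =>
    have h := ih fun x hx => hl x (List.mem_cons_of_mem _ hx)
    rcases hl a List.mem_cons_self with h1 | h1 <;> subst h1
    · rw [List.map_cons, List.sum_cons, h, List.count_cons_self, List.count_cons_of_ne hrs]
      push_cast
      ring
    · rw [List.map_cons, List.sum_cons, h, List.count_cons_self, List.count_cons_of_ne hrs.symm]
      push_cast
      ring

lemma sq_sum_div_le_of_perm {n r s k₁ k₂ : ℕ} (hn : 0 < n) (hrs : r ≠ s) {δ : ℝ}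
    (h₁ : (k₁ * r : ℝ) ≤ (1 - δ) * n) (h₂ : k₁ * r + k₂ * s ≤ n) {bs ss : List ℕ}
    (h : (bs ++ ss).Perm (List.replicate k₁ r ++ List.replicate k₂ s)) :
    (bs.sum : ℝ) ^ 2 / n ≤ (bs.map fun a => if a = r then (1 - δ) * r else 2 * (a : ℝ)).sum := by
  have hmem : ∀ a ∈ bs, a = r ∨ a = s := fun a ha => by
    have := h.mem_iff.1 (List.mem_append_left ss ha)
    rw [List.mem_append, List.mem_replicate, List.mem_replicate] at this
    tauto
  have hr : bs.count r ≤ k₁ := by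
    have := h.count_eq r
    rw [List.count_append, List.count_append, List.count_replicate_self, List.count_replicate,
      if_neg (by simpa using hrs.symm)] at this
    omega
  have hs : bs.count s ≤ k₂ := by
    have := h.count_eq s
    rw [List.count_append, List.count_append, List.count_replicate_self, List.count_replicate,
      if_neg (by simpa using hrs)] at this
    omega
  have hsum : (bs.sum : ℝ) = bs.count r * r + bs.count s * s := by
    rw [← sum_map_eq_count hrs hmem fun a => (a : ℝ), Nat.cast_list_sum]
  rw [sum_map_eq_count hrs hmem, hsum, if_pos rfl, if_neg hrs.symm]
  have hn' : (0 : ℝ) < n := by exact_mod_cast hn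
  rw [div_le_iff₀ hn']
  have h3 : (bs.count r : ℝ) * r ≤ k₁ * r := by gcongr
  have h4 : (bs.count s : ℝ) * s ≤ k₂ * s := by gcongr
  have h5 : (k₁ * r + k₂ * s : ℝ) ≤ n := by exact_mod_cast h₂
  have h6 : (0 : ℝ) ≤ bs.count r * r := by positivity
  have h7 : (0 : ℝ) ≤ bs.count s * s := by positivity
  nlinarith [mul_nonneg h6 (sub_nonneg.2 (h3.trans h₁)),
    mul_nonneg h7 (by linarith : 0 ≤ (n : ℝ) - (bs.count r * r + bs.count s * s))]

variable {V : Type*} [DecidableEq V]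

lemma IsTuple.exists_coloring {as : List ℕ} {R : Finset V} {l : List (Finset V)}
    (h : IsTuple as R l) : ∃ f : V → ℕ, (∀ x ∈ R, f x < as.length + (R.card - as.sum)) ∧
      ∀ x ∈ R, ∀ y ∈ R, x ≠ y → f x = f y → s(x, y) ∈ tupleEdges l := by
  induction as generalizing R l with
  | nil =>
    refine ⟨fun x => if hx : x ∈ R then R.equivFin ⟨x, hx⟩ else 0, fun x hx => ?_,
      fun x hx y hy hne hxy => ?_⟩
    · simp [hx]
    · dsimp only at hxy
      rw [dif_pos hx, dif_pos hy] at hxy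
      have := R.equivFin.injective (Fin.ext hxy)
      exact absurd (Subtype.mk.inj this) hne
  | cons a as ih =>
    obtain ⟨W, l', rfl, hW, hl⟩ := h
    obtain ⟨f, hf, hf'⟩ := ih hl
    obtain ⟨hWR, hWa⟩ := Finset.mem_powersetCard.1 hW
    have hc := Finset.card_sdiff_add_card_eq_card hWR
    refine ⟨fun x => if x ∈ W then 0 else f x + 1, fun x hx => ?_, fun x hx y hy hne hxy => ?_⟩
    · rw [List.length_cons, List.sum_cons]
      dsimp only
      split_ifs with hxW
      · omega
      · have := hf x (Finset.mem_sdiff.2 ⟨hx, hxW⟩)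
        omega
    · rw [tupleEdges, Finset.mem_union, mk_mem_pairs]
      by_cases hxW : x ∈ W <;> by_cases hyW : y ∈ W
      · exact Or.inl ⟨hxW, hyW, hne⟩
      · simp [hxW, hyW] at hxy
      · simp [hxW, hyW] at hxy
      · simp only [hxW, hyW, if_false, Nat.add_right_cancel_iff] at hxy
        exact Or.inr (hf' x (Finset.mem_sdiff.2 ⟨hx, hxW⟩) y (Finset.mem_sdiff.2 ⟨hy, hyW⟩) hne hxy)

lemma IsTuple.colorable [Fintype V] {as : List ℕ} {l : List (Finset V)}
    (h : IsTuple as Finset.univ l) {S : Finset (Sym2 V)} (hS : Disjoint S (tupleEdges l)) :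
    (SimpleGraph.fromEdgeSet (S : Set (Sym2 V))).Colorable
      (as.length + (Fintype.card V - as.sum)) := by
  obtain ⟨f, hf, hf'⟩ := h.exists_coloring
  refine ⟨SimpleGraph.Coloring.mk (fun x => ⟨f x, hf x (Finset.mem_univ x)⟩) fun {x y} hxy he => ?_⟩
  rw [SimpleGraph.fromEdgeSet_adj] at hxy
  exact Finset.disjoint_left.1 hS hxy.1
    (hf' x (Finset.mem_univ x) y (Finset.mem_univ y) hxy.2 (Fin.mk.inj_iff.1 he))

end TwoSizes

lemma one_le_mul_gnpProb_chrom_le {p : ℝ} (hp0 : 0 ≤ p) (hp1 : p < 1) {n r s k₁ k₂ m h : ℕ}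
    (hn : 0 < n) (hs : 0 < s) (hsr : s < r) (hh : 0 < h) (hrn : r ≤ n) {κ κ' δ : ℝ} (hκ : 0 ≤ κ)
    (hκ' : 0 ≤ κ') (hκs : r * r * (1 / (1 - p)) ^ h ≤ κ * m)
    (hκb : r * r * (1 / (1 - p)) ^ (r / 2) ≤ κ' * (n - r))
    (hbig : (2 * (r * n * (1 + κ'))) ^ 2 ≤ (1 / (1 - p)) ^ (s + h - 1))
    (h₁ : (k₁ * r : ℝ) ≤ (1 - δ) * n) (h₂ : k₁ * r + k₂ * s + m ≤ n) :
    1 ≤ (n * (2 * (1 / (1 - p)) ^ r.choose 2) * r.factorial / (n : ℝ) ^ r * exp ((1 - δ) * r) +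
        (1 + κ) ^ r) ^ k₁ *
      (n * (2 * r ^ (r - s) * (1 / (1 - p)) ^ s.choose 2) * s.factorial / (n : ℝ) ^ s *
        exp (2 * s) + (1 + κ) ^ r) ^ k₂ *
      gnpProb n p {G | chrom G ≤ k₁ + k₂ + (n - (k₁ * r + k₂ * s))} := by
  classical
  set b := 1 / (1 - p) with hb
  have hq : 0 < 1 - p := by linarith
  have hb1 : 1 ≤ b := by
    rw [hb, le_div_iff₀ hq]
    linarith
  set as := List.replicate k₁ r ++ List.replicate k₂ s with has
  have hmem : ∀ a ∈ as, a = r ∨ a = s := fun a ha => by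
    rw [has, List.mem_append, List.mem_replicate, List.mem_replicate] at ha
    tauto
  have hsum : as.sum = k₁ * r + k₂ * s := by
    simp [has]
  have hlen : as.length = k₁ + k₂ := by
    simp [has]
  have hK := one_le_mul_subsetAvg_exists_isTuple (V := Fin n) hp0 hp1 as Finset.univ
    (by rw [hsum, Finset.card_univ, Fintype.card_fin]; omega) (K := _) fun l hl =>
      hl.prodSum_le (n := n) (r := r) (m := m) (h := h) (κ := κ) (κ' := κ') hb1
        (Fintype.card_fin n) hn ?_ ?_ (by omega) hh hκ hκ' hκs ?_ ?_ (by omega)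
        (fun bs ss hp => sq_sum_div_le_of_perm hn hsr.ne' h₁ (by omega) hp)
  · rw [has, List.map_append, List.prod_append, List.map_replicate, List.map_replicate,
      List.prod_replicate, List.prod_replicate, if_pos rfl, if_neg hsr.ne, Nat.sub_self, pow_zero,
      mul_one] at hK
    refine hK.trans (mul_le_mul_of_nonneg_left ?_ (by positivity))
    rw [gnpProb_eq_subsetAvg]
    refine subsetAvg_mono hp0 hp1.le fun S _ => ?_
    split_ifs with h1 h2
    · exact le_rfl
    · obtain ⟨l, hl, hS⟩ := h1
      refine absurd ?_ h2
      rw [Set.mem_ofPred_eq, chrom_le_iff]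
      have := hl.colorable hS
      rwa [Fintype.card_fin, hlen, hsum] at this
    · exact zero_le_one
    · exact le_rfl
  · rw [hlen]
    have e1 : k₁ ≤ k₁ * r := Nat.le_mul_of_pos_right _ (by omega)
    have e2 : k₂ ≤ k₂ * s := Nat.le_mul_of_pos_right _ hs
    omega
  · intro a ha
    rcases hmem a ha with h | h <;> omega
  · intro a ha
    have h3 : a ≤ r := by rcases hmem a ha with h | h <;> omega
    have h4 : (a : ℝ) ≤ r := by exact_mod_cast h3
    refine ⟨by omega, ?_⟩
    calc (a : ℝ) * r * b ^ (a / 2) ≤ r * r * b ^ (r / 2) := by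
          gcongr
      _ ≤ κ' * (n - r) := hκb
      _ ≤ _ := by gcongr
  · intro a ha
    have h3 : s ≤ a := by rcases hmem a ha with h | h <;> omega
    exact hbig.trans (pow_le_pow_right₀ hb1 (by omega))

lemma size_weight_le {b : ℝ} (hb : 0 < b) {n a : ℕ} (hn : 0 < n) (ha : 0 < a) {B : ℝ} (hB : 0 < B)
    (c : ℝ) : n * (2 * B * b ^ a.choose 2) * a.factorial / (n : ℝ) ^ a * exp (c * a) ≤
      exp (log n + log 2 + log B + 1 + log a +
        a * (log b * (a - 1) / 2 + log a - 1 - log n + c)) := by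
  have hn' : (0 : ℝ) < n := by exact_mod_cast hn
  have ha' : (0 : ℝ) < a := by exact_mod_cast ha
  have e1 : b ^ a.choose 2 = exp (a * (log b * (a - 1) / 2)) := by
    rw [← rpow_natCast, rpow_def_of_pos hb, Nat.cast_choose_two]
    ring_nf
  have e2 : (a / exp 1) ^ a = exp (a * (log a - 1)) := by
    rw [← rpow_natCast, rpow_def_of_pos (by positivity), log_div ha'.ne' (exp_pos _).ne', log_exp,
      mul_comm]
  have e3 : (n : ℝ) ^ a = exp (a * log n) := by
    rw [← rpow_natCast, rpow_def_of_pos hn', mul_comm]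
  have h1 := factorial_le_mul_exp ha
  rw [e2] at h1
  calc _ ≤ n * (2 * B * b ^ a.choose 2) * (a * exp 1 * exp (a * (log a - 1))) / (n : ℝ) ^ a *
        exp (c * a) := by gcongr
    _ = _ := by
      rw [e1, e3, div_eq_mul_inv, ← exp_neg]
      have e4 : log n + log 2 + log B + 1 + log a + a * (log b * (a - 1) / 2 + log a - 1 - log n + c) =
        log n + log 2 + log B + 1 + log a + a * (log b * (a - 1) / 2) + a * (log a - 1) +
          -(a * log n) + c * a := by ring
      rw [e4]
      simp only [exp_add, exp_log hn', exp_log ha', exp_log hB, exp_log (two_pos (α := ℝ))]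
      ring

lemma eventually_add_mul_log_le (C D : ℝ) {c : ℝ} (hc : 0 < c) :
    ∀ᶠ x : ℝ in atTop, C + D * log x ≤ c * x := by
  have h1 : (fun x : ℝ => C + D * log x) =o[atTop] (fun x : ℝ => x) := by
    refine Asymptotics.IsLittleO.add ?_ (isLittleO_log_id_atTop.const_mul_left D)
    exact (Asymptotics.isLittleO_const_id_atTop C)
  filter_upwards [h1.bound hc, eventually_ge_atTop 0] with x hx h0
  rw [norm_eq_abs, norm_eq_abs, abs_of_nonneg h0] at hx
  exact (le_abs_self _).trans hx

lemma weight_exponent_le_of_upper {lam x w ρ lr δ : ℝ} (hρ : 0 ≤ ρ) (hlr : lr ≤ w + log 2)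
    (h₁ : lam * ρ / 2 ≤ x - w - log 2) (h₂ : x - w + 1 - log 2 - lam / 2 ≤ lam * ρ / 2) :
    x + log 2 + 0 + 1 + lr + ρ * (lam * (ρ - 1) / 2 + lr - 1 - x + (1 - δ)) ≤
      2 * w + 3 * log 2 + lam / 2 - δ * ρ := by
  have h3 : lam * (ρ - 1) / 2 + lr - 1 - x + (1 - δ) ≤ -(lam / 2) - δ := by linarith
  have h4 := mul_le_mul_of_nonneg_left h3 hρ
  linarith

lemma weight_exponent_le_of_lower {lam x w ρ lr ls : ℝ} (hlam : 2 < lam) (hρ : 2 ≤ ρ)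
    (hlr : lr ≤ w + log 2) (hls : ls ≤ lr)
    (h₁ : lam * ρ / 2 ≤ x - w - log 2) (h₂ : x - w + 1 - log 2 - lam / 2 ≤ lam * ρ / 2) :
    x + log 2 + 2 * lr + 1 + ls + (ρ - 2) * (lam * (ρ - 2 - 1) / 2 + ls - 1 - x + 2) ≤
      -x + 5 * w + 6 * log 2 + 3 * lam := by
  have h3 : lam * (ρ - 2 - 1) / 2 + ls - 1 - x + 2 ≤ -lam := by linarith
  have h4 := mul_le_mul_of_nonneg_left h3 (sub_nonneg.2 hρ)
  linarith

lemma exp_neg_lt_gnpProb_chrom_le {p : ℝ} (hp0 : 0 ≤ p) (hp1 : p < 1) {n r s k₁ k₂ m h : ℕ}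
    (hn : 0 < n) (hs : 0 < s) (hsr : s < r) (hh : 0 < h) (hrn : r ≤ n) {κ κ' δ : ℝ} (hκ : 0 ≤ κ)
    (hκ' : 0 ≤ κ') (hκs : r * r * (1 / (1 - p)) ^ h ≤ κ * m)
    (hκb : r * r * (1 / (1 - p)) ^ (r / 2) ≤ κ' * (n - r))
    (hbig : (2 * (r * n * (1 + κ'))) ^ 2 ≤ (1 / (1 - p)) ^ (s + h - 1))
    (h₁ : (k₁ * r : ℝ) ≤ (1 - δ) * n) (h₂ : k₁ * r + k₂ * s + m ≤ n) {ζ E : ℝ}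
    (hyr : n * (2 * (1 / (1 - p)) ^ r.choose 2) * r.factorial / (n : ℝ) ^ r * exp ((1 - δ) * r) ≤ ζ)
    (hys : n * (2 * r ^ (r - s) * (1 / (1 - p)) ^ s.choose 2) * s.factorial / (n : ℝ) ^ s *
      exp (2 * s) ≤ ζ) (hκζ : r * κ ≤ ζ) (hE : 2 * ζ * n < E) :
    exp (-E) < gnpProb n p {G | chrom G ≤ k₁ + k₂ + (n - (k₁ * r + k₂ * s))} := by
  have key := one_le_mul_gnpProb_chrom_le hp0 hp1 hn hs hsr hh hrn hκ hκ' hκs hκb hbig h₁ h₂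
  set P := gnpProb n p {G | chrom G ≤ k₁ + k₂ + (n - (k₁ * r + k₂ * s))}
  have hζ : 0 ≤ ζ := le_trans (by positivity) hκζ
  have hq : 0 < 1 - p := by linarith
  have hz : (1 + κ) ^ r ≤ exp ζ := by
    calc (1 + κ) ^ r ≤ exp κ ^ r := by
          gcongr
          linarith [add_one_le_exp κ]
      _ = exp (r * κ) := by rw [← exp_nat_mul]
      _ ≤ exp ζ := exp_le_exp.2 hκζ
  have hy : ∀ y ≤ ζ, y + (1 + κ) ^ r ≤ exp (2 * ζ) := fun y hy => by
    have h3 : 1 ≤ exp ζ := one_le_exp hζ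
    have h4 : ζ + 1 ≤ exp ζ := add_one_le_exp ζ
    rw [two_mul, exp_add]
    nlinarith
  have hk : k₁ + k₂ ≤ n := by
    have e1 : k₁ ≤ k₁ * r := Nat.le_mul_of_pos_right _ (by omega)
    have e2 : k₂ ≤ k₂ * s := Nat.le_mul_of_pos_right _ hs
    omega
  have hP0 : 0 ≤ P := by
    by_contra! hP
    refine absurd key (not_le.2 (lt_of_le_of_lt ?_ zero_lt_one))
    refine mul_nonpos_of_nonneg_of_nonpos ?_ hP.le
    positivity
  have hK : 1 ≤ exp (2 * ζ * n) * P := by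
    refine key.trans (mul_le_mul_of_nonneg_right ?_ hP0)
    calc _ ≤ exp (2 * ζ) ^ k₁ * exp (2 * ζ) ^ k₂ := by
          refine mul_le_mul (pow_le_pow_left₀ (by positivity) (hy _ hyr) _)
            (pow_le_pow_left₀ (by positivity) (hy _ hys) _) (by positivity) (by positivity)
      _ ≤ exp (2 * ζ) ^ n := by
        rw [← pow_add]
        exact pow_le_pow_right₀ (one_le_exp (by positivity)) hk
      _ = exp (2 * ζ * n) := by rw [← exp_nat_mul, mul_comm]
  have h5 : exp (-(2 * ζ * n)) ≤ P := by
    rw [exp_neg, inv_le_iff_one_le_mul₀ (exp_pos _), mul_comm]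
    exact hK
  exact lt_of_lt_of_le (exp_lt_exp.2 (neg_lt_neg hE)) h5

lemma colors_le {n r k₁ k₂ m : ℕ} (hr : 4 ≤ r) {δ : ℝ} (hδ0 : 0 ≤ δ) (hδ : δ ≤ 1)
    (hm : (m : ℝ) ≤ δ * n) (hk₁ : k₁ = ⌊(1 - δ) * n / r⌋₊)
    (hk₂ : k₂ = ⌊(δ * n - m) / (r - 2 : ℕ)⌋₊) :
    (k₁ * r : ℝ) ≤ (1 - δ) * n ∧ k₁ * r + k₂ * (r - 2) + m ≤ n ∧
    ((k₁ + k₂ + (n - (k₁ * r + k₂ * (r - 2))) : ℕ) : ℝ) ≤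
      n / r + 4 * δ * n / (r : ℝ) ^ 2 + m + 2 * r := by
  have hr' : (4 : ℝ) ≤ r := by exact_mod_cast hr
  have hs : ((r - 2 : ℕ) : ℝ) = r - 2 := by
    rw [Nat.cast_sub (by omega)]
    norm_num
  have hr0 : (0 : ℝ) < r := by linarith
  have hs0 : (0 : ℝ) < (r - 2 : ℕ) := by
    rw [hs]
    linarith
  have hn0 : (0 : ℝ) ≤ n := n.cast_nonneg
  have a1 : (k₁ : ℝ) ≤ (1 - δ) * n / r := by
    rw [hk₁]
    exact Nat.floor_le (by have := sub_nonneg.2 hδ; positivity)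
  have a2 : (k₂ : ℝ) ≤ (δ * n - m) / (r - 2 : ℕ) := by
    rw [hk₂]
    exact Nat.floor_le (by have := sub_nonneg.2 hm; positivity)
  have b1 : (1 - δ) * n / r < k₁ + 1 := by
    rw [hk₁]
    exact Nat.lt_floor_add_one _
  have b2 : (δ * n - m) / (r - 2 : ℕ) < k₂ + 1 := by
    rw [hk₂]
    exact Nat.lt_floor_add_one _
  have a1' : (k₁ * r : ℝ) ≤ (1 - δ) * n := by rwa [le_div_iff₀ hr0] at a1
  have a2' : (k₂ * (r - 2 : ℕ) : ℝ) ≤ δ * n - m := by rwa [le_div_iff₀ hs0] at a2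
  rw [div_lt_iff₀ hr0] at b1
  rw [div_lt_iff₀ hs0] at b2
  have hle : k₁ * r + k₂ * (r - 2) + m ≤ n := by
    have : ((k₁ * r + k₂ * (r - 2) + m : ℕ) : ℝ) ≤ n := by
      push_cast
      linarith
    exact_mod_cast this
  refine ⟨a1', hle, ?_⟩
  rw [Nat.cast_add, Nat.cast_sub (by omega)]
  push_cast
  rw [hs] at a2 b2 ⊢
  have c1 : (δ * n - m) / (r - 2 : ℝ) ≤ δ * n / r + 4 * δ * n / (r : ℝ) ^ 2 := by
    rw [div_le_iff₀ (by linarith)]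
    have c2 : (δ * n / r + 4 * δ * n / (r : ℝ) ^ 2) * (r - 2 : ℝ) =
        δ * n + δ * n * (2 * r - 8) / (r : ℝ) ^ 2 := by
      field_simp
      ring
    rw [c2]
    have c3 : 0 ≤ δ * n * (2 * r - 8) / (r : ℝ) ^ 2 := by
      have : 0 ≤ 2 * (r : ℝ) - 8 := by linarith
      positivity
    have : (0 : ℝ) ≤ m := m.cast_nonneg
    linarith
  have c4 : (1 - δ) * n / r + δ * n / r = (n : ℝ) / r := by ring
  nlinarith

set_option maxHeartbeats 2000000 in
theorem eventually_gnpProb_chrom_ge_le {p : ℝ} (hp0 : 0 ≤ p) (hp1 : p < 1)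
    (hlam : 2 < log (1 / (1 - p))) {ε : ℝ} (hε : 0 < ε) : ∀ᶠ n : ℕ in atTop, ∀ r : ℕ,
      log (1 / (1 - p)) * r / 2 ≤ log n - log (log n / log (1 / (1 - p))) - log 2 →
      log n - log (log n / log (1 / (1 - p))) + 1 - log 2 - log (1 / (1 - p)) / 2 ≤
        log (1 / (1 - p)) * r / 2 →
      gnpProb n p {G | n / r + ε * n / log n ^ 2 ≤ (chrom G : ℝ)} ≤ exp (-log n) := by
  have hq : 0 < 1 - p := by linarith
  set b := 1 / (1 - p) with hbdef
  have hb0 : 0 < b := by positivity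
  set lam := log b with hlamdef
  have hlam0 : 0 < lam := by linarith
  obtain ⟨δ, hδ0, hδ1, hδε⟩ : ∃ δ : ℝ, 0 < δ ∧ δ ≤ 1 ∧ 4 * δ * lam ^ 2 ≤ ε / 2 := by
    refine ⟨min 1 (ε / (8 * lam ^ 2)), by positivity, min_le_left _ _, ?_⟩
    have := min_le_right 1 (ε / (8 * lam ^ 2))
    calc _ ≤ 4 * (ε / (8 * lam ^ 2)) * lam ^ 2 := by gcongr
      _ = ε / 2 := by
        field_simp
        norm_num
  have hbpow : ∀ k : ℕ, b ^ k = exp (lam * k) := fun k => by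
    rw [← rpow_natCast, rpow_def_of_pos hb0]
  have hb1 : 1 ≤ b := (one_le_div hq).2 (by linarith)
  have hlog : Tendsto (fun n : ℕ => log n) atTop atTop :=
    tendsto_log_atTop.comp tendsto_natCast_atTop_atTop
  filter_upwards [eventually_ge_atTop 1, hlog.eventually_ge_atTop 10,
    hlog.eventually_ge_atTop (4 * lam), hlog.eventually_ge_atTop (2 / δ),
    hlog.eventually_ge_atTop (8 / ε),
    hlog.eventually (eventually_add_mul_log_le lam 2 one_pos),
    hlog.eventually (eventually_add_mul_log_le 2 7 one_pos),
    hlog.eventually (eventually_add_mul_log_le lam 5 (c := 1 / 4) (by norm_num)),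
    hlog.eventually (eventually_add_mul_log_le (3 + 4 * lam) 8 (c := 1 / 4) (by norm_num)),
    hlog.eventually (eventually_add_mul_log_le (6 + 3 * lam) 12 one_pos),
    hlog.eventually (eventually_add_mul_log_le (3 + lam / 2) 9 (c := δ / lam) (by positivity))]
    with n hn1 hx10 hx4 hxδ hxε f1 f2 f3 f4 f5 f6 r h1 h2
  set x := log n with hx
  set Λ := log x with hΛ
  have hx0 : 0 < x := by linarith
  have hxe : x = exp Λ := (exp_log hx0).symm
  have hn0 : (0 : ℝ) < n := by exact_mod_cast hn1
  have hne : (n : ℝ) = exp x := (exp_log hn0).symm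
  have hΛ0 : 0 ≤ Λ := log_nonneg (by linarith)
  have l2 : log 2 < 0.6931471808 := log_two_lt_d9
  have l2' : 0.6931471803 < log 2 := log_two_gt_d9
  set w := log (x / lam) with hw
  have hw0 : 0 ≤ w := log_nonneg ((one_le_div hlam0).2 (by linarith))
  have hwΛ : w ≤ Λ := log_le_log (by positivity) (div_le_self hx0.le (by linarith))
  have hr0' : (0 : ℝ) ≤ r := r.cast_nonneg
  have hrx : (r : ℝ) ≤ x := by
    have := mul_le_mul_of_nonneg_right hlam.le hr0'
    linarith
  have hrl : x ≤ lam * r := by linarith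
  have hr4' : (4 : ℝ) ≤ r := by
    refine le_of_mul_le_mul_left ?_ hlam0
    linarith
  have hr4 : 4 ≤ r := by exact_mod_cast hr4'
  have hr0 : (0 : ℝ) < r := by linarith
  have hlr : log r ≤ w + log 2 := by
    rw [hw, ← log_mul (by positivity) (by norm_num)]
    refine log_le_log hr0 ?_
    rw [div_mul_eq_mul_div, le_div_iff₀ hlam0]
    linarith
  have hs : ((r - 2 : ℕ) : ℝ) = r - 2 := by
    rw [Nat.cast_sub (by omega)]
    norm_num
  have hls : log (r - 2 : ℝ) ≤ log r := log_le_log (by linarith) (by linarith)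
  have hpowx : ∀ k : ℕ, x ^ k = exp (k * Λ) := fun k => by
    rw [hxe, ← exp_nat_mul]
  have hx7n : 2 * x ^ 7 ≤ n := by
    rw [hne, hpowx, ← exp_log (two_pos (α := ℝ)), ← exp_add]
    refine exp_le_exp.2 ?_
    push_cast
    linarith
  have hx1 : 1 ≤ x := by linarith
  obtain ⟨m, hm⟩ : ∃ m, m = ⌈(n : ℝ) / x ^ 3⌉₊ := ⟨_, rfl⟩
  have hm1 : (n : ℝ) / x ^ 3 ≤ m := hm ▸ Nat.le_ceil _
  have hm2 : (m : ℝ) ≤ n / x ^ 3 + 1 := hm ▸ (Nat.ceil_lt_add_one (by positivity)).le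
  have h4n : 4 * x ≤ n / x ^ 3 := by
    rw [le_div_iff₀ (by positivity)]
    have : 10 ^ 3 ≤ x ^ 3 := by gcongr
    calc 4 * x * x ^ 3 = x ^ 4 * 4 := by ring
      _ ≤ x ^ 4 * (2 * x ^ 3) := mul_le_mul_of_nonneg_left (by linarith) (by positivity)
      _ = 2 * x ^ 7 := by ring
      _ ≤ n := hx7n
  have hmδ : (m : ℝ) ≤ δ * n := by
    have e1 : 2 ≤ δ * x := by rwa [div_le_iff₀ hδ0, mul_comm] at hxδ
    have e2 : (n : ℝ) / x ^ 3 ≤ δ * n / 2 := by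
      rw [div_le_iff₀ (by positivity)]
      have e3 : x ≤ x ^ 3 := le_self_pow₀ hx1 (by norm_num)
      have e4 : 2 ≤ δ * x ^ 3 := e1.trans (mul_le_mul_of_nonneg_left e3 hδ0.le)
      linarith [mul_le_mul_of_nonneg_left e4 hn0.le]
    linarith
  obtain ⟨k₁, hk₁⟩ : ∃ k, k = ⌊(1 - δ) * n / r⌋₊ := ⟨_, rfl⟩
  obtain ⟨k₂, hk₂⟩ : ∃ k, k = ⌊(δ * n - m) / (r - 2 : ℕ)⌋₊ := ⟨_, rfl⟩
  obtain ⟨c1, c2, c3⟩ := colors_le hr4 hδ0.le hδ1 hmδ hk₁ hk₂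
  obtain ⟨h, hh⟩ : ∃ h, h = ⌈x / (4 * lam)⌉₊ := ⟨_, rfl⟩
  have hh1 : x / 4 ≤ lam * h := by
    have : x / (4 * lam) ≤ h := hh ▸ Nat.le_ceil _
    rw [div_le_iff₀ (by positivity)] at this
    linarith
  have hh2 : lam * h ≤ x / 4 + lam := by
    have : (h : ℝ) ≤ x / (4 * lam) + 1 := hh ▸ (Nat.ceil_lt_add_one (by positivity)).le
    calc lam * h ≤ lam * (x / (4 * lam) + 1) := by gcongr
      _ = _ := by field_simp
  have hhpos : 0 < h := by
    rw [hh, Nat.ceil_pos]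
    positivity
  have hrn : (r : ℝ) ≤ n / 2 := by
    have : x ≤ x ^ 7 := le_self_pow₀ hx1 (by norm_num)
    linarith
  have hζ : (1 : ℝ) / x ^ 7 = exp (-(7 * Λ)) := by
    rw [hpowx, exp_neg, one_div]
    norm_num
  have key := exp_neg_lt_gnpProb_chrom_le hp0 hp1 (n := n) (r := r) (s := r - 2) (k₁ := k₁)
    (k₂ := k₂) (m := m) (h := h) (κ := exp (-(x / 2))) (κ' := x ^ 2) (δ := δ) (ζ := 1 / x ^ 7)
    (E := (n / x ^ 3) ^ 2 / (2 * n)) hn1 (by omega) (by omega) hhpos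
    (by
      have : (r : ℝ) ≤ n := by linarith
      exact_mod_cast this) (exp_pos _).le (by positivity) ?_ ?_ ?_ c1 c2 ?_ ?_ ?_ ?_
  · have hk := lt_of_lt_of_le key (gnpProb_mono hp0 hp1.le
      (B := {G | (chrom G : ℝ) ≤ n / r + 4 * δ * n / (r : ℝ) ^ 2 + m + 2 * r}) fun G hG =>
        (Nat.cast_le.2 hG).trans c3)
    have hconc := gnpProb_chrom_concentration hp0 hp1.le hn1 (t := n / x ^ 3) (by positivity) hk
    have hsub : {G : SimpleGraph (Fin n) | n / r + ε * n / x ^ 2 ≤ (chrom G : ℝ)} ⊆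
        {G | n / r + 4 * δ * n / (r : ℝ) ^ 2 + m + 2 * r + 2 * (n / x ^ 3) ≤ (chrom G : ℝ)} := by
      intro G (hG : n / r + ε * n / x ^ 2 ≤ (chrom G : ℝ))
      refine le_trans ?_ hG
      have e1 : 4 * δ * n / (r : ℝ) ^ 2 ≤ ε / 2 * n / x ^ 2 := by
        rw [div_le_div_iff₀ (by positivity) (by positivity)]
        calc 4 * δ * n * x ^ 2 ≤ 4 * δ * n * (lam * r) ^ 2 := by gcongr
          _ = 4 * δ * lam ^ 2 * (n * r ^ 2) := by ring
          _ ≤ ε / 2 * (n * r ^ 2) := by gcongr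
          _ = _ := by ring
      have e2 : 4 * ((n : ℝ) / x ^ 3) ≤ ε / 2 * n / x ^ 2 := by
        rw [← mul_div_assoc, div_le_div_iff₀ (by positivity) (by positivity)]
        rw [div_le_iff₀ hε] at hxε
        have e3 : 0 ≤ n * x ^ 2 := by positivity
        linarith [mul_le_mul_of_nonneg_left hxε e3]
      have e4 : ε * n / x ^ 2 = ε / 2 * n / x ^ 2 + ε / 2 * n / x ^ 2 := by ring
      linarith
    refine (gnpProb_mono hp0 hp1.le hsub).trans (hconc.trans (exp_le_exp.2 (neg_le_neg ?_)))
    rw [div_pow, div_div, le_div_iff₀ (by positivity)]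
    calc x * ((x ^ 3) ^ 2 * (2 * (n : ℝ))) = 2 * x ^ 7 * (n : ℝ) := by ring
      _ ≤ (n : ℝ) * n := by gcongr
      _ = _ := by ring
  · rw [hbpow]
    calc (r : ℝ) * r * exp (lam * h) ≤ x * x * exp (x / 4 + lam) := by gcongr
      _ ≤ exp (-(x / 2)) * (n / x ^ 3) := by
        rw [mul_div_assoc', le_div_iff₀ (by positivity), hne, ← exp_add]
        have : x * x * exp (x / 4 + lam) * x ^ 3 = exp (5 * Λ + (x / 4 + lam)) := by
          rw [exp_add (5 * Λ)]
          have := hpowx 5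
          push_cast at this
          rw [← this]
          ring
        rw [this]
        exact exp_le_exp.2 (by linarith)
      _ ≤ _ := by gcongr
  · rw [hbpow]
    have e1 : exp (lam * ((r / 2 : ℕ) : ℝ)) ≤ n / 2 := by
      have : ((r / 2 : ℕ) : ℝ) ≤ r / 2 := Nat.cast_div_le
      rw [hne, ← exp_log (two_pos (α := ℝ)), ← exp_sub]
      refine exp_le_exp.2 ?_
      linarith [mul_le_mul_of_nonneg_left this hlam0.le]
    calc (r : ℝ) * r * exp (lam * ((r / 2 : ℕ) : ℝ)) ≤ x * x * (n / 2) := by gcongr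
      _ ≤ x ^ 2 * (n - r) := by
        rw [← pow_two]
        exact mul_le_mul_of_nonneg_left (by linarith) (by positivity)
  · rw [hbpow]
    have e1 : 2 * (r * n * (1 + x ^ 2)) ≤ exp (2 * log 2 + 3 * Λ + x) := by
      have h3 := hpowx 3
      push_cast at h3
      rw [exp_add, exp_add, ← hne, ← h3, two_mul (log 2), exp_add, exp_log two_pos]
      have : 1 + x ^ 2 ≤ 2 * x ^ 2 := by
        have := one_le_pow₀ hx1 (n := 2)
        linarith
      calc 2 * (r * n * (1 + x ^ 2)) ≤ 2 * (x * n * (2 * x ^ 2)) := by gcongr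
        _ = _ := by ring
    calc (2 * (r * n * (1 + x ^ 2))) ^ 2 ≤ exp (2 * log 2 + 3 * Λ + x) ^ 2 := by gcongr
      _ = exp (2 * (2 * log 2 + 3 * Λ + x)) := by
        rw [← exp_nat_mul]
        norm_num
      _ ≤ _ := by
        refine exp_le_exp.2 ?_
        have e2 : ((r - 2 + h - 1 : ℕ) : ℝ) = r - 2 + h - 1 := by
          rw [Nat.cast_sub (by omega), Nat.cast_add, hs]
          norm_num
        rw [e2]
        linarith
  · have e := size_weight_le hb0 hn1 (a := r) (by omega) one_pos (1 - δ)
    rw [mul_one] at e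
    refine e.trans ?_
    rw [hζ, log_one]
    refine exp_le_exp.2 ((weight_exponent_le_of_upper hr0' hlr h1 h2).trans ?_)
    have : δ / lam * x ≤ δ * r := by
      rw [div_mul_eq_mul_div, div_le_iff₀ hlam0]
      linarith [mul_le_mul_of_nonneg_left hrl hδ0.le]
    linarith
  · have e := size_weight_le hb0 hn1 (a := r - 2) (by omega) (B := (r : ℝ) ^ 2) (by positivity) 2
    have e2 : r - (r - 2) = 2 := by omega
    rw [e2]
    refine e.trans ?_
    rw [hζ, log_pow, hs]
    refine exp_le_exp.2 (le_trans ?_ ((weight_exponent_le_of_lower hlam (by linarith) hlr hls h1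
      h2).trans ?_))
    · push_cast
      exact le_rfl
    · linarith
  · rw [hζ]
    calc (r : ℝ) * exp (-(x / 2)) ≤ exp Λ * exp (-(x / 2)) := by
          rw [← hxe]
          gcongr
      _ = exp (Λ + -(x / 2)) := (exp_add _ _).symm
      _ ≤ _ := exp_le_exp.2 (by linarith)
  · rw [div_pow, div_div, lt_div_iff₀ (by positivity)]
    have : 2 * (1 / x ^ 7) * n * ((x ^ 3) ^ 2 * (2 * n)) = n ^ 2 * (4 / x) := by
      field_simp
      ring
    rw [this]
    have h5 : 4 / x < 1 := (div_lt_one hx0).2 (by linarith)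
    exact mul_lt_of_lt_one_right (by positivity) h5

/-- The graphs containing `m` disjoint independent sets of size `a`. -/
def disjointIndepSets (n m a : ℕ) : Set (SimpleGraph (Fin n)) :=
  {G | ∃ F : Finset (Finset (Fin n)), F.card = m ∧ (∀ W ∈ F, W.card = a) ∧
    (∀ W ∈ F, ∀ x ∈ W, ∀ y ∈ W, ¬ G.Adj x y) ∧ ∀ W ∈ F, ∀ W' ∈ F, W ≠ W' → Disjoint W W'}

section FirstMoment

open scoped Classical in
lemma factorial_le_tupleSum {V : Type*} [DecidableEq V] {S : Finset (Sym2 V)} {a m : ℕ}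
    {F : Finset (Finset V)} {R : Finset V} (hF : F.card = m) (hFR : ∀ W ∈ F, W ∈ R.powersetCard a)
    (hS : ∀ W ∈ F, Disjoint S (pairs W)) (hd : ∀ W ∈ F, ∀ W' ∈ F, W ≠ W' → Disjoint W W') :
    (m.factorial : ℝ) ≤ tupleSum (List.replicate m a) R
      (fun l => if Disjoint S (tupleEdges l) then 1 else 0) := by
  induction m generalizing F R with
  | zero => simp [tupleSum, tupleEdges]
  | succ m ih =>
    rw [List.replicate_succ, tupleSum]
    have hnn : ∀ W ∈ R.powersetCard a, 0 ≤ tupleSum (List.replicate m a) (R \ W)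
        (fun l => if Disjoint S (tupleEdges (W :: l)) then 1 else 0) := fun W _ => by
      have := tupleSum_mono (as := List.replicate m a) (R := R \ W) (φ := fun _ => 0 * 1)
        (φ' := fun l => if Disjoint S (tupleEdges (W :: l)) then (1 : ℝ) else 0) fun l _ => by
          split_ifs <;> norm_num
      rwa [tupleSum_mul_left, zero_mul] at this
    refine le_trans ?_ (Finset.sum_le_sum_of_subset_of_nonneg (s := F) hFR fun W hW _ => hnn W hW)
    have h1 : ∀ W ∈ F, (m.factorial : ℝ) ≤ tupleSum (List.replicate m a) (R \ W)
        (fun l => if Disjoint S (tupleEdges (W :: l)) then 1 else 0) := by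
      intro W hW
      have h2 := ih (F := F.erase W) (R := R \ W) (by rw [Finset.card_erase_of_mem hW, hF]; rfl)
        (fun W' hW' => ?_) (fun W' hW' => hS W' (Finset.mem_of_mem_erase hW'))
        (fun W₁ h₁ W₂ h₂ => hd W₁ (Finset.mem_of_mem_erase h₁) W₂ (Finset.mem_of_mem_erase h₂))
      · refine h2.trans (tupleSum_mono fun l _ => ?_)
        have h3 : Disjoint S (tupleEdges (W :: l)) ↔ Disjoint S (tupleEdges l) := by
          rw [tupleEdges, Finset.disjoint_union_right]
          exact and_iff_right (hS W hW)
        simp only [h3]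
        exact le_rfl
      · have h3 := Finset.mem_powersetCard.1 (hFR W' (Finset.mem_of_mem_erase hW'))
        refine Finset.mem_powersetCard.2 ⟨Finset.subset_sdiff.2 ⟨h3.1, ?_⟩, h3.2⟩
        exact hd W' (Finset.mem_of_mem_erase hW') W hW (Finset.ne_of_mem_erase hW')
    refine le_trans (le_of_eq ?_) (Finset.sum_le_sum h1)
    rw [Finset.sum_const, hF, nsmul_eq_mul, Nat.factorial_succ]
    push_cast
    rfl

lemma gnpProb_disjointIndepSets_mul_le {p : ℝ} (hp0 : 0 ≤ p) (hp1 : p ≤ 1) (n m a : ℕ) :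
    gnpProb n p (disjointIndepSets n m a) * m.factorial * (a.factorial : ℝ) ^ m ≤
      (1 - p) ^ (m * a.choose 2) * n.descFactorial (m * a) := by
  classical
  set as := List.replicate m a with has
  have h1 := subsetAvg_tupleSum_disjoint p as (Finset.univ : Finset (Fin n))
  have h2 := tupleSum_one as (Finset.univ : Finset (Fin n))
  have e1 : (as.map fun a => (a.factorial : ℝ)).prod = (a.factorial : ℝ) ^ m := by simp [has]
  have e2 : (as.map fun a => a.choose 2).sum = m * a.choose 2 := by simp [has]
  have e3 : as.sum = m * a := by simp [has]
  rw [e1, e3, Finset.card_univ, Fintype.card_fin] at h2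
  rw [e2] at h1
  rw [← h2, ← mul_assoc, ← h1]
  refine mul_le_mul_of_nonneg_right ?_ (by positivity)
  rw [gnpProb_eq_subsetAvg, mul_comm, ← subsetAvg_mul_left]
  refine subsetAvg_mono hp0 hp1 fun S hS => ?_
  split_ifs with h
  · obtain ⟨F, hF, hFa, hFi, hFd⟩ := h
    rw [mul_one]
    refine factorial_le_tupleSum hF
      (fun W hW => Finset.mem_powersetCard.2 ⟨Finset.subset_univ _, hFa W hW⟩) (fun W hW => ?_) hFd
    rw [Finset.disjoint_left]
    intro e heS heW
    induction e using Sym2.inductionOn with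
    | _ x y =>
      obtain ⟨hx, hy, hne⟩ := mk_mem_pairs.1 heW
      exact hFi W hW x hx y hy ((SimpleGraph.fromEdgeSet_adj _).2 ⟨heS, hne⟩)
  · rw [mul_zero]
    have := tupleSum_mono (as := as) (R := Finset.univ) (φ := fun _ => 0 * 1)
      (φ' := fun l => if Disjoint S (tupleEdges l) then (1 : ℝ) else 0) fun l _ => by
        split_ifs <;> norm_num
    rwa [tupleSum_mul_left, zero_mul] at this

lemma gnpProb_disjointIndepSets_le {p : ℝ} (hp0 : 0 ≤ p) (hp1 : p < 1) {n m a : ℕ} (hn : 0 < n)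
    (hm : 0 < m) (ha : 0 < a) : gnpProb n p (disjointIndepSets n m a) ≤
      exp (m * (a * (log n - log (1 / (1 - p)) * (a - 1) / 2 - log a + 1) - log m + 1 -
        a * (m * a - 1) / (2 * n))) := by
  have hq : 0 < 1 - p := by linarith
  have hn' : (0 : ℝ) < n := by exact_mod_cast hn
  have ha' : (0 : ℝ) < a := by exact_mod_cast ha
  have hm' : (0 : ℝ) < m := by exact_mod_cast hm
  set P := gnpProb n p (disjointIndepSets n m a)
  have key := gnpProb_disjointIndepSets_mul_le hp0 hp1.le n m a
  have d1 := descFactorial_le_pow_mul_exp n (m * a)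
  have d2 : ∀ k : ℕ, 0 < k → exp (k * (log k - 1)) ≤ k.factorial := fun k hk => by
    have hk' : (0 : ℝ) < k := by exact_mod_cast hk
    refine le_trans (le_of_eq ?_) (pow_div_exp_le_factorial k)
    rw [← rpow_natCast, rpow_def_of_pos (by positivity), log_div hk'.ne' (exp_pos _).ne', log_exp,
      mul_comm]
  have e1 : (1 - p) ^ (m * a.choose 2) = exp (m * (a * (-log (1 / (1 - p)) * (a - 1) / 2))) := by
    rw [← rpow_natCast, rpow_def_of_pos hq, Nat.cast_mul, Nat.cast_choose_two, one_div, log_inv]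
    ring_nf
  have e2 : (n : ℝ) ^ (m * a) = exp (m * a * log n) := by
    rw [← rpow_natCast, rpow_def_of_pos hn', Nat.cast_mul, mul_comm]
  have hpos : 0 < (m.factorial : ℝ) * (a.factorial : ℝ) ^ m := by positivity
  have hle : P ≤ (1 - p) ^ (m * a.choose 2) * n.descFactorial (m * a) /
      (m.factorial * (a.factorial : ℝ) ^ m) := by
    rw [le_div_iff₀ hpos, ← mul_assoc]
    exact key
  refine hle.trans ?_
  calc _ ≤ exp (m * (a * (-log (1 / (1 - p)) * (a - 1) / 2))) *
        ((n : ℝ) ^ (m * a) * exp (-(((m * a : ℕ) : ℝ) * ((m * a : ℕ) - 1) / (2 * n)))) /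
        (exp (m * (log m - 1)) * exp (a * (log a - 1)) ^ m) := by
        rw [e1]
        exact div_le_div₀ (by positivity) (mul_le_mul_of_nonneg_left d1 (exp_pos _).le)
          (by positivity) (mul_le_mul (d2 m hm) (pow_le_pow_left₀ (exp_pos _).le (d2 a ha) _)
            (by positivity) (by positivity))
    _ = _ := by
      rw [e2, ← exp_nat_mul, ← exp_add, ← exp_add, ← exp_add, ← exp_sub]
      congr 1
      push_cast
      field_simp
      ring

end FirstMoment

lemma card_le_of_not_mem_disjointIndepSets {n m a k : ℕ} (ha : 0 < a) {G : SimpleGraph (Fin n)}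
    (hG : G.Colorable k) (h₁ : G ∉ disjointIndepSets n m a)
    (h₂ : G ∉ disjointIndepSets n 1 (a + 2)) : n ≤ k * (a - 1) + 2 * m := by
  classical
  obtain ⟨C⟩ := hG
  let cls : Fin k → Finset (Fin n) := fun i => Finset.univ.filter fun x => C x = i
  have hmem : ∀ i x, x ∈ cls i ↔ C x = i := fun i x => by simp [cls]
  have hind : ∀ i, ∀ x ∈ cls i, ∀ y ∈ cls i, ¬ G.Adj x y := fun i x hx y hy hxy =>
    C.valid hxy (((hmem i x).1 hx).trans ((hmem i y).1 hy).symm)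
  have hsum : n = ∑ i, (cls i).card := by
    have := Finset.card_eq_sum_card_fiberwise (s := (Finset.univ : Finset (Fin n)))
      (t := (Finset.univ : Finset (Fin k))) (f := C) fun x _ => Finset.mem_coe.2 (Finset.mem_univ _)
    rwa [Finset.card_univ, Fintype.card_fin] at this
  have hbig : ∀ i, (cls i).card ≤ a + 1 := by
    intro i
    by_contra! hc
    obtain ⟨W, hW, hWa⟩ := Finset.exists_subset_card_eq (show a + 2 ≤ (cls i).card from hc)
    refine h₂ ⟨{W}, Finset.card_singleton _, ?_, ?_, ?_⟩
    · simpa using hWa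
    · intro W' hW'
      rw [Finset.mem_singleton.1 hW']
      exact fun x hx y hy => hind i x (hW hx) y (hW hy)
    · intro W₁ hW₁ W₂ hW₂ hne
      exact absurd ((Finset.mem_singleton.1 hW₁).trans (Finset.mem_singleton.1 hW₂).symm) hne
  set I := Finset.univ.filter fun i => a ≤ (cls i).card with hI
  have hIm : I.card ≤ m := by
    by_contra! hc
    obtain ⟨J, hJ, hJm⟩ := Finset.exists_subset_card_eq hc.le
    have hex : ∀ i : Fin k, ∃ W : Finset (Fin n), i ∈ J → W ⊆ cls i ∧ W.card = a := fun i => by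
      by_cases hi : i ∈ J
      · obtain ⟨W, hW⟩ := Finset.exists_subset_card_eq (Finset.mem_filter.1 (hJ hi)).2
        exact ⟨W, fun _ => hW⟩
      · exact ⟨∅, fun h => absurd h hi⟩
    choose W hW using hex
    have hdisj : ∀ i ∈ J, ∀ j ∈ J, i ≠ j → Disjoint (W i) (W j) := fun i hi j hj hij => by
      rw [Finset.disjoint_left]
      intro x hx hx'
      exact hij (((hmem i x).1 ((hW i hi).1 hx)).symm.trans ((hmem j x).1 ((hW j hj).1 hx')))
    refine h₁ ⟨J.image W, ?_, ?_, ?_, ?_⟩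
    · rw [Finset.card_image_of_injOn, hJm]
      intro i hi j hj hij
      by_contra hne
      have h3 := hdisj i hi j hj hne
      rw [← hij, Finset.disjoint_self_iff_empty] at h3
      have h4 := (hW i hi).2
      rw [h3, Finset.card_empty] at h4
      omega
    · intro U hU
      obtain ⟨i, hi, rfl⟩ := Finset.mem_image.1 hU
      exact (hW i hi).2
    · intro U hU
      obtain ⟨i, hi, rfl⟩ := Finset.mem_image.1 hU
      exact fun x hx y hy => hind i x ((hW i hi).1 hx) y ((hW i hi).1 hy)
    · intro U hU U' hU' hne
      obtain ⟨i, hi, rfl⟩ := Finset.mem_image.1 hU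
      obtain ⟨j, hj, rfl⟩ := Finset.mem_image.1 hU'
      exact hdisj i hi j hj fun h => hne (h ▸ rfl)
  calc n = ∑ i, (cls i).card := hsum
    _ ≤ ∑ i : Fin k, ((a - 1) + if a ≤ (cls i).card then 2 else 0) := by
      refine Finset.sum_le_sum fun i _ => ?_
      have := hbig i
      split_ifs <;> omega
    _ = k * (a - 1) + 2 * I.card := by
      rw [Finset.sum_add_distrib, ← Finset.sum_filter, Finset.sum_const, Finset.sum_const,
        Finset.card_univ, Fintype.card_fin, smul_eq_mul, smul_eq_mul, mul_comm 2]
    _ ≤ _ := by omega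

theorem eventually_gnpProb_disjointIndepSets_le {p : ℝ} (hp0 : 0 ≤ p) (hp1 : p < 1)
    (hlam : 2 < log (1 / (1 - p))) {t : ℝ} (ht : 0 < t) : ∀ᶠ n : ℕ in atTop, ∀ a : ℕ,
      log n - log (log n / log (1 / (1 - p))) + 1 - log 2 ≤ log (1 / (1 - p)) * a / 2 →
      log (1 / (1 - p)) * a / 2 ≤
        log n - log (log n / log (1 / (1 - p))) + 1 - log 2 + log (1 / (1 - p)) / 2 →
      gnpProb n p (disjointIndepSets n ⌈t * n / a⌉₊ a) ≤ exp (-log n) ∧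
      gnpProb n p (disjointIndepSets n 1 (a + 2)) ≤
        exp (1 - log n / (2 * log (1 / (1 - p)))) := by
  set lam := log (1 / (1 - p)) with hlamdef
  have hlam0 : 0 < lam := by linarith
  obtain ⟨θ, hθ0, hθ1, hθt⟩ : ∃ θ : ℝ, 0 < θ ∧ θ ≤ 1 / 2 ∧ θ ≤ t / 4 :=
    ⟨min (1 / 2) (t / 4), by positivity, min_le_left _ _, min_le_right _ _⟩
  have hθe : 0 < 1 - exp (-θ) := sub_pos.2 (Real.exp_lt_one_iff.2 (by linarith))
  have hlog : Tendsto (fun n : ℕ => log n) atTop atTop :=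
    tendsto_log_atTop.comp tendsto_natCast_atTop_atTop
  filter_upwards [eventually_ge_atTop 1, hlog.eventually_ge_atTop 10,
    hlog.eventually_ge_atTop (lam * exp (1 + lam / 2)),
    hlog.eventually_ge_atTop (lam * (4 / t * (lam / 2 + 4 - log t))),
    hlog.eventually (eventually_add_mul_log_le lam 2 one_pos),
    hlog.eventually (eventually_add_mul_log_le 0 1 hθe),
    hlog.eventually (eventually_add_mul_log_le (-log t) 2 one_pos)]
    with n hn1 hx10 hxw hxt f1 f2 f3 a h1 h2
  set x := log n with hx
  set Λ := log x with hΛ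
  have hx0 : 0 < x := by linarith
  have hxe : x = exp Λ := (exp_log hx0).symm
  have hn0 : (0 : ℝ) < n := by exact_mod_cast hn1
  have hne : (n : ℝ) = exp x := (exp_log hn0).symm
  have l2 : log 2 < 0.6931471808 := log_two_lt_d9
  have l2' : 0.6931471803 < log 2 := log_two_gt_d9
  set w := log (x / lam) with hw
  have hw0 : 1 + lam / 2 ≤ w := by
    rw [hw, le_log_iff_exp_le (by positivity), le_div_iff₀ hlam0]
    linarith
  have hwΛ : w ≤ Λ := log_le_log (by positivity) (div_le_self hx0.le (by linarith))
  have hax : x ≤ lam * a := by linarith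
  have ha0 : (0 : ℝ) < a := by
    by_contra! hc
    nlinarith
  have ha : 0 < a := by exact_mod_cast ha0
  have hla : log a ≤ w + log 2 := by
    rw [hw, ← log_mul (by positivity) (by norm_num)]
    refine log_le_log ha0 ?_
    rw [div_mul_eq_mul_div, le_div_iff₀ hlam0]
    linarith
  have hla' : w + log 2 - θ ≤ log a := by
    rw [le_log_iff_exp_le ha0, sub_eq_add_neg, exp_add, exp_add, exp_log two_pos, hw,
      exp_log (by positivity), div_mul_eq_mul_div, div_mul_eq_mul_div, div_le_iff₀ hlam0]
    linarith
  have hax' : (a : ℝ) ≤ x := by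
    have := mul_le_mul_of_nonneg_right hlam.le ha0.le
    linarith
  have hxn : x ^ 2 ≤ t * n := by
    rw [hxe, ← exp_nat_mul, hne, ← exp_log ht, ← exp_add]
    refine exp_le_exp.2 ?_
    push_cast
    linarith
  have hxn' : x ≤ n := by
    rw [hne]
    linarith [add_one_le_exp x]
  have hq : 0 < 1 - p := by linarith
  constructor
  · set m := ⌈t * n / a⌉₊ with hm
    have hm1 : t * n / a ≤ m := Nat.le_ceil _
    have hm0 : (0 : ℝ) < m := lt_of_lt_of_le (by positivity) hm1
    have hma : t * n ≤ m * a := by rwa [div_le_iff₀ ha0] at hm1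
    have hmx : x ≤ m := by
      refine le_trans ?_ hm1
      rw [le_div_iff₀ ha0]
      nlinarith
    have hlm : log t + x - log a ≤ log m := by
      rw [hx, ← log_mul ht.ne' hn0.ne', ← log_div (by positivity) ha0.ne']
      exact log_le_log (by positivity) hm1
    refine (gnpProb_disjointIndepSets_le hp0 hp1 hn1 (by exact_mod_cast hm0) ha).trans
      (exp_le_exp.2 ?_)
    have b1 : (a : ℝ) * (x - lam * (a - 1) / 2 - log a + 1) ≤ a * (lam / 2 + θ) :=
      mul_le_mul_of_nonneg_left (by linarith) ha0.le
    have b2 : (a : ℝ) * t / 2 - 1 ≤ a * (m * a - 1) / (2 * n) := by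
      rw [le_div_iff₀ (by positivity)]
      have := mul_le_mul_of_nonneg_left hma ha0.le
      linarith
    have b3 : a * θ ≤ a * (t / 4) := mul_le_mul_of_nonneg_left hθt ha0.le
    have b4 : lam / 2 + 4 - log t ≤ a * (t / 4) := by
      have := le_of_mul_le_mul_left (hxt.trans hax) hlam0
      rw [div_mul_eq_mul_div, div_le_iff₀ ht] at this
      linarith
    have b5 : a * (x - lam * (a - 1) / 2 - log a + 1) - log m + 1 -
        a * (m * a - 1) / (2 * n) ≤ -1 := by linarith
    have b6 := mul_le_mul_of_nonneg_left b5 hm0.le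
    linarith
  · refine (gnpProb_disjointIndepSets_le hp0 hp1 hn1 one_pos (by omega : 0 < a + 2)).trans
      (exp_le_exp.2 ?_)
    push_cast
    rw [log_one]
    have b1 : log a ≤ log (a + 2 : ℝ) := log_le_log ha0 (by linarith)
    have b2 : (a + 2 : ℝ) * (x - lam * (a + 2 - 1) / 2 - log (a + 2) + 1) ≤ (a + 2) * (-(1 / 2)) :=
      mul_le_mul_of_nonneg_left (by linarith) (by linarith)
    have b3 : 0 ≤ (a + 2 : ℝ) * (1 * (a + 2) - 1) / (2 * n) :=
      div_nonneg (mul_nonneg (by linarith) (by linarith)) (by linarith)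
    have b4 : x / (2 * lam) ≤ a / 2 := by
      rw [div_le_div_iff₀ (by positivity) two_pos]
      linarith
    linarith

lemma log_mul_alpha0_div_two {b : ℝ} (hb : 1 < b) (x : ℝ) :
    log b * alpha0 b x / 2 = log x - log (log x / log b) + 1 - log 2 + log b / 2 := by
  have hb0 : log b ≠ 0 := (log_pos hb).ne'
  simp only [alpha0, logb]
  rw [log_div (exp_pos _).ne' two_ne_zero, log_exp]
  field_simp
  ring

/-- Fix `1 − 1/e² < p < 1`, set `b = 1/(1−p)` and `u = 2/log b < 1`.  For
every `ε > 0`, the probability that `|χ(G_{n,p}) − n/(α(n)−1)| ≤ ε n / log² n` tends to `1`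
as `n → ∞` through the integers satisfying `α₀(n) − α(n) ≥ u`. -/
theorem chromatic_estimate_large_p (p : ℝ) (hp1 : p < 1)
    (hp : 1 - 1 / Real.exp 1 ^ 2 < p) :
    ∀ ε : ℝ, 0 < ε →
      Tendsto (fun n : ℕ => gnpProb n p
          {G | |(chrom G : ℝ) - (n : ℝ) / ((⌊alpha0 (1 / (1 - p)) n⌋ : ℝ) - 1)|
            ≤ ε * n / Real.log n ^ 2})
        (atTop ⊓ Filter.principal
          {n : ℕ | 2 / Real.log (1 / (1 - p))
            ≤ alpha0 (1 / (1 - p)) n - (⌊alpha0 (1 / (1 - p)) n⌋ : ℝ)})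
        (nhds 1) := by
  intro ε hε
  have he : exp 1 ^ 2 = exp 2 := by
    rw [← exp_nat_mul]
    norm_num
  have hq : 0 < 1 - p := by linarith
  have hp0 : 0 ≤ p := by
    have : 1 / exp 1 ^ 2 ≤ 1 := by
      rw [he]
      exact (div_le_one (exp_pos _)).2 (one_le_exp (by norm_num))
    linarith
  have hlam : 2 < log (1 / (1 - p)) := by
    rw [lt_log_iff_exp_lt (by positivity), lt_div_iff₀ hq, mul_comm, ← lt_div_iff₀ (exp_pos _), ← he]
    linarith
  have hb1 : 1 < 1 / (1 - p) := (log_pos_iff (by positivity)).1 (by linarith)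
  set b := 1 / (1 - p)
  set lam := log b
  have hlam0 : 0 < lam := by linarith
  have hlog : Tendsto (fun n : ℕ => log n) atTop atTop :=
    tendsto_log_atTop.comp tendsto_natCast_atTop_atTop
  have hlow : Tendsto (fun n : ℕ => 1 - exp (-log n) - exp (-log n) -
      exp (1 - log n / (2 * lam))) atTop (nhds 1) := by
    have h1 : Tendsto (fun n : ℕ => exp (-log n)) atTop (nhds 0) :=
      tendsto_exp_neg_atTop_nhds_zero.comp hlog
    have h2 : Tendsto (fun n : ℕ => exp (1 - log n / (2 * lam))) atTop (nhds 0) := by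
      refine tendsto_exp_atBot.comp ?_
      simp only [sub_eq_add_neg]
      refine tendsto_atBot_add_const_left _ _ (tendsto_neg_atTop_atBot.comp ?_)
      exact hlog.atTop_div_const (by positivity)
    simpa using ((tendsto_const_nhds (x := (1 : ℝ))).sub h1).sub h1 |>.sub h2
  refine tendsto_of_tendsto_of_tendsto_of_le_of_le' (hlow.mono_left inf_le_left)
    tendsto_const_nhds ?_ (Eventually.of_forall fun n => gnpProb_le_one hp0 hp1.le _)
  rw [eventually_inf_principal]
  filter_upwards [eventually_gnpProb_chrom_ge_le hp0 hp1 hlam hε,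
    eventually_gnpProb_disjointIndepSets_le hp0 hp1 hlam (t := ε / (4 * lam ^ 2)) (by positivity),
    eventually_ge_atTop 1, hlog.eventually_ge_atTop 10,
    hlog.eventually (eventually_add_mul_log_le lam 2 one_pos),
    hlog.eventually (eventually_add_mul_log_le (2 - log ε) 2 one_pos)]
    with n hup hindep hn1 hx10 f1 f2 hn
  replace hn : 2 / lam ≤ alpha0 b n - (⌊alpha0 b n⌋ : ℝ) := hn
  have hA := log_mul_alpha0_div_two hb1 n
  have l2 : log 2 < 0.6931471808 := log_two_lt_d9
  have hfl := Int.floor_le (alpha0 b n)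
  have hfl' := Int.lt_floor_add_one (alpha0 b n)
  change lam * alpha0 b n / 2 = log n - log (log n / lam) + 1 - log 2 + lam / 2 at hA
  set x := log n with hx
  have hx0 : 0 < x := by linarith
  have hwΛ : log (x / lam) ≤ log x :=
    log_le_log (by positivity) (div_le_self hx0.le (by linarith))
  set A := alpha0 b n
  have hl1 := mul_le_mul_of_nonneg_left hfl hlam0.le
  have hl2 := mul_le_mul_of_nonneg_left hfl'.le hlam0.le
  have hl3 : 2 ≤ lam * (A - ⌊A⌋) := by rwa [div_le_iff₀' hlam0] at hn
  have hxA : x ≤ lam * ((⌊A⌋ : ℝ) - 1) := by linarith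
  have hfl0 : (1 : ℝ) < ⌊A⌋ := by
    have := pos_of_mul_pos_right (hx0.trans_le hxA) hlam0.le
    linarith
  have hfl0' : (1 : ℤ) < ⌊A⌋ := by exact_mod_cast hfl0
  obtain ⟨r, hr⟩ : ∃ r : ℕ, ⌊A⌋ = r + 1 := ⟨(⌊A⌋ - 1).toNat, by omega⟩
  have hr' : (⌊A⌋ : ℝ) = r + 1 := by exact_mod_cast hr
  have hr0 : (0 : ℝ) < r := by linarith
  rw [hr'] at hl1 hl2 hl3 hxA ⊢
  rw [add_sub_cancel_right] at hxA ⊢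
  have hU := hup r (by linarith) (by linarith)
  obtain ⟨hL₁, hL₂⟩ := hindep (r + 1) (by push_cast; linarith) (by push_cast; linarith)
  set m := ⌈ε / (4 * lam ^ 2) * n / (r + 1 : ℕ)⌉₊ with hm
  refine le_trans ?_ (one_sub_le_gnpProb hp0 hp1.le
    (B := {G | n / r + ε * n / x ^ 2 ≤ (chrom G : ℝ)}) (C := disjointIndepSets n m (r + 1))
    (D := disjointIndepSets n 1 (r + 1 + 2)) fun G hB hC hD => ?_)
  · linarith
  · have hn0 : (0 : ℝ) < n := by exact_mod_cast hn1
    have h1 := card_le_of_not_mem_disjointIndepSets r.succ_pos (chrom_le_iff.1 le_rfl) hC hD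
    rw [Nat.succ_sub_one] at h1
    have h2 : (n : ℝ) ≤ chrom G * r + 2 * m := by exact_mod_cast h1
    have h3 : (chrom G : ℝ) < n / r + ε * n / x ^ 2 := not_le.1 hB
    have h4 : (m : ℝ) ≤ ε / (4 * lam ^ 2) * n / r + 1 := by
      refine (Nat.ceil_lt_add_one (by positivity)).le.trans ?_
      gcongr
      omega
    have h5 : 4 * x ^ 2 ≤ ε * n := by
      rw [← exp_log hε, ← exp_log hn0, ← exp_add, ← exp_log hx0, ← exp_nat_mul,
        ← exp_log (by norm_num : (0 : ℝ) < 4), ← exp_add]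
      refine exp_le_exp.2 ?_
      have h6 : log (4 : ℝ) = 2 * log 2 := by
        rw [← log_rpow two_pos]
        norm_num
      rw [h6]
      push_cast
      linarith
    have h7 : 2 * m / r ≤ ε * n / x ^ 2 := by
      have e1 : 1 ≤ (r : ℝ) := by
        have : 0 < r := by exact_mod_cast hr0
        exact_mod_cast this
      have e2 : (2 : ℝ) ≤ ε * n / x ^ 2 / 2 * r := by
        have : (2 : ℝ) ≤ ε * n / x ^ 2 / 2 := by
          rw [div_div, le_div_iff₀ (by positivity)]
          linarith
        nlinarith
      have e3 : 2 * (ε / (4 * lam ^ 2) * n / r) ≤ ε * n / x ^ 2 / 2 * r := by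
        have : 2 * (ε / (4 * lam ^ 2) * n / r) = ε * n / (lam * r) ^ 2 / 2 * r := by
          field_simp
          ring
        rw [this]
        gcongr
      rw [div_le_iff₀ hr0]
      linarith
    have h8 : (n : ℝ) / r ≤ chrom G + 2 * m / r := by
      rw [div_le_iff₀ hr0, add_mul, div_mul_cancel₀ _ hr0.ne']
      exact h2
    rw [Set.mem_ofPred_eq, abs_le]
    constructor <;> linarith
end

section
/- Suppose t = t(n) is a positive integer with t(n) = O(log n). Then for all sufficiently large n and for all k with 1 < n/k < t, log(E_{n,k,t}) = L₀(n,k,t) + O(log⁴ n), where the implied constants are uniform over such k. -/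
open Filter Real

/-- `P` is a partition of the vertex set of `G` into independent sets, each of size at most
`t`. -/
def IsIndepPartition {n : ℕ} (G : SimpleGraph (Fin n)) (t : ℕ)
    (P : Finset (Finset (Fin n))) : Prop :=
  (∀ S ∈ P, S.Nonempty ∧ S.card ≤ t ∧ ∀ u ∈ S, ∀ v ∈ S, ¬ G.Adj u v) ∧
  (∀ v : Fin n, ∃! S, S ∈ P ∧ v ∈ S)

/-- The number of unordered `t`-bounded `k`-colourings of `G`. -/
noncomputable def numPartitions {n : ℕ} (k t : ℕ) (G : SimpleGraph (Fin n)) : ℕ :=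
  Set.ncard {P : Finset (Finset (Fin n)) | P.card = k ∧ IsIndepPartition G t P}

/-- `E_{n,k,t}`: expected number of unordered `t`-bounded `k`-colourings of `G_{n,1/2}`. -/
noncomputable def EE (n k t : ℕ) : ℝ :=
  ∑ G : SimpleGraph (Fin n), gnpWeight n (1 / 2) G * numPartitions k t G

/-- `d_i = 2^C(i,2) i!`. -/
noncomputable def dI (i : ℕ) : ℝ := 2 ^ i.choose 2 * (i.factorial : ℝ)

/-- `L₀(n,k,t)`: the supremum, over real profiles `(n_1,…,n_t)` with `n_i ≥ 0`,
`Σ n_i = k` and `Σ i n_i = n` (index `i : Fin t` denotes size `i+1`), of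
`n log n − n + k − Σ n_i log(n_i d_i)`. -/
noncomputable def L0 (n k : ℝ) (t : ℕ) : ℝ :=
  sSup {L : ℝ | ∃ ns : Fin t → ℝ, (∀ i, 0 ≤ ns i) ∧ (∑ i, ns i) = k ∧
    (∑ i, ((i.1 + 1 : ℕ) : ℝ) * ns i) = n ∧
    L = n * Real.log n - n + k - ∑ i, ns i * Real.log (ns i * dI (i.1 + 1))}

theorem card_equiv_comp_eq {α α' ι : Type*} [Fintype α] [Fintype α'] [Fintype ι]
    [DecidableEq α] [DecidableEq α'] [DecidableEq ι] (f : α → ι) (g : α' → ι)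
    (h : ∀ i, Fintype.card {a // f a = i} = Fintype.card {a // g a = i}) :
    Fintype.card {e : α ≃ α' // g ∘ e = f} =
      ∏ i, (Fintype.card {a // f a = i}).factorial := by
  rw [← DomMulAct.stabilizer_card f]
  let e₀ : α ≃ α' := (Equiv.sigmaFiberEquiv f).symm.trans
    ((Equiv.sigmaCongrRight fun i => Fintype.equivOfCardEq (h i)).trans (Equiv.sigmaFiberEquiv g))
  have he₀ : ∀ a, g (e₀ a) = f a := fun a =>
    (Fintype.equivOfCardEq (h (f a)) ⟨a, rfl⟩).2
  refine Fintype.card_congr (Equiv.subtypeEquiv (Equiv.equivCongr (Equiv.refl α) e₀.symm) ?_)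
  intro e
  have key : ∀ a, f (e₀.symm (e a)) = g (e a) := fun a => by
    rw [← he₀, Equiv.apply_symm_apply]
  constructor
  · intro hh
    funext a
    simpa [key] using congrFun hh a
  · intro hh
    funext a
    have := congrFun hh a
    simpa [key] using this

theorem card_fun_fiber_card_mul {α β : Type*} [Fintype α] [Fintype β] [DecidableEq α]
    [DecidableEq β] (s : β → ℕ) (hs : ∑ b, s b = Fintype.card α) :
    Fintype.card {f : α → β // ∀ b, Fintype.card {a // f a = b} = s b} * ∏ b, (s b).factorial =
      (Fintype.card α).factorial := by
  obtain ⟨e⟩ : Nonempty (α ≃ Σ b, Fin (s b)) := by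
    rw [← Fintype.card_eq]
    simp [hs]
  let f₀ : α → β := fun a => (e a).1
  have hf₀ : ∀ b, Fintype.card {a // f₀ a = b} = s b := by
    intro b
    have e' : {a // f₀ a = b} ≃ {x : Σ b, Fin (s b) // x.1 = b} :=
      Equiv.subtypeEquiv e fun a => Iff.rfl
    rw [Fintype.card_congr e', Fintype.card_congr (Equiv.sigmaSubtype b)]
    simp
  let Φ : Equiv.Perm α → {f : α → β // ∀ b, Fintype.card {a // f a = b} = s b} := fun σ =>
    ⟨f₀ ∘ σ, fun b => by
      rw [← hf₀ b]
      exact Fintype.card_congr (Equiv.subtypeEquiv σ fun a => Iff.rfl)⟩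
  rw [← Fintype.card_perm, ← Fintype.card_congr (Equiv.sigmaFiberEquiv Φ), Fintype.card_sigma,
    Finset.sum_congr rfl (g := fun _ => ∏ b, (s b).factorial)]
  · simp
  · intro f _
    rw [← Finset.prod_congr rfl fun b _ => congrArg Nat.factorial (f.2 b),
      ← card_equiv_comp_eq f.1 f₀ fun b => (f.2 b).trans (hf₀ b).symm]
    exact Fintype.card_congr (Equiv.subtypeEquiv (Equiv.refl _) fun σ => by
      simp [Φ, Subtype.ext_iff])

/-- `P` is a partition of `α` into nonempty sets of size at most `t`. -/
def IsBoundedPartition {α : Type*} (t : ℕ) (P : Finset (Finset α)) : Prop :=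
  (∀ S ∈ P, S.Nonempty ∧ S.card ≤ t) ∧ ∀ v : α, ∃! S, S ∈ P ∧ v ∈ S

/-- The number of blocks of each size `1, …, t`. -/
def blockProfile {α : Type*} (t : ℕ) (P : Finset (Finset α)) (i : Fin t) : ℕ :=
  (P.filter fun S => S.card = i.1 + 1).card

/-- The set of fibres of `f`. -/
def fiberFinset {α β : Type*} [Fintype α] [Fintype β] [DecidableEq α] [DecidableEq β]
    (f : α → β) : Finset (Finset α) :=
  Finset.univ.image fun b => Finset.univ.filter fun a => f a = b

theorem card_fun_fiberFinset_eq {α : Type*} [Fintype α] [DecidableEq α] {t : ℕ}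
    (y : Fin t → ℕ) (P : Finset (Finset α)) (hP : IsBoundedPartition t P)
    (hy : blockProfile t P = y) :
    Fintype.card {f : α → (Σ i : Fin t, Fin (y i)) //
      (∀ b, Fintype.card {a // f a = b} = b.1.1 + 1) ∧ fiberFinset f = P} =
      ∏ i, (y i).factorial := by
  classical
  have hpos : ∀ S ∈ P, 0 < S.card := fun S hS => (hP.1 S hS).1.card_pos
  let cls : P → Fin t := fun S => ⟨S.1.card - 1, by
    have := hpos S.1 S.2
    have := (hP.1 S.1 S.2).2
    omega⟩
  have hcls : ∀ i, Fintype.card {S // cls S = i} = y i := by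
    intro i
    rw [← hy, blockProfile, Fintype.card_subtype]
    refine Finset.card_bij (fun S _ => S.1) ?_ ?_ ?_
    · intro S hS
      have hS' : S.1.card - 1 = i.1 := by simpa [cls, Fin.ext_iff] using hS
      have := hpos S.1 S.2
      exact Finset.mem_filter.2 ⟨S.2, by omega⟩
    · exact fun S _ S' _ h => Subtype.ext h
    · intro S hS
      obtain ⟨hS, hc⟩ := Finset.mem_filter.1 hS
      exact ⟨⟨S, hS⟩, by simp [cls, Fin.ext_iff, hc], rfl⟩
  have hblk : ∀ a, ∃ S : P, ∀ S' : P, a ∈ S'.1 ↔ S' = S := by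
    intro a
    obtain ⟨S, ⟨hS, haS⟩, hu⟩ := hP.2 a
    refine ⟨⟨S, hS⟩, fun S' => ⟨fun h => Subtype.ext (hu _ ⟨S'.2, h⟩), ?_⟩⟩
    rintro rfl
    exact haS
  choose blk hblk using hblk
  have hsurj : Function.Surjective blk := fun S => by
    obtain ⟨a, ha⟩ := (hP.1 S.1 S.2).1
    exact ⟨a, ((hblk a S).1 ha).symm⟩
  have hfib : ∀ S : P, (Finset.univ.filter fun a => blk a = S) = S.1 := fun S => by
    ext a
    simp [hblk, eq_comm]
  have hcount := card_equiv_comp_eq cls (Sigma.fst : (Σ i : Fin t, Fin (y i)) → Fin t) fun i => by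
    rw [hcls, Fintype.card_congr (Equiv.sigmaSubtype i), Fintype.card_fin]
  simp only [hcls] at hcount
  rw [← hcount]
  symm
  have hfe : ∀ (e : P ≃ Σ i : Fin t, Fin (y i)) b,
      (Finset.univ.filter fun a => e (blk a) = b) = (e.symm b).1 := fun e b => by
    rw [← hfib]
    congr 1
    ext a
    rw [Equiv.eq_symm_apply]
  refine Fintype.card_of_bijective (f := fun e => ⟨fun a => e.1 (blk a), fun b => ?_, ?_⟩)
    ⟨?_, ?_⟩
  · rw [Fintype.card_subtype, hfe]
    have h1 := congrFun e.2 (e.1.symm b)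
    simp only [Function.comp_apply, Equiv.apply_symm_apply, cls] at h1
    have := hpos _ (e.1.symm b).2
    rw [h1]
    simp only
    omega
  · ext S
    simp only [fiberFinset, Finset.mem_image, Finset.mem_univ, true_and, hfe]
    constructor
    · rintro ⟨b, rfl⟩
      exact (e.1.symm b).2
    · exact fun hS => ⟨e.1 ⟨S, hS⟩, by simp⟩
  · intro e e' h
    have h' := congrArg Subtype.val h
    refine Subtype.ext (Equiv.ext fun S => ?_)
    obtain ⟨a, rfl⟩ := hsurj S
    exact congrFun h' a
  · rintro ⟨f, hf, hfP⟩
    have hmem : ∀ b, (Finset.univ.filter fun a => f a = b) ∈ P := fun b => by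
      rw [← hfP]
      exact Finset.mem_image_of_mem _ (Finset.mem_univ b)
    let φ : (Σ i : Fin t, Fin (y i)) → P := fun b => ⟨_, hmem b⟩
    have hφ : ∀ a, φ (f a) = blk a := fun a => ((hblk a _).1 (by simp [φ]))
    have hbij : Function.Bijective φ := by
      constructor
      · intro b b' h
        obtain ⟨a, ha⟩ := (hP.1 _ (hmem b)).1
        have ha' : a ∈ (φ b').1 := by rw [← h]; exact ha
        simp only [Finset.mem_filter, Finset.mem_univ, true_and, φ] at ha ha'
        exact ha.symm.trans ha'
      · intro S
        obtain ⟨a, ha⟩ := hsurj S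
        exact ⟨f a, by rw [hφ, ha]⟩
    refine ⟨⟨(Equiv.ofBijective φ hbij).symm, ?_⟩, ?_⟩
    · funext S
      obtain ⟨b, rfl⟩ := hbij.2 S
      have hc : (φ b).1.card = b.1.1 + 1 := by
        rw [← hf b, Fintype.card_subtype]
      have hb : (Equiv.ofBijective φ hbij).symm (φ b) = b :=
        (Equiv.ofBijective φ hbij).symm_apply_apply b
      simp [cls, hc, hb]
    · refine Subtype.ext (funext fun a => ?_)
      simp only
      rw [← hφ]
      exact (Equiv.ofBijective φ hbij).symm_apply_apply (f a)

theorem card_partition_profile_mul {α : Type*} [Fintype α] [DecidableEq α] {t : ℕ}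
    (y : Fin t → ℕ) (hy : ∑ i, (i.1 + 1) * y i = Fintype.card α) :
    Nat.card {P : Finset (Finset α) // IsBoundedPartition t P ∧ blockProfile t P = y} *
      ((∏ i, (y i).factorial) * ∏ i : Fin t, (i.1 + 1).factorial ^ y i) =
      (Fintype.card α).factorial := by
  classical
  have hs : ∑ b : (Σ i : Fin t, Fin (y i)), (b.1.1 + 1) = Fintype.card α := by
    rw [← hy, Fintype.sum_sigma]
    simp [mul_comm]
  rw [← card_fun_fiber_card_mul _ hs, Fintype.prod_sigma]
  simp only [Finset.prod_const, Finset.card_univ, Fintype.card_fin]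
  rw [← mul_assoc, Nat.card_eq_fintype_card]
  congr 1
  let Φ : {f : α → (Σ i : Fin t, Fin (y i)) // ∀ b, Fintype.card {a // f a = b} = b.1.1 + 1} →
      {P : Finset (Finset α) // IsBoundedPartition t P ∧ blockProfile t P = y} := fun f =>
    ⟨fiberFinset f.1, by
      obtain ⟨f, hf⟩ := f
      simp only [Fintype.card_subtype] at hf
      have hinj : Function.Injective fun b => Finset.univ.filter fun a => f a = b := by
        intro b b' h
        have hne : (Finset.univ.filter fun a => f a = b).Nonempty := by
          rw [← Finset.card_pos, hf]; omega
        obtain ⟨a, ha⟩ := hne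
        have ha' : a ∈ Finset.univ.filter fun a => f a = b' := by
          have h' : (Finset.univ.filter fun a => f a = b) =
              Finset.univ.filter fun a => f a = b' := h
          rwa [← h']
        simp only [Finset.mem_filter, Finset.mem_univ, true_and] at ha ha'
        exact ha.symm.trans ha'
      refine ⟨⟨?_, ?_⟩, ?_⟩
      · intro S hS
        obtain ⟨b, -, rfl⟩ := Finset.mem_image.1 hS
        rw [← Finset.card_pos, hf]
        have := b.1.2
        omega
      · intro v
        refine ⟨Finset.univ.filter fun a => f a = f v,
          ⟨Finset.mem_image_of_mem _ (Finset.mem_univ _), by simp⟩, ?_⟩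
        rintro S ⟨hS, hv⟩
        obtain ⟨b, -, rfl⟩ := Finset.mem_image.1 hS
        have hv' : f v = b := (Finset.mem_filter.1 hv).2
        rw [hv']
      · funext i
        rw [blockProfile, fiberFinset, Finset.filter_image, Finset.card_image_of_injective _ hinj]
        simp only [hf]
        rw [← Fintype.card_subtype, ← Fintype.card_fin (y i),
          ← Fintype.card_congr (Equiv.sigmaSubtype (β := fun i => Fin (y i)) i)]
        exact Fintype.card_congr (Equiv.subtypeEquiv (Equiv.refl _) fun b => by
          simp [Fin.ext_iff])⟩
  rw [← Fintype.card_congr (Equiv.sigmaFiberEquiv Φ), Fintype.card_sigma,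
    Finset.sum_congr rfl (g := fun _ => ∏ i, (y i).factorial)]
  · simp
  · intro P _
    rw [← card_fun_fiberFinset_eq y P.1 P.2.1 P.2.2]
    refine Fintype.card_congr ((Equiv.subtypeEquivRight fun f => ?_).trans
      (Equiv.subtypeSubtypeEquivSubtypeInter _ _))
    simp [Φ, Subtype.ext_iff]

theorem card_graph_avoiding {n : ℕ} (D : Finset (Sym2 (Fin n))) (hD : ∀ e ∈ D, ¬ e.IsDiag) :
    Nat.card {G : SimpleGraph (Fin n) // ∀ e ∈ D, e ∉ G.edgeSet} * 2 ^ D.card =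
      2 ^ n.choose 2 := by
  classical
  set U : Finset (Sym2 (Fin n)) := Finset.univ.filter fun e => ¬ e.IsDiag with hU
  have hUc : U.card = n.choose 2 := by
    rw [hU, ← Fintype.card_subtype, Sym2.card_subtype_not_diag, Fintype.card_fin]
  have hDU : D ⊆ U := fun e he => Finset.mem_filter.2 ⟨Finset.mem_univ _, hD e he⟩
  have hcard : Nat.card {G : SimpleGraph (Fin n) // ∀ e ∈ D, e ∉ G.edgeSet} =
      (U \ D).powerset.card := by
    rw [Nat.card_eq_fintype_card, Fintype.card_subtype]
    refine Finset.card_nbij' (fun G => G.edgeFinset)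
      (fun s => SimpleGraph.fromEdgeSet (s : Set (Sym2 (Fin n)))) ?_ ?_ ?_ ?_
    · intro G hG
      have hG' : ∀ e ∈ D, e ∉ G.edgeSet := by simpa using hG
      simp only [Finset.coe_powerset, Set.mem_preimage, Set.mem_powerset_iff, Finset.coe_subset]
      intro e he
      have he' := SimpleGraph.mem_edgeFinset.1 he
      exact Finset.mem_sdiff.2 ⟨Finset.mem_filter.2 ⟨Finset.mem_univ _,
        G.not_isDiag_of_mem_edgeSet he'⟩, fun h => hG' e h he'⟩
    · intro s hs
      have hs' : s ⊆ U \ D := Finset.mem_powerset.1 (Finset.mem_coe.1 hs)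
      simp only [Finset.coe_filter, Finset.mem_univ, true_and, Set.mem_ofPred_eq,
        SimpleGraph.edgeSet_fromEdgeSet]
      exact fun e he h => (Finset.mem_sdiff.1 (hs' h.1)).2 he
    · intro G _
      simp
    · intro s hs
      have hs' : s ⊆ U \ D := Finset.mem_powerset.1 (Finset.mem_coe.1 hs)
      ext e
      simp only [SimpleGraph.mem_edgeFinset, SimpleGraph.edgeSet_fromEdgeSet, Set.mem_sdiff,
        Finset.mem_coe, Sym2.mem_diagSet, and_iff_left_iff_imp]
      exact fun he => (Finset.mem_filter.1 (Finset.mem_sdiff.1 (hs' he)).1).2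
  rw [hcard, Finset.card_powerset, ← pow_add, Finset.card_sdiff_add_card_eq_card hDU, hUc]

theorem card_graph_indep {n t : ℕ} (P : Finset (Finset (Fin n))) (hP : IsBoundedPartition t P) :
    (Nat.card {G : SimpleGraph (Fin n) // ∀ S ∈ P, ∀ u ∈ S, ∀ v ∈ S, ¬ G.Adj u v} : ℝ) *
      2 ^ ∑ S ∈ P, S.card.choose 2 = 2 ^ n.choose 2 := by
  classical
  set D : Finset (Sym2 (Fin n)) := P.biUnion fun S => S.offDiag.image Sym2.mk.uncurry with hDdef
  have hmem : ∀ u v, s(u, v) ∈ D ↔ u ≠ v ∧ ∃ S ∈ P, u ∈ S ∧ v ∈ S := by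
    intro u v
    simp only [hDdef, Finset.mem_biUnion, Finset.mem_image, Finset.mem_offDiag, Prod.exists,
      Function.uncurry_apply_pair, Sym2.eq_iff]
    constructor
    · rintro ⟨S, hS, a, b, ⟨ha, hb, hab⟩, ⟨rfl, rfl⟩ | ⟨rfl, rfl⟩⟩
      · exact ⟨hab, S, hS, ha, hb⟩
      · exact ⟨hab.symm, S, hS, hb, ha⟩
    · rintro ⟨huv, S, hS, hu, hv⟩
      exact ⟨S, hS, u, v, ⟨hu, hv, huv⟩, Or.inl ⟨rfl, rfl⟩⟩
  have hDc : D.card = ∑ S ∈ P, S.card.choose 2 := by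
    rw [hDdef, Finset.card_biUnion]
    · exact Finset.sum_congr rfl fun S _ => Sym2.card_image_offDiag S
    · intro S hS S' hS' hne
      rw [Function.onFun, Finset.disjoint_left]
      intro e he he'
      obtain ⟨⟨a, b⟩, hab, rfl⟩ := Finset.mem_image.1 he
      obtain ⟨⟨c, d⟩, hcd, hh⟩ := Finset.mem_image.1 he'
      simp only [Finset.mem_offDiag, Function.uncurry_apply_pair, Sym2.eq_iff] at hab hcd hh
      obtain ⟨T, -, hT⟩ := hP.2 a
      have haS' : a ∈ S' := by
        rcases hh with ⟨rfl, rfl⟩ | ⟨rfl, rfl⟩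
        exacts [hcd.1, hcd.2.1]
      exact hne ((hT S ⟨hS, hab.1⟩).trans (hT S' ⟨hS', haS'⟩).symm)
  have hDd : ∀ e ∈ D, ¬ e.IsDiag := by
    intro e
    induction e using Sym2.ind with
    | _ u v => exact fun h => by simpa using ((hmem u v).1 h).1
  have hequiv : ∀ G : SimpleGraph (Fin n),
      (∀ S ∈ P, ∀ u ∈ S, ∀ v ∈ S, ¬ G.Adj u v) ↔ ∀ e ∈ D, e ∉ G.edgeSet := by
    intro G
    constructor
    · intro h e
      induction e using Sym2.ind with
      | _ u v =>
        intro huv hadj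
        obtain ⟨-, S, hS, hu, hv⟩ := (hmem u v).1 huv
        exact h S hS u hu v hv hadj
    · intro h S hS u hu v hv hadj
      exact h s(u, v) ((hmem u v).2 ⟨hadj.ne, S, hS, hu, hv⟩) hadj
  rw [← hDc, Nat.card_congr (Equiv.subtypeEquivRight hequiv)]
  exact_mod_cast card_graph_avoiding D hDd

theorem gnpWeight_half {n : ℕ} (G : SimpleGraph (Fin n)) :
    gnpWeight n (1 / 2) G = (2 ^ n.choose 2)⁻¹ := by
  classical
  have h : edgeCount G ≤ n.choose 2 := by
    rw [edgeCount, ← SimpleGraph.coe_edgeFinset, Set.ncard_coe_finset]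
    simpa using G.card_edgeFinset_le_card_choose_two
  rw [gnpWeight, show (1 - 1 / 2 : ℝ) = 1 / 2 by norm_num, ← pow_add, Nat.add_sub_cancel' h]
  simp

open Classical in
theorem EE_eq_sum_partition (n k t : ℕ) :
    EE n k t = ∑ P : Finset (Finset (Fin n)) with P.card = k ∧ IsBoundedPartition t P,
      (2 ^ ∑ S ∈ P, S.card.choose 2 : ℝ)⁻¹ := by
  have hnum : ∀ G : SimpleGraph (Fin n), (numPartitions k t G : ℝ) =
      ∑ P : Finset (Finset (Fin n)) with P.card = k ∧ IsBoundedPartition t P,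
        if ∀ S ∈ P, ∀ u ∈ S, ∀ v ∈ S, ¬ G.Adj u v then (1 : ℝ) else 0 := by
    intro G
    rw [Finset.sum_boole, Finset.filter_filter, numPartitions, ← Set.ncard_coe_finset]
    refine congrArg (fun s : Set (Finset (Finset (Fin n))) => (s.ncard : ℝ)) (Set.ext fun P => ?_)
    rw [Finset.mem_coe, Finset.mem_filter, Set.mem_ofPred_eq]
    simp only [IsIndepPartition, IsBoundedPartition, Finset.mem_univ, true_and]
    constructor
    · rintro ⟨h1, h2, h3⟩
      exact ⟨⟨h1, fun S hS => ⟨(h2 S hS).1, (h2 S hS).2.1⟩, h3⟩, fun S hS => (h2 S hS).2.2⟩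
    · rintro ⟨⟨h1, h2, h3⟩, h4⟩
      exact ⟨h1, fun S hS => ⟨(h2 S hS).1, (h2 S hS).2, h4 S hS⟩, h3⟩
  simp only [EE, gnpWeight_half, hnum]
  rw [← Finset.mul_sum, Finset.sum_comm, Finset.mul_sum]
  refine Finset.sum_congr rfl fun P hP => ?_
  have h := card_graph_indep P (Finset.mem_filter.1 hP).2.2
  rw [Nat.card_eq_fintype_card, Fintype.card_subtype] at h
  rw [Finset.sum_boole, ← h, mul_inv, mul_comm, ← mul_assoc, mul_inv_cancel₀, one_mul]
  intro h0
  rw [h0, zero_mul] at h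
  exact absurd h.symm (by positivity)

/-- The integer profiles of `t`-bounded partitions of an `n`-set into `k` blocks. -/
def profiles (n k t : ℕ) : Finset (Fin t → ℕ) :=
  (Fintype.piFinset fun _ => Finset.range (n + 1)).filter fun y =>
    ∑ i, y i = k ∧ ∑ i, (i.1 + 1) * y i = n

/-- The expected number of colourings with a given profile. -/
noncomputable def profileTerm (n : ℕ) {t : ℕ} (y : Fin t → ℕ) : ℝ :=
  n.factorial / ∏ i, ((y i).factorial * dI (i.1 + 1) ^ y i)

theorem mem_profiles {n k t : ℕ} {y : Fin t → ℕ} :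
    y ∈ profiles n k t ↔ ∑ i, y i = k ∧ ∑ i, (i.1 + 1) * y i = n := by
  rw [profiles, Finset.mem_filter, and_iff_right_iff_imp]
  rintro ⟨-, h⟩
  refine Fintype.mem_piFinset.2 fun i => Finset.mem_range.2 ?_
  have := Finset.single_le_sum (f := fun i : Fin t => (i.1 + 1) * y i) (fun _ _ => Nat.zero_le _)
    (Finset.mem_univ i)
  simp only [h] at this
  nlinarith

theorem sum_eq_sum_blockProfile {α : Type*} {t : ℕ} {P : Finset (Finset α)}
    (hP : IsBoundedPartition t P) (g : ℕ → ℕ) :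
    ∑ S ∈ P, g S.card = ∑ i : Fin t, g (i.1 + 1) * blockProfile t P i := by
  have h : ∀ S ∈ P, S.card ∈ (Finset.univ : Finset (Fin t)).image fun i => i.1 + 1 := by
    intro S hS
    have h1 := (hP.1 S hS).1.card_pos
    have h2 := (hP.1 S hS).2
    exact Finset.mem_image.2 ⟨⟨S.card - 1, by omega⟩, Finset.mem_univ _, by simp only; omega⟩
  rw [← Finset.sum_fiberwise_of_maps_to' h g, Finset.sum_image]
  · simp [blockProfile, mul_comm]
  · intro i _ j _ hij
    exact Fin.ext (by simpa using hij)

theorem sum_card_eq_of_isBoundedPartition {α : Type*} [Fintype α] {t : ℕ}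
    {P : Finset (Finset α)} (hP : IsBoundedPartition t P) :
    ∑ S ∈ P, S.card = Fintype.card α := by
  classical
  have hU : (Finset.univ : Finset α) = P.biUnion fun S => S := by
    ext v
    obtain ⟨S, hS, -⟩ := hP.2 v
    simpa using ⟨S, hS⟩
  rw [← Finset.card_univ, hU, Finset.card_biUnion]
  · intro S hS S' hS' hne
    rw [Function.onFun, Finset.disjoint_left]
    intro v hv hv'
    obtain ⟨T, -, hT⟩ := hP.2 v
    exact hne ((hT S ⟨hS, hv⟩).trans (hT S' ⟨hS', hv'⟩).symm)

theorem EE_eq_sum_profiles (n k t : ℕ) :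
    EE n k t = ∑ y ∈ profiles n k t, profileTerm n y := by
  classical
  rw [EE_eq_sum_partition, ← Finset.sum_fiberwise_of_maps_to (t := profiles n k t)
    (g := fun P => blockProfile t P)]
  · refine Finset.sum_congr rfl fun y hy => ?_
    obtain ⟨hy1, hy2⟩ := mem_profiles.1 hy
    have hcount := card_partition_profile_mul (α := Fin n) y (by simpa using hy2)
    rw [Fintype.card_fin, Nat.card_eq_fintype_card, Fintype.card_subtype] at hcount
    rw [Finset.sum_congr rfl (g := fun _ => (∏ i : Fin t, ((2:ℝ) ^ (i.1 + 1).choose 2) ^ y i)⁻¹),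
      Finset.sum_const, nsmul_eq_mul, profileTerm, ← hcount]
    · have hset : ((Finset.univ.filter fun P : Finset (Finset (Fin n)) =>
          P.card = k ∧ IsBoundedPartition t P).filter fun P => blockProfile t P = y) =
          Finset.univ.filter fun P => IsBoundedPartition t P ∧ blockProfile t P = y := by
        ext P
        simp only [Finset.mem_filter, Finset.mem_univ, true_and]
        constructor
        · rintro ⟨⟨-, h⟩, h'⟩
          exact ⟨h, h'⟩
        · rintro ⟨h, h'⟩
          refine ⟨⟨?_, h⟩, h'⟩
          have := sum_eq_sum_blockProfile h fun _ => 1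
          simpa [h', hy1] using this
      rw [hset]
      simp only [dI, mul_pow, Finset.prod_mul_distrib]
      push_cast
      have h1 : (∏ i, ((y i).factorial : ℝ)) ≠ 0 :=
        Finset.prod_ne_zero_iff.2 fun i _ => by positivity
      have h2 : (∏ i : Fin t, (((i.1 + 1).factorial : ℝ) ^ y i)) ≠ 0 :=
        Finset.prod_ne_zero_iff.2 fun i _ => by positivity
      have h3 : (∏ i : Fin t, (((2:ℝ) ^ (i.1 + 1).choose 2) ^ y i)) ≠ 0 :=
        Finset.prod_ne_zero_iff.2 fun i _ => by positivity
      field_simp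
    · intro P hP
      simp only [Finset.mem_filter, Finset.mem_univ, true_and] at hP
      rw [sum_eq_sum_blockProfile hP.1.2 fun m => m.choose 2, hP.2, ← Finset.prod_pow_eq_pow_sum]
      simp only [pow_mul]
  · intro P hP
    obtain ⟨hk, hP⟩ := (Finset.mem_filter.1 hP).2
    refine mem_profiles.2 ⟨?_, ?_⟩
    · have := sum_eq_sum_blockProfile hP fun _ => 1
      simpa [hk] using this.symm
    · rw [← sum_eq_sum_blockProfile hP fun m => m, sum_card_eq_of_isBoundedPartition hP,
        Fintype.card_fin]

theorem card_profiles_le (n k t : ℕ) : (profiles n k t).card ≤ (n + 1) ^ t :=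
  (Finset.card_filter_le _ _).trans (by simp)

theorem log_factorial_le {m : ℕ} (hm : 1 ≤ m) :
    log (m.factorial : ℝ) ≤ m * log m - m + log m + 1 := by
  induction m, hm using Nat.le_induction with
  | base => simp
  | succ m hm ih =>
    have hm0 : (0 : ℝ) < m := by exact_mod_cast hm
    rw [Nat.factorial_succ]
    push_cast
    rw [log_mul (by positivity) (by positivity)]
    have h := one_sub_inv_le_log_of_pos (x := ((m : ℝ) + 1) / m) (by positivity)
    rw [log_div (by positivity) (by positivity), inv_div] at h
    have h' : 1 ≤ ((m : ℝ) + 1) * (log (m + 1) - log m) := by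
      calc (1 : ℝ) = (m + 1) * (1 - m / (m + 1)) := by field_simp; ring
        _ ≤ _ := by gcongr
    linarith

theorem mul_log_sub_le_log_factorial (m : ℕ) :
    m * log m - m ≤ log (m.factorial : ℝ) := by
  rcases Nat.eq_zero_or_pos m with rfl | hm
  · simp
  have hm0 : (0 : ℝ) < m := by exact_mod_cast hm
  have h := Real.pow_div_factorial_le_exp (m : ℝ) hm0.le m
  have h' := log_le_log (by positivity) h
  rw [log_exp, log_div (by positivity) (by positivity), log_pow] at h'
  linarith

theorem sub_one_le_mul_log {x : ℝ} (hx : 0 ≤ x) : x - 1 ≤ x * log x := by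
  rcases hx.eq_or_lt with rfl | hx
  · simp
  have h := mul_le_mul_of_nonneg_left (one_sub_inv_le_log_of_pos hx) hx.le
  rwa [mul_sub, mul_one, mul_inv_cancel₀ hx.ne'] at h

theorem mul_log_sub_le_mul_log_sub {m x : ℝ} (hm : 1 ≤ m) (hx : m ≤ x) :
    m * log m - m ≤ x * log x - x := by
  have hx0 : 0 < x := by linarith
  have h := mul_le_mul_of_nonneg_left (one_sub_inv_le_log_of_pos (x := x / m) (by positivity)) hx0.le
  rw [log_div (by positivity) (by positivity), inv_div] at h
  have h2 : x * (1 - m / x) = x - m := by field_simp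
  have h3 := mul_le_mul_of_nonneg_right hx (log_nonneg hm)
  nlinarith

theorem log_factorial_le_of_le_add_two {n y : ℕ} {x : ℝ} (hn : 2 ≤ n) (hx : 0 ≤ x)
    (hxn : x ≤ n) (hy : (y : ℝ) ≤ x + 2) :
    log (y.factorial : ℝ) ≤ x * log x - x + (5 * log n + 2) := by
  have hlog : 0 ≤ log (n : ℝ) := log_natCast_nonneg n
  have hym : y ≤ ⌊x⌋₊ + 2 := by
    rw [← Nat.floor_add_ofNat hx]
    exact Nat.le_floor hy
  have h1 : log (y.factorial : ℝ) ≤ log ((⌊x⌋₊ + 2).factorial : ℝ) :=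
    log_le_log (by positivity) (by exact_mod_cast Nat.factorial_le hym)
  have hmx := Nat.floor_le hx
  rcases Nat.eq_zero_or_pos ⌊x⌋₊ with hm | hm
  · rw [hm] at h1
    have h2 : log ((0 + 2).factorial : ℝ) ≤ 1 := by
      have := Real.log_two_lt_d9
      norm_num
      linarith
    have := sub_one_le_mul_log hx
    linarith
  · set m := ⌊x⌋₊
    have hm1 : (1 : ℝ) ≤ m := by exact_mod_cast hm
    have hn2 : (2 : ℝ) ≤ n := by exact_mod_cast hn
    have hm2 : log ((m : ℝ) + 2) ≤ 2 * log n := by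
      rw [← Nat.cast_ofNat (n := 2), ← log_pow]
      exact log_le_log (by positivity) (by push_cast; nlinarith)
    have hm3 : log ((m : ℝ) + 1) ≤ log ((m : ℝ) + 2) := log_le_log (by positivity) (by linarith)
    have hm4 : log (m : ℝ) ≤ log n := log_le_log (by positivity) (by linarith)
    have h2 := log_factorial_le hm
    have h3 := mul_log_sub_le_mul_log_sub hm1 hmx
    rw [Nat.factorial_succ, Nat.factorial_succ] at h1
    push_cast at h1
    rw [log_mul (by positivity) (by positivity), log_mul (by positivity) (by positivity),
      show (m : ℝ) + 1 + 1 = m + 2 by ring] at h1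
    linarith

theorem one_le_dI (i : ℕ) : 1 ≤ dI i :=
  one_le_mul_of_one_le_of_one_le (one_le_pow₀ one_le_two)
    (by exact_mod_cast Nat.one_le_iff_ne_zero.2 i.factorial_ne_zero)

theorem dI_pos (i : ℕ) : 0 < dI i := zero_lt_one.trans_le (one_le_dI i)

theorem log_dI_le {i t : ℕ} (hit : i ≤ t) : log (dI i) ≤ 2 * (t : ℝ) ^ 2 := by
  have hit' : (i : ℝ) ≤ t := by exact_mod_cast hit
  rw [dI, log_mul (by positivity) (by positivity), log_pow]
  have h1 : (i.choose 2 : ℝ) ≤ (i : ℝ) ^ 2 := by exact_mod_cast Nat.choose_le_pow i 2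
  have h2 : log (i.factorial : ℝ) ≤ (i : ℝ) ^ 2 := by
    calc log (i.factorial : ℝ) ≤ log ((i : ℝ) ^ i) :=
          log_le_log (by positivity) (by exact_mod_cast Nat.factorial_le_pow i)
      _ = i * log i := log_pow _ _
      _ ≤ i * i := by gcongr; exact Real.log_le_self (Nat.cast_nonneg i)
      _ = _ := by ring
  have h3 : log 2 ≤ (1 : ℝ) := by linarith [Real.log_two_lt_d9]
  have h4 : (i.choose 2 : ℝ) * log 2 ≤ (i.choose 2 : ℝ) * 1 := by gcongr
  have h5 : (i : ℝ) ^ 2 ≤ (t : ℝ) ^ 2 := by gcongr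
  linarith

theorem mul_log_mul_dI {x : ℝ} (hx : 0 ≤ x) (i : ℕ) :
    x * log (x * dI i) = x * log x + x * log (dI i) := by
  rcases hx.eq_or_lt with rfl | hx
  · simp
  rw [log_mul hx.ne' (dI_pos i).ne', mul_add]

theorem profileTerm_pos (n : ℕ) {t : ℕ} (y : Fin t → ℕ) : 0 < profileTerm n y :=
  div_pos (by positivity) (Finset.prod_pos fun i _ => mul_pos (by positivity) (pow_pos (dI_pos _) _))

theorem log_profileTerm (n : ℕ) {t : ℕ} (y : Fin t → ℕ) :
    log (profileTerm n y) =
      log n.factorial - ∑ i, (log (y i).factorial + y i * log (dI (i.1 + 1))) := by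
  have h : ∀ i : Fin t, ((y i).factorial : ℝ) * dI (i.1 + 1) ^ y i ≠ 0 := fun i =>
    (mul_pos (by positivity) (pow_pos (dI_pos _) _)).ne'
  rw [profileTerm, log_div (by positivity) (Finset.prod_ne_zero_iff.2 fun i _ => h i),
    log_prod fun i _ => h i]
  congr 1
  refine Finset.sum_congr rfl fun i _ => ?_
  rw [log_mul (by positivity) (pow_pos (dI_pos _) _).ne', log_pow]

theorem bddAbove_L0 (n k : ℝ) (t : ℕ) :
    BddAbove {L : ℝ | ∃ ns : Fin t → ℝ, (∀ i, 0 ≤ ns i) ∧ (∑ i, ns i) = k ∧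
      (∑ i, ((i.1 + 1 : ℕ) : ℝ) * ns i) = n ∧
      L = n * Real.log n - n + k - ∑ i, ns i * Real.log (ns i * dI (i.1 + 1))} := by
  refine ⟨n * log n - n + t, ?_⟩
  rintro L ⟨x, hx, hk, -, rfl⟩
  have h : ∑ i, (x i - 1) ≤ ∑ i, x i * log (x i * dI (i.1 + 1)) := by
    refine Finset.sum_le_sum fun i _ => ?_
    rw [mul_log_mul_dI (hx i)]
    have h1 := sub_one_le_mul_log (hx i)
    have h2 := mul_nonneg (hx i) (log_nonneg (one_le_dI (i.1 + 1)))
    linarith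
  rw [Finset.sum_sub_distrib, hk] at h
  simp only [Finset.sum_const, Finset.card_univ, Fintype.card_fin, nsmul_eq_mul, mul_one] at h
  linarith

theorem log_profileTerm_le {n k t : ℕ} (hn : 1 ≤ n) {y : Fin t → ℕ} (hy : y ∈ profiles n k t) :
    log (profileTerm n y) ≤ L0 n k t + (log n + 1) := by
  obtain ⟨h1, h2⟩ := mem_profiles.1 hy
  have hle := le_csSup (bddAbove_L0 n k t) ⟨fun i => (y i : ℝ), fun i => Nat.cast_nonneg _,
    by beta_reduce; exact_mod_cast h1, by beta_reduce; exact_mod_cast h2, rfl⟩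
  refine le_trans ?_ (add_le_add_left hle _)
  have hk : ∑ i, (y i : ℝ) = k := by exact_mod_cast h1
  have h : ∑ i, ((y i : ℝ) * log (y i * dI (i.1 + 1)) - y i) ≤
      ∑ i, (log (y i).factorial + y i * log (dI (i.1 + 1))) := by
    refine Finset.sum_le_sum fun i _ => ?_
    rw [mul_log_mul_dI (Nat.cast_nonneg _)]
    linarith [mul_log_sub_le_log_factorial (y i)]
  rw [Finset.sum_sub_distrib, hk] at h
  rw [log_profileTerm]
  linarith [log_factorial_le hn]

theorem le_log_profileTerm {n k t : ℕ} (hn : 2 ≤ n) {x : Fin t → ℝ} (hx : ∀ i, 0 ≤ x i)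
    (hk : ∑ i, x i = k) (hxn : ∀ i, x i ≤ n) {y : Fin t → ℕ} (hy : ∀ i, |(y i : ℝ) - x i| ≤ 2) :
    n * log n - n + k - ∑ i, x i * log (x i * dI (i.1 + 1)) ≤
      log (profileTerm n y) + t * (5 * log n + 2 + 4 * t ^ 2) := by
  have h : ∑ i, (log (y i).factorial + y i * log (dI (i.1 + 1))) ≤
      ∑ i, (x i * log (x i * dI (i.1 + 1)) - x i + (5 * log n + 2 + 4 * (t : ℝ) ^ 2)) := by
    refine Finset.sum_le_sum fun i _ => ?_
    rw [mul_log_mul_dI (hx i)]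
    have hyi := (abs_le.1 (hy i)).2
    have h1 := log_factorial_le_of_le_add_two hn (hx i) (hxn i) (y := y i) (by linarith)
    have h2 := log_dI_le (i := i.1 + 1) (t := t) (by have := i.2; omega)
    have h3 := mul_le_mul_of_nonneg_right hyi (log_nonneg (one_le_dI (i.1 + 1)))
    linarith
  rw [Finset.sum_add_distrib (f := fun i => x i * log (x i * dI (i.1 + 1)) - x i),
    Finset.sum_sub_distrib, hk] at h
  simp only [Finset.sum_const, Finset.card_univ, Fintype.card_fin, nsmul_eq_mul] at h
  rw [log_profileTerm]
  linarith [mul_log_sub_le_log_factorial n]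

theorem sum_succ_mul_sub {R : Type*} [CommRing R] (a : ℕ → R) (t : ℕ) :
    ∑ i ∈ Finset.range t, ((i : R) + 1) * (a (i + 1) - a i) =
      t * a t - ∑ i ∈ Finset.range t, a i := by
  induction t with
  | zero => simp
  | succ t ih =>
    rw [Finset.sum_range_succ, Finset.sum_range_succ, ih]
    push_cast
    ring

theorem exists_round_profile {n k t : ℕ} (x : ℕ → ℝ) (hx : ∀ i, 0 ≤ x i)
    (hk : ∑ i ∈ Finset.range t, x i = k) (hn : ∑ i ∈ Finset.range t, ((i : ℝ) + 1) * x i = n) :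
    ∃ y : ℕ → ℕ, ∑ i ∈ Finset.range t, y i = k ∧ ∑ i ∈ Finset.range t, (i + 1) * y i = n ∧
      ∀ i, |(y i : ℝ) - x i| ≤ 2 := by
  let F : ℕ → ℝ := fun s => ∑ i ∈ Finset.range s, x i
  have hF : ∀ s, F (s + 1) - F s = x s := fun s => by simp [F, Finset.sum_range_succ]
  have hFsum : ∑ i ∈ Finset.range t, F i = t * k - n := by
    have h := sum_succ_mul_sub F t
    simp only [hF, hn] at h
    have hFt : F t = k := hk
    rw [hFt] at h
    linarith
  let G : ℕ → ℕ → ℤ := fun j s => if s < j then ⌊F s⌋ else ⌈F s⌉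
  have hGF : ∀ j s, |(G j s : ℝ) - F s| ≤ 1 := by
    intro j s
    have h1 := Int.floor_le (F s)
    have h2 := Int.lt_floor_add_one (F s)
    have h3 := Int.le_ceil (F s)
    have h4 := Int.ceil_lt_add_one (F s)
    rw [abs_le]
    simp only [G]
    split_ifs <;> constructor <;> linarith
  have hGmono : ∀ j s, G j s ≤ G j (s + 1) := by
    intro j s
    have hle : F s ≤ F (s + 1) := by linarith [hF s, hx s]
    simp only [G]
    split_ifs
    · exact Int.floor_le_floor hle
    · exact (Int.floor_le_floor hle).trans (Int.floor_le_ceil _)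
    · omega
    · exact Int.ceil_le_ceil hle
  let H : ℕ → ℤ := fun j => ∑ i ∈ Finset.range t, G j i
  have hH0 : (t * k - n : ℤ) ≤ H 0 := by
    have h : ∑ i ∈ Finset.range t, F i ≤ ∑ i ∈ Finset.range t, (G 0 i : ℝ) :=
      Finset.sum_le_sum fun i _ => by simpa [G] using Int.le_ceil (F i)
    rw [hFsum] at h
    exact_mod_cast h
  have hHt : H t ≤ (t * k - n : ℤ) := by
    have h : ∑ i ∈ Finset.range t, (G t i : ℝ) ≤ ∑ i ∈ Finset.range t, F i :=
      Finset.sum_le_sum fun i hi => by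
        simpa [G, Finset.mem_range.1 hi] using Int.floor_le (F i)
    rw [hFsum] at h
    exact_mod_cast h
  have hHstep : ∀ j, H j ≤ H (j + 1) + 1 := by
    intro j
    have h : H j ≤ ∑ i ∈ Finset.range t, (G (j + 1) i + if i = j then 1 else 0) := by
      refine Finset.sum_le_sum fun i _ => ?_
      have := Int.ceil_le_floor_add_one (F i)
      simp only [G]
      split_ifs <;> omega
    rw [Finset.sum_add_distrib, Finset.sum_ite_eq'] at h
    refine h.trans (add_le_add_right ?_ _)
    split_ifs <;> norm_num
  obtain ⟨j, hj⟩ : ∃ j, H j = t * k - n := by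
    classical
    have hex : ∃ j, H j ≤ (t * k - n : ℤ) := ⟨t, hHt⟩
    refine ⟨Nat.find hex, le_antisymm (Nat.find_spec hex) ?_⟩
    rcases hfind : Nat.find hex with _ | j
    · exact hH0
    · have h1 := Nat.find_min hex (m := j) (by omega)
      have h2 := hHstep j
      omega
  have hcast : ∀ i, ((G j (i + 1) - G j i).toNat : ℤ) = G j (i + 1) - G j i := fun i =>
    Int.toNat_of_nonneg (sub_nonneg.2 (hGmono j i))
  have hG0 : G j 0 = 0 := by simp [G, F]
  have hGt : G j t = k := by
    have hFt : F t = k := hk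
    simp [G, hFt]
  refine ⟨fun i => (G j (i + 1) - G j i).toNat, ?_, ?_, fun i => ?_⟩
  · zify
    simp only [hcast]
    rw [Finset.sum_range_sub, hG0, hGt, sub_zero]
  · zify
    simp only [hcast]
    rw [sum_succ_mul_sub, hGt]
    change _ - H j = _
    rw [hj]
    ring
  · have h1 : (((G j (i + 1) - G j i).toNat : ℕ) : ℝ) = G j (i + 1) - G j i := by
      exact_mod_cast congrArg (Int.cast : ℤ → ℝ) (hcast i)
    rw [h1, ← hF]
    have h2 := abs_le.1 (hGF j (i + 1))
    have h3 := abs_le.1 (hGF j i)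
    rw [abs_le]
    constructor <;> linarith

theorem exists_profile_near {n k t : ℕ} {x : Fin t → ℝ} (hx : ∀ i, 0 ≤ x i)
    (hk : ∑ i, x i = k) (hn : ∑ i, ((i.1 + 1 : ℕ) : ℝ) * x i = n) :
    ∃ y ∈ profiles n k t, ∀ i, |(y i : ℝ) - x i| ≤ 2 := by
  let x' : ℕ → ℝ := fun i => if h : i < t then x ⟨i, h⟩ else 0
  have hx' : ∀ i : Fin t, x' i = x i := fun i => by simp [x']
  obtain ⟨y, h1, h2, h3⟩ := exists_round_profile (n := n) (k := k) (t := t) x'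
    (fun i => by simp only [x']; split_ifs; exacts [hx _, le_rfl])
    (by rw [← Fin.sum_univ_eq_sum_range, ← hk]; simp [hx'])
    (by
      rw [← Fin.sum_univ_eq_sum_range (fun i => ((i : ℝ) + 1) * x' i), ← hn]
      simp [hx'])
  refine ⟨fun i => y i, mem_profiles.2 ⟨?_, ?_⟩, fun i => by simpa [hx'] using h3 i⟩
  · rw [Fin.sum_univ_eq_sum_range, h1]
  · rw [Fin.sum_univ_eq_sum_range fun i => (i + 1) * y i, h2]

theorem exists_feasible {n k t : ℕ} (hk : k < n) (hn : n < k * t) :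
    ∃ x : Fin t → ℝ, (∀ i, 0 ≤ x i) ∧ ∑ i, x i = k ∧
      ∑ i, ((i.1 + 1 : ℕ) : ℝ) * x i = n := by
  obtain ⟨m, rfl⟩ : ∃ m, t = m + 2 := by
    rcases t with _ | _ | m
    · omega
    · omega
    · exact ⟨m, rfl⟩
  have hk' : (k : ℝ) < n := by exact_mod_cast hk
  have hn' : (n : ℝ) < k * (m + 2) := by exact_mod_cast hn
  set a : ℝ := (n - k) / (m + 1) with ha
  have ha0 : 0 ≤ a := div_nonneg (by linarith) (by positivity)
  have ham : a * (m + 1) = n - k := div_mul_cancel₀ _ (by positivity)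
  have hak : a ≤ k := by
    rw [ha, div_le_iff₀ (by positivity)]
    linarith
  refine ⟨fun i => (if i = 0 then k - a else 0) + (if i = Fin.last (m + 1) then a else 0),
    fun i => ?_, ?_, ?_⟩
  · refine add_nonneg ?_ ?_ <;> split_ifs <;> linarith
  · simp [Finset.sum_add_distrib]
  · simp only [mul_add, Finset.sum_add_distrib, mul_ite, mul_zero, Finset.sum_ite_eq',
      Finset.mem_univ, if_true]
    simp only [Fin.val_zero, Fin.val_last]
    push_cast
    linarith

theorem abs_log_EE_sub_L0_le {n k t : ℕ} (hn : 2 ≤ n) (hk : k < n) (ht : n < k * t) :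
    |log (EE n k t) - L0 n k t| ≤
      t * log (n + 1) + log n + 1 + t * (5 * log n + 2 + 4 * t ^ 2) := by
  have hlog : 0 ≤ log (n : ℝ) := log_natCast_nonneg n
  have hlog' : 0 ≤ log ((n : ℝ) + 1) := log_nonneg (by linarith [Nat.cast_nonneg (α := ℝ) n])
  have hlower : ∀ x : Fin t → ℝ, (∀ i, 0 ≤ x i) → ∑ i, x i = k →
      ∑ i, ((i.1 + 1 : ℕ) : ℝ) * x i = n → 0 < EE n k t ∧
      n * log n - n + k - ∑ i, x i * log (x i * dI (i.1 + 1)) ≤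
        log (EE n k t) + t * (5 * log n + 2 + 4 * t ^ 2) := by
    intro x hx hxk hxn
    obtain ⟨y, hy, hyx⟩ := exists_profile_near hx hxk hxn
    have hle : profileTerm n y ≤ EE n k t := by
      rw [EE_eq_sum_profiles]
      exact Finset.single_le_sum (f := fun y => profileTerm n y)
        (fun y _ => (profileTerm_pos n y).le) hy
    refine ⟨(profileTerm_pos n y).trans_le hle, ?_⟩
    have hxi : ∀ i, x i ≤ n := fun i => by
      have h := Finset.single_le_sum (f := x) (fun i _ => hx i) (Finset.mem_univ i)
      have hk' : (k : ℝ) < n := by exact_mod_cast hk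
      rw [hxk] at h
      linarith
    have h1 := le_log_profileTerm hn hx hxk hxi hyx
    have h2 := log_le_log (profileTerm_pos n y) hle
    linarith
  obtain ⟨x₀, h₀, h₁, h₂⟩ := exists_feasible hk ht
  have hpos : 0 < EE n k t := (hlower x₀ h₀ h₁ h₂).1
  have hL0 : L0 n k t ≤ log (EE n k t) + t * (5 * log n + 2 + 4 * t ^ 2) := by
    refine csSup_le ⟨_, x₀, h₀, h₁, h₂, rfl⟩ ?_
    rintro L ⟨x, hx, hxk, hxn, rfl⟩
    exact (hlower x hx hxk hxn).2
  have hupper : log (EE n k t) ≤ t * log (n + 1) + (L0 n k t + (log n + 1)) := by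
    have h : EE n k t ≤ ((n : ℝ) + 1) ^ t * exp (L0 n k t + (log n + 1)) := by
      rw [EE_eq_sum_profiles]
      refine (Finset.sum_le_card_nsmul _ _ (exp (L0 n k t + (log n + 1))) fun y hy => ?_).trans ?_
      · rw [← log_le_iff_le_exp (profileTerm_pos n y)]
        exact log_profileTerm_le (by omega) hy
      · rw [nsmul_eq_mul]
        gcongr
        exact_mod_cast card_profiles_le n k t
    have h' := log_le_log hpos h
    rwa [log_mul (by positivity) (exp_ne_zero _), log_exp, log_pow] at h'
  have h3 : 0 ≤ (t : ℝ) * log (n + 1) := by positivity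
  have h4 : 0 ≤ (t : ℝ) * (5 * log n + 2 + 4 * t ^ 2) := by positivity
  rw [abs_le]
  constructor <;> linarith

/-- Suppose `t = t(n)` is a positive integer with `t(n) = O(log n)`.
Then for all sufficiently large `n` and all `k` with `1 < n/k < t(n)`,
`log E_{n,k,t} = L₀(n,k,t) + O(log⁴ n)`, uniformly in `k`. -/
theorem log_EE_eq_L0 (t : ℕ → ℕ) (ht0 : ∀ n, 0 < t n)
    (htO : ∃ C : ℝ, ∀ᶠ n : ℕ in atTop, (t n : ℝ) ≤ C * Real.log n) :
    ∃ K : ℝ, ∃ n₀ : ℕ, ∀ n : ℕ, n₀ ≤ n → ∀ k : ℕ,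
      1 < (n : ℝ) / (k : ℝ) → (n : ℝ) / (k : ℝ) < (t n : ℝ) →
      |Real.log (EE n k (t n)) - L0 (n : ℝ) (k : ℝ) (t n)| ≤ K * Real.log n ^ 4 := by
  obtain ⟨C, hC⟩ := htO
  obtain ⟨N, hN⟩ := eventually_atTop.1 hC
  refine ⟨9 * |C| + 2 + 4 * |C| ^ 3, max N 3, fun n hn k h1 h2 => ?_⟩
  have hn3 : 3 ≤ n := (le_max_right _ _).trans hn
  have hn3' : (3 : ℝ) ≤ n := by exact_mod_cast hn3
  have hk0 : (0 : ℝ) < k := by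
    rcases Nat.eq_zero_or_pos k with rfl | hk
    · norm_num at h1
    · exact_mod_cast hk
  rw [one_lt_div hk0] at h1
  rw [div_lt_iff₀ hk0, mul_comm] at h2
  refine (abs_log_EE_sub_L0_le (by omega) (by exact_mod_cast h1)
    (by exact_mod_cast h2)).trans ?_
  set l := log (n : ℝ) with hl
  have hl1 : 1 ≤ l := by
    rw [hl, le_log_iff_exp_le (by linarith)]
    linarith [Real.exp_one_lt_d9]
  have hl' : log ((n : ℝ) + 1) ≤ 2 * l := by
    rw [hl, ← Nat.cast_ofNat (n := 2), ← log_pow]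
    exact log_le_log (by positivity) (by nlinarith)
  have ht : (t n : ℝ) ≤ |C| * l := (hN n ((le_max_left _ _).trans hn)).trans
    (mul_le_mul_of_nonneg_right (le_abs_self C) (by linarith))
  have hlog' : 0 ≤ log ((n : ℝ) + 1) := log_nonneg (by linarith)
  calc (t n : ℝ) * log (n + 1) + l + 1 + t n * (5 * l + 2 + 4 * (t n : ℝ) ^ 2)
      ≤ (|C| * l) * (2 * l) + l + l + (|C| * l) * (5 * l + 2 * l + 4 * (|C| * l) ^ 2) := by
        gcongr
        exact le_mul_of_one_le_right zero_le_two hl1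
    _ = 9 * |C| * l ^ 2 + 2 * l ^ 1 + 4 * |C| ^ 3 * l ^ 3 := by ring
    _ ≤ 9 * |C| * l ^ 4 + 2 * l ^ 4 + 4 * |C| ^ 3 * l ^ 4 := by
        gcongr <;> first | exact hl1 | norm_num
    _ = _ := by ring
end
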